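/- Let κ > 5, let J = diag(−1,−1,1), and let ξ be a real symmetric 3×3 matrix with determinant 1 and signature (2,1). Then for Haar-almost every g ∈ SL(3,ℝ), setting J_Q = (g⁻¹)ᵀ J g⁻¹ (the Gram matrix of the quadratic form Q(x) = Q₀(g⁻¹x), where Q₀(x) = −x₁² − x₂² + x₃²), there exists ε₀ > 0 such that for every ε ∈ (0, ε₀) there is γ ∈ SL(3,ℤ) with ‖γᵀ J_Q γ − ξ‖ < ε and ‖γ‖ < ε^{−κ}. -/

import Mathlib

open MeasureTheory Matrix

instance : TopologicalSpace (Matrix.SpecialLinearGroup (Fin 3) ℝ) :=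
  instTopologicalSpaceSubtype

instance : MeasurableSpace (Matrix.SpecialLinearGroup (Fin 3) ℝ) := borel _

/-- The matrix `J = diag(−1,−1,1)`, the Gram matrix of `Q₀(x) = −x₁² − x₂² + x₃²`. -/
noncomputable def Jmat : Matrix (Fin 3) (Fin 3) ℝ := Matrix.diagonal ![-1, -1, 1]

open Filter Topology

set_option linter.unusedSectionVars false

/-- The group `SL(3, ℝ)`. -/
abbrev SL3 := Matrix.SpecialLinearGroup (Fin 3) ℝ

section MatrixElements

instance : BorelSpace SL3 := ⟨rfl⟩

instance : IsTopologicalGroup SL3 :=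
  Matrix.SpecialLinearGroup.topologicalGroup (n := Fin 3) (R := ℝ)

lemma SL3.continuous_mk {α : Type*} [TopologicalSpace α] {f : α → Matrix (Fin 3) (Fin 3) ℝ}
    (hf : Continuous f) (h : ∀ x, (f x).det = 1) : Continuous fun x => (⟨f x, h x⟩ : SL3) :=
  hf.subtype_mk h

lemma SL3.continuous_val : Continuous fun g : SL3 => (g : Matrix (Fin 3) (Fin 3) ℝ) :=
  continuous_subtype_val

instance : SecondCountableTopology SL3 :=
  (Topology.IsEmbedding.subtypeVal (X := Fin 3 → Fin 3 → ℝ)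
    (p := fun A => Matrix.det (Matrix.of A) = 1)).secondCountableTopology

instance : LocallyCompactSpace SL3 :=
  haveI : LocallyCompactSpace (Matrix (Fin 3) (Fin 3) ℝ) :=
    inferInstanceAs (LocallyCompactSpace (Fin 3 → Fin 3 → ℝ))
  (Matrix.SpecialLinearGroup.isClosedEmbedding_val (n := Fin 3) (R := ℝ)).locallyCompactSpace

instance : T2Space SL3 := inferInstanceAs (T2Space (Subtype _))

/-- The elementary matrix `1 + x E_{ij}`. -/
def elem {i j : Fin 3} (h : i ≠ j) (x : ℝ) : SL3 := Matrix.SpecialLinearGroup.transvection h x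

lemma elem_coe {i j : Fin 3} (h : i ≠ j) (x : ℝ) :
    (elem h x : Matrix (Fin 3) (Fin 3) ℝ) = 1 + Matrix.single i j x := rfl

lemma continuous_elem {i j : Fin 3} (h : i ≠ j) : Continuous (elem h) := by
  refine SL3.continuous_mk ?_ _
  unfold Matrix.transvection
  refine continuous_const.add ?_
  refine continuous_matrix fun a b => ?_
  by_cases hab : i = a ∧ j = b
  · simpa [Matrix.single_apply, hab] using continuous_id'
  · simpa [Matrix.single_apply, hab] using continuous_const

lemma elem_zero {i j : Fin 3} (h : i ≠ j) : elem h 0 = 1 :=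
  Matrix.SpecialLinearGroup.transvection_coeff_zero h

lemma elem_add {i j : Fin 3} (h : i ≠ j) (x y : ℝ) : elem h (x + y) = elem h x * elem h y :=
  Matrix.SpecialLinearGroup.transvection_add h x y

lemma elem_inv {i j : Fin 3} (h : i ≠ j) (x : ℝ) : (elem h x)⁻¹ = elem h (-x) :=
  Matrix.SpecialLinearGroup.transvection_inv h x

/-- The diagonal matrix `diag(x, y, (xy)⁻¹)`. -/
noncomputable def dia (x y : ℝ) (h : x ≠ 0 ∧ y ≠ 0) : SL3 :=
  ⟨Matrix.diagonal ![x, y, (x * y)⁻¹], by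
    rw [Matrix.det_diagonal, Fin.prod_univ_three]
    have := mul_ne_zero h.1 h.2
    simp only [Matrix.cons_val]
    exact mul_inv_cancel₀ this⟩

lemma dia_coe (x y : ℝ) (h : x ≠ 0 ∧ y ≠ 0) :
    (dia x y h : Matrix (Fin 3) (Fin 3) ℝ) = Matrix.diagonal ![x, y, (x * y)⁻¹] := rfl

lemma SL3.ext' {g h : SL3} (H : ∀ i j, (g : Matrix (Fin 3) (Fin 3) ℝ) i j = h i j) : g = h :=
  Subtype.ext (Matrix.ext H)

/-- Diagonal matrices in `SL(3)` are products of elementary matrices. -/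
lemma dia_eq_prod (x y : ℝ) (h : x ≠ 0 ∧ y ≠ 0) :
    dia x y h =
      (elem (show (0 : Fin 3) ≠ 1 by decide) 1 * elem (show (1 : Fin 3) ≠ 0 by decide) (x - 1) *
        elem (show (0 : Fin 3) ≠ 1 by decide) (-1 / x) *
        elem (show (1 : Fin 3) ≠ 0 by decide) (-(x - 1) * x)) *
      (elem (show (1 : Fin 3) ≠ 2 by decide) 1 *
        elem (show (2 : Fin 3) ≠ 1 by decide) (x * y - 1) *
        elem (show (1 : Fin 3) ≠ 2 by decide) (-1 / (x * y)) *
        elem (show (2 : Fin 3) ≠ 1 by decide) (-(x * y - 1) * (x * y))) := by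
  obtain ⟨hx, hy⟩ := h
  apply SL3.ext'
  intro i j
  simp only [Matrix.SpecialLinearGroup.coe_mul, elem_coe, dia_coe]
  fin_cases i <;> fin_cases j <;>
    simp [Matrix.mul_apply, Fin.sum_univ_three, Matrix.single_apply, Matrix.one_apply] <;>
    field_simp <;> ring_nf <;> simp

/-- A subgroup of `SL(3, ℝ)` containing all elementary matrices is everything. -/
lemma subgroup_eq_top_of_elem (H : Subgroup SL3)
    (hH : ∀ (i j : Fin 3) (h : i ≠ j) (x : ℝ), elem h x ∈ H) : H = ⊤ := by
  rw [Subgroup.eq_top_iff']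
  intro g
  suffices h : ∃ g' ∈ H, (g' : Matrix (Fin 3) (Fin 3) ℝ) = g by
    obtain ⟨g', hg', hgg⟩ := h
    rwa [← show g' = g from Subtype.ext hgg]
  refine Matrix.diagonal_transvection_induction
    (fun M => ∃ g ∈ H, (g : Matrix (Fin 3) (Fin 3) ℝ) = M)
    (g : Matrix (Fin 3) (Fin 3) ℝ) ?_ ?_ ?_
  · intro D hD
    rw [g.2, Matrix.det_diagonal, Fin.prod_univ_three] at hD
    have h0 : D 0 ≠ 0 := by rintro h; simp [h] at hD
    have h1 : D 1 ≠ 0 := by rintro h; simp [h] at hD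
    refine ⟨dia (D 0) (D 1) ⟨h0, h1⟩, ?_, ?_⟩
    · rw [dia_eq_prod]
      exact H.mul_mem (H.mul_mem (H.mul_mem (H.mul_mem (hH _ _ _ _) (hH _ _ _ _)) (hH _ _ _ _))
        (hH _ _ _ _)) (H.mul_mem (H.mul_mem (H.mul_mem (hH _ _ _ _) (hH _ _ _ _)) (hH _ _ _ _))
        (hH _ _ _ _))
    · simp only [dia]
      congr 1
      ext i
      fin_cases i
      · rfl
      · rfl
      · simpa using (eq_inv_of_mul_eq_one_right hD).symm
  · intro t
    exact ⟨elem t.hij t.c, hH _ _ _ _, rfl⟩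
  · rintro A B ⟨a, ha, rfl⟩ ⟨b, hb, rfl⟩
    exact ⟨a * b, H.mul_mem ha hb, rfl⟩

end MatrixElements

section Mautner

variable {V : Type*} [NormedAddCommGroup V] [InnerProductSpace ℂ V]

open scoped InnerProductSpace

/-- The closed subspace of invariant vectors. -/
def invVec (π : SL3 →* (V ≃ₗᵢ[ℂ] V)) : Submodule ℂ V where
  carrier := {v | ∀ g, π g v = v}
  add_mem' := fun ha hb g => by rw [map_add, ha g, hb g]
  zero_mem' := fun g => map_zero _
  smul_mem' := fun c v hv g => by rw [map_smul, hv g]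

/-- The stabilizer of a vector. -/
def stabVec (π : SL3 →* (V ≃ₗᵢ[ℂ] V)) (v : V) : Subgroup SL3 where
  carrier := {g | π g v = v}
  mul_mem' := fun {a b} ha hb => by
    change π (a * b) v = v
    rw [map_mul]
    change π a (π b v) = v
    rw [show π b v = v from hb, show π a v = v from ha]
  one_mem' := by simp
  inv_mem' := fun {a} ha => by
    change π a⁻¹ v = v
    rw [map_inv]
    nth_rewrite 1 [← show π a v = v from ha]
    change ((π a)⁻¹ * π a) v = v
    rw [inv_mul_cancel]
    rfl

lemma mem_stabVec {π : SL3 →* (V ≃ₗᵢ[ℂ] V)} {v : V} {g : SL3} : g ∈ stabVec π v ↔ π g v = v :=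
  Iff.rfl

lemma pi_mul_apply (π : SL3 →* (V ≃ₗᵢ[ℂ] V)) (g h : SL3) (u : V) :
    π (g * h) u = π g (π h u) := by rw [map_mul]; rfl

lemma inner_pi_left (π : SL3 →* (V ≃ₗᵢ[ℂ] V)) (g : SL3) (u w : V) :
    ⟪π g u, w⟫_ℂ = ⟪u, π g⁻¹ w⟫_ℂ := by
  rw [← LinearIsometryEquiv.inner_map_map (π g) u (π g⁻¹ w), ← pi_mul_apply,
    mul_inv_cancel, map_one]
  rfl

lemma eq_of_inner_eq_norm_sq {a b : V} (hab : ‖a‖ = ‖b‖) (h : ⟪a, b⟫_ℂ = (‖b‖ : ℂ) ^ 2) :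
    a = b := by
  rw [← sub_eq_zero, ← norm_eq_zero, ← sq_eq_zero_iff, @norm_sub_sq ℂ, h, hab]
  have : RCLike.re ((‖b‖ : ℂ) ^ 2) = ‖b‖ ^ 2 := by
    rw [← Complex.ofReal_pow]; exact Complex.ofReal_re _
  rw [this]; ring

/-- The product of two sequences of stabilizing elements around a sequence tending to `1`
has its limit in the stabilizer. -/
lemma mem_stabVec_of_tendsto {π : SL3 →* (V ≃ₗᵢ[ℂ] V)} (hπ : ∀ v, Continuous fun g => π g v)
    {v : V} {a b e : ℕ → SL3} {d : SL3} (ha : ∀ n, a n ∈ stabVec π v) (hb : ∀ n, b n ∈ stabVec π v)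
    (he : Tendsto e atTop (𝓝 1)) (hd : Tendsto (fun n => a n * e n * b n) atTop (𝓝 d)) :
    d ∈ stabVec π v := by
  rw [mem_stabVec]
  refine eq_of_inner_eq_norm_sq (LinearIsometryEquiv.norm_map _ _) ?_
  have h1 : Tendsto (fun n => ⟪π (a n * e n * b n) v, v⟫_ℂ) atTop (𝓝 ⟪π d v, v⟫_ℂ) :=
    (((hπ v).tendsto d).comp hd).inner tendsto_const_nhds
  have h2 : Tendsto (fun n => ⟪π (e n) v, v⟫_ℂ) atTop (𝓝 ⟪π 1 v, v⟫_ℂ) :=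
    (((hπ v).tendsto 1).comp he).inner tendsto_const_nhds
  have h3 : ∀ n, ⟪π (a n * e n * b n) v, v⟫_ℂ = ⟪π (e n) v, v⟫_ℂ := by
    intro n
    rw [pi_mul_apply, pi_mul_apply, mem_stabVec.1 (hb n), inner_pi_left,
      mem_stabVec.1 ((stabVec π v).inv_mem (ha n))]
  simp_rw [h3] at h1
  rw [tendsto_nhds_unique h1 h2, map_one, LinearIsometryEquiv.coe_one, id,
    inner_self_eq_norm_sq_to_K]
  rfl

lemma ne01 : (0 : Fin 3) ≠ 1 := by decide
lemma ne10 : (1 : Fin 3) ≠ 0 := by decide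

lemma elem_int_mem {π : SL3 →* (V ≃ₗᵢ[ℂ] V)} {v : V} (hv : π (elem ne01 1) v = v) (n : ℤ) :
    elem ne01 n ∈ stabVec π v := by
  have h : ∀ n : ℕ, elem ne01 n ∈ stabVec π v := by
    intro n
    induction n with
    | zero => simp [elem_zero, (stabVec π v).one_mem]
    | succ k ih => rw [Nat.cast_succ, elem_add]; exact (stabVec π v).mul_mem ih hv
  obtain ⟨k, rfl | rfl⟩ := n.eq_nat_or_neg
  · simpa using h k
  · have := (stabVec π v).inv_mem (h k)
    rw [elem_inv] at this
    simpa using this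

lemma dia_conj_elem (n : ℕ) {i j : Fin 3} (h : i ≠ j) (x : ℝ) :
    (dia 2 (1/2) (by norm_num))⁻¹ ^ n * elem h x * dia 2 (1/2) (by norm_num) ^ n =
      elem h ((![2, 1/2, 1] i)⁻¹ ^ n * ![2, 1/2, 1] j ^ n * x) := by
  set d := dia 2 (1/2) (by norm_num) with hd
  rw [inv_pow, mul_assoc, inv_mul_eq_iff_eq_mul]
  have hdn : ((d ^ n : SL3) : Matrix (Fin 3) (Fin 3) ℝ) =
      Matrix.diagonal (fun k => (![2, 1/2, 1] k : ℝ) ^ n) := by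
    rw [Matrix.SpecialLinearGroup.coe_pow, hd, dia]
    simp only [Matrix.diagonal_pow]
    congr 1
    ext k
    fin_cases k <;> simp
  apply Subtype.ext
  simp only [Matrix.SpecialLinearGroup.coe_mul, elem_coe, hdn, mul_add, add_mul, mul_one, one_mul]
  congr 1
  ext a b
  rw [Matrix.mul_diagonal, Matrix.diagonal_mul, Matrix.single_apply, Matrix.single_apply]
  have h0 : (![2, 1/2, 1] i : ℝ) ≠ 0 := by fin_cases i <;> simp
  split_ifs with hab
  · rw [← hab.1, ← hab.2, ← mul_assoc, ← mul_assoc, ← mul_pow, mul_inv_cancel₀ h0, one_pow,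
      one_mul, mul_comm]
  · simp

/-- **Mautner phenomenon**: a vector fixed by one elementary matrix is fixed by `SL(3, ℝ)`. -/
theorem mem_invVec_of_elem {π : SL3 →* (V ≃ₗᵢ[ℂ] V)} (hπ : ∀ v, Continuous fun g => π g v)
    {v : V} (hv : π (elem ne01 1) v = v) : v ∈ invVec π := by
  have hd : dia 2 (1/2) (by norm_num) ∈ stabVec π v := by
    refine mem_stabVec_of_tendsto hπ (a := fun n => elem ne01 ((2 * (n + 1 : ℕ) : ℤ) : ℝ))
      (b := fun n => elem ne01 ((-(n + 1 : ℕ) : ℤ) : ℝ))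
      (e := fun n => elem ne10 (1 / 2 * (1 / ((n : ℝ) + 1))))
      (fun n => elem_int_mem hv _) (fun n => elem_int_mem hv _) ?_ ?_
    · rw [← elem_zero ne10]
      refine ((continuous_elem ne10).tendsto 0).comp ?_
      simpa using (tendsto_one_div_add_atTop_nhds_zero_nat (𝕜 := ℝ)).const_mul (2 : ℝ)⁻¹
    · have h : ∀ n : ℕ, elem ne01 ((2 * (n + 1 : ℕ) : ℤ) : ℝ) *
          elem ne10 (1 / 2 * (1 / ((n : ℝ) + 1))) * elem ne01 ((-(n + 1 : ℕ) : ℤ) : ℝ) =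
          dia 2 (1/2) (by norm_num) * elem ne10 (1 * (1 / ((n : ℝ) + 1))) := by
        intro n
        have hn : (n : ℝ) + 1 ≠ 0 := by positivity
        apply SL3.ext'
        intro i j
        simp only [Matrix.SpecialLinearGroup.coe_mul, elem_coe, dia_coe]
        fin_cases i <;> fin_cases j <;>
          simp [Matrix.mul_apply, Fin.sum_univ_three, Matrix.single_apply, Matrix.one_apply] <;>
          field_simp <;> ring
      simp_rw [h]
      have h1 : Tendsto (fun n : ℕ => elem ne10 (1 * (1 / ((n : ℝ) + 1)))) atTop (𝓝 1) := by
        rw [← elem_zero ne10]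
        refine ((continuous_elem ne10).tendsto 0).comp ?_
        simpa using (tendsto_one_div_add_atTop_nhds_zero_nat (𝕜 := ℝ))
      simpa using (tendsto_const_nhds (x := dia 2 (1/2) (by norm_num))).mul h1
  have hall : ∀ (i j : Fin 3) (h : i ≠ j) (x : ℝ), elem h x ∈ stabVec π v := by
    intro i j h x
    have key : ∀ (r : ℝ) (i j : Fin 3) (h : i ≠ j) (x : ℝ), |r| < 1 →
        (∀ n : ℕ, (![2, 1/2, 1] i : ℝ)⁻¹ ^ n * ![2, 1/2, 1] j ^ n = r ^ n) →
        elem h x ∈ stabVec π v := by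
      intro r i j h x hr1 hr
      refine mem_stabVec_of_tendsto hπ (a := fun n => dia 2 (1/2) (by norm_num) ^ n)
        (b := fun n => (dia 2 (1/2) (by norm_num))⁻¹ ^ n)
        (e := fun n => (dia 2 (1/2) (by norm_num))⁻¹ ^ n * elem h x * dia 2 (1/2) (by norm_num) ^ n)
        (fun n => (stabVec π v).pow_mem hd n)
        (fun n => (stabVec π v).pow_mem ((stabVec π v).inv_mem hd) n) ?_ ?_
      · simp_rw [dia_conj_elem, hr]
        rw [← elem_zero h]
        refine ((continuous_elem h).tendsto 0).comp ?_
        simpa using (tendsto_pow_atTop_nhds_zero_of_abs_lt_one hr1).mul_const x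
      · have : ∀ n : ℕ, dia 2 (1/2) (by norm_num) ^ n * ((dia 2 (1/2) (by norm_num))⁻¹ ^ n *
          elem h x * dia 2 (1/2) (by norm_num) ^ n) * (dia 2 (1/2) (by norm_num))⁻¹ ^ n =
            elem h x := by
          intro n; group
        simp_rw [this]
        exact tendsto_const_nhds
    have key' : ∀ (r : ℝ) (i j : Fin 3) (h : i ≠ j) (x : ℝ), |r| < 1 →
        (∀ n : ℕ, (![2, 1/2, 1] j : ℝ)⁻¹ ^ n * ![2, 1/2, 1] i ^ n = r ^ n) →
        elem h x ∈ stabVec π v := by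
      intro r i j h x hr1 hr
      refine mem_stabVec_of_tendsto hπ (a := fun n => (dia 2 (1/2) (by norm_num))⁻¹ ^ n)
        (b := fun n => (dia 2 (1/2) (by norm_num)) ^ n)
        (e := fun n => (dia 2 (1/2) (by norm_num)) ^ n * elem h x *
          (dia 2 (1/2) (by norm_num))⁻¹ ^ n)
        (fun n => (stabVec π v).pow_mem ((stabVec π v).inv_mem hd) n)
        (fun n => (stabVec π v).pow_mem hd n) ?_ ?_
      · have : ∀ n : ℕ, (dia 2 (1/2) (by norm_num)) ^ n * elem h x *
            (dia 2 (1/2) (by norm_num))⁻¹ ^ n = elem h (r ^ n * x) := by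
          intro n
          have h1 := dia_conj_elem n h (r ^ n * x)
          have h0 : (![2, 1/2, 1] i : ℝ) ≠ 0 := by fin_cases i <;> simp
          have h0' : (![2, 1/2, 1] j : ℝ) ≠ 0 := by fin_cases j <;> simp
          have h2 : (![2, 1/2, 1] i : ℝ)⁻¹ ^ n * ![2, 1/2, 1] j ^ n * (r ^ n * x) = x := by
            rw [← hr]
            generalize (![2, 1/2, 1] i : ℝ) = p at *
            generalize (![2, 1/2, 1] j : ℝ) = q at *
            rw [inv_pow, inv_pow]
            field_simp
          rw [h2] at h1
          rw [← h1]; group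
        simp_rw [this]
        rw [← elem_zero h]
        refine ((continuous_elem h).tendsto 0).comp ?_
        simpa using (tendsto_pow_atTop_nhds_zero_of_abs_lt_one hr1).mul_const x
      · have : ∀ n : ℕ, (dia 2 (1/2) (by norm_num))⁻¹ ^ n * ((dia 2 (1/2) (by norm_num)) ^ n *
          elem h x * (dia 2 (1/2) (by norm_num))⁻¹ ^ n) * (dia 2 (1/2) (by norm_num)) ^ n =
            elem h x := by
          intro n; group
        simp_rw [this]
        exact tendsto_const_nhds
    rcases lt_trichotomy |((![2, 1/2, 1] i : ℝ)⁻¹ * ![2, 1/2, 1] j)| 1 with hlt | heq | hgt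
    · exact key _ i j h x hlt fun n => by rw [mul_pow]
    · exfalso
      fin_cases i <;> fin_cases j <;> norm_num at heq <;> exact h rfl
    · refine key' ((![2, 1/2, 1] j : ℝ)⁻¹ * ![2, 1/2, 1] i) i j h x ?_ fun n => by rw [mul_pow]
      have : ((![2, 1/2, 1] j : ℝ)⁻¹ * ![2, 1/2, 1] i) =
          ((![2, 1/2, 1] i : ℝ)⁻¹ * ![2, 1/2, 1] j)⁻¹ := by rw [mul_inv, inv_inv, mul_comm]
      rw [this, abs_inv]
      exact inv_lt_one_of_one_lt₀ hgt
  intro g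
  have := subgroup_eq_top_of_elem _ hall
  exact mem_stabVec.1 (this ▸ Subgroup.mem_top g)

end Mautner

section Plancherel

open FourierTransform SchwartzMap
open scoped InnerProductSpace ContDiff

variable {E F : Type*} [NormedAddCommGroup E] [InnerProductSpace ℝ E] [FiniteDimensional ℝ E]
  [MeasurableSpace E] [BorelSpace E]
  [NormedAddCommGroup F] [InnerProductSpace ℂ F] [CompleteSpace F]

/-- On `L¹ ∩ L²` the `L²` Fourier transform is given by the Fourier integral. -/
lemma fourier_toLp_ae_eq {f : E → F} (h1 : Integrable f) (h2 : MemLp f 2) :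
    ((𝓕 (h2.toLp f) : Lp F 2 (volume : Measure E)) : E → F) =ᵐ[volume] 𝓕 f := by
  have hcont : Continuous (𝓕 f) :=
    VectorFourier.fourierIntegral_continuous Real.continuous_fourierChar
      (by exact continuous_inner) h1
  refine ae_eq_of_integral_contDiff_smul_eq ?_ hcont.locallyIntegrable ?_
  · exact (Lp.memLp _).locallyIntegrable (by norm_num)
  intro g hg hgc
  let g' : 𝓢(E, ℂ) := HasCompactSupport.toSchwartzMap (f := fun x => (g x : ℂ))
    (hgc.comp_left (g := fun r : ℝ => (r : ℂ)) rfl) (Complex.ofRealCLM.contDiff.comp hg)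
  have hg' : ∀ x, g' x = (g x : ℂ) := fun x => rfl
  have e1 : ∀ x (w : F), g x • w = g' x • w := fun x w => by
    rw [hg', Complex.coe_smul]
  simp_rw [e1]
  have h3 := congrArg (fun T => T g') (Lp.fourier_toTemperedDistribution_eq (h2.toLp f))
  simp only [TemperedDistribution.fourier_apply, Lp.toTemperedDistribution_apply] at h3
  rw [← h3]
  have h4 := VectorFourier.integral_fourierIntegral_smul_eq_flip (L := innerₗ E) (μ := volume)
    (ν := volume) Real.continuous_fourierChar continuous_inner g'.integrable h1
  have h5 : ∀ x, VectorFourier.fourierIntegral Real.fourierChar volume (innerₗ E).flip f x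
      = 𝓕 f x := by
    intro x
    simp only [VectorFourier.fourierIntegral, Real.fourier_eq, LinearMap.flip_apply,
      innerₗ_apply_apply, real_inner_comm]
  simp_rw [h5] at h4
  rw [← h4]
  refine integral_congr_ae ?_
  filter_upwards [h2.coeFn_toLp] with x hx
  rw [hx, SchwartzMap.fourier_coe]
  rfl

lemma memLp_fourier {f : E → F} (h1 : Integrable f) (h2 : MemLp f 2) : MemLp (𝓕 f) 2 :=
  (memLp_congr_ae (fourier_toLp_ae_eq h1 h2)).1 (Lp.memLp _)

/-- **Plancherel** for vector valued functions in `L¹ ∩ L²`. -/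
lemma integral_inner_fourier_fourier {f h : E → F} (f1 : Integrable f) (f2 : MemLp f 2)
    (h1 : Integrable h) (h2 : MemLp h 2) :
    ∫ ξ, ⟪𝓕 f ξ, 𝓕 h ξ⟫_ℂ = ∫ x, ⟪f x, h x⟫_ℂ := by
  have := Lp.inner_fourier_eq (f2.toLp f) (h2.toLp h)
  rw [L2.inner_def, L2.inner_def] at this
  rw [integral_congr_ae (g := fun ξ => ⟪(𝓕 (f2.toLp f) : Lp F 2 (volume : Measure E)) ξ,
    (𝓕 (h2.toLp h) : Lp F 2 (volume : Measure E)) ξ⟫_ℂ), this]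
  · refine integral_congr_ae ?_
    filter_upwards [f2.coeFn_toLp, h2.coeFn_toLp] with x hx hx'
    rw [hx, hx']
  · filter_upwards [fourier_toLp_ae_eq f1 f2, fourier_toLp_ae_eq h1 h2] with x hx hx'
    rw [hx, hx']

end Plancherel

section Levy

variable {E : Type*} [NormedAddCommGroup E] [InnerProductSpace ℝ E] [FiniteDimensional ℝ E]
  [MeasurableSpace E] [BorelSpace E]

/-- A sequence of probability measures whose characteristic functions converge to a function
continuous at `0` converges weakly. -/
lemma exists_tendsto_of_tendsto_charFun {μ : ℕ → ProbabilityMeasure E} {f : E → ℂ}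
    (hf : ContinuousAt f 0)
    (h : ∀ t, Tendsto (fun n => charFun (μ n : Measure E) t) atTop (𝓝 (f t))) :
    ∃ ν : ProbabilityMeasure E, (∀ t, charFun (ν : Measure E) t = f t) ∧
      Tendsto μ atTop (𝓝 ν) := by
  have htight := isTightMeasureSet_of_tendsto_charFun hf h
  have hcomp : IsCompact (closure (Set.range μ)) := by
    apply isCompact_closure_of_isTightMeasureSet
    convert htight using 1
    ext m
    simp
  obtain ⟨ν, -, hν⟩ := isCompact_iff_ultrafilter_le_nhds.1 hcomp (Ultrafilter.of (map μ atTop))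
    (by
      rw [le_principal_iff]
      refine Ultrafilter.of_le _ ?_
      rw [mem_map]
      exact Filter.univ_mem' fun n => subset_closure ⟨n, rfl⟩)
  have hchar : ∀ t, charFun (ν : Measure E) t = f t := by
    intro t
    have h1 : Tendsto (fun m : ProbabilityMeasure E => charFun (m : Measure E) t)
        (𝓝 ν) (𝓝 (charFun (ν : Measure E) t)) := by
      have := (ProbabilityMeasure.tendsto_iff_forall_integral_rclike_tendsto ℂ
        (F := 𝓝 ν) (μs := id) (μ := ν)).1 tendsto_id (BoundedContinuousFunction.innerProbChar t)
      simp_rw [charFun_eq_integral_innerProbChar]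
      exact this
    have h2 : Tendsto (fun m : ProbabilityMeasure E => charFun (m : Measure E) t)
        (Ultrafilter.of (map μ atTop) : Filter _) (𝓝 (f t)) :=
      (tendsto_map'_iff.2 (h t)).mono_left (Ultrafilter.of_le _)
    exact tendsto_nhds_unique (h1.mono_left hν) h2
  refine ⟨ν, hchar, ProbabilityMeasure.tendsto_of_tendsto_charFun fun t => ?_⟩
  rw [hchar]
  exact h t

end Levy

section Spectral

open FourierTransform
open scoped InnerProductSpace

variable {E V : Type*} [NormedAddCommGroup E] [InnerProductSpace ℝ E] [FiniteDimensional ℝ E]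
  [MeasurableSpace E] [BorelSpace E]
  [NormedAddCommGroup V] [InnerProductSpace ℂ V] [CompleteSpace V]

/-- The Gaussian window. -/
noncomputable def gw (a : ℝ) (x : E) : ℝ := Real.exp (-a * ‖x‖ ^ 2)

lemma gw_pos (a : ℝ) (x : E) : 0 < gw a x := Real.exp_pos _

lemma continuous_gw (a : ℝ) : Continuous (gw a : E → ℝ) := by unfold gw; fun_prop

lemma integrable_gw {a : ℝ} (ha : 0 < a) : Integrable (gw a : E → ℝ) := by
  have h := (GaussianFourier.integrable_cexp_neg_mul_sq_norm_add (V := E) (b := (a : ℂ))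
    (by simpa using ha) 0 0).norm
  refine h.congr (ae_of_all _ fun x => ?_)
  simp only [Complex.norm_exp, gw]
  congr 1
  simp [← Complex.ofReal_pow]

/-- The total mass of the squared Gaussian window. -/
noncomputable def gmass (E : Type*) [NormedAddCommGroup E] [InnerProductSpace ℝ E]
    [FiniteDimensional ℝ E] [MeasurableSpace E] [BorelSpace E] (a : ℝ) : ℝ :=
  ∫ x : E, gw (2 * a) x

lemma gmass_pos {a : ℝ} (ha : 0 < a) : 0 < gmass E a := by
  refine (integral_pos_iff_support_of_nonneg (fun x => (gw_pos _ x).le)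
    (integrable_gw (by positivity))).2 ?_
  have : Function.support (gw (2 * a) : E → ℝ) = Set.univ := by
    ext x; simp [(gw_pos _ x).ne']
  rw [this]
  exact Measure.measure_univ_pos.2 (NeZero.ne _)

lemma integral_gw_mul_gw (a : ℝ) (z : E) :
    ∫ x, gw a x * gw a (x + z) = Real.exp (-a * ‖z‖ ^ 2 / 2) * gmass E a := by
  have h : ∀ x : E, gw a x * gw a (x + z) =
      Real.exp (-a * ‖z‖ ^ 2 / 2) * gw (2 * a) (x + (2 : ℝ)⁻¹ • z) := by
    intro x
    simp only [gw]
    rw [← Real.exp_add, ← Real.exp_add]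
    congr 1
    rw [norm_add_sq_real, norm_add_sq_real, inner_smul_right, norm_smul]
    norm_num
    ring
  simp_rw [h]
  rw [integral_const_mul, integral_add_right_eq_self (fun x : E => gw (2 * a) x)]
  rfl

variable {τ : E → (V ≃ₗᵢ[ℂ] V)}

/-- The orbit map cut off by a Gaussian. -/
noncomputable def cutOrbit (τ : E → (V ≃ₗᵢ[ℂ] V)) (a : ℝ) (u : V) (x : E) : V :=
  (gw a x : ℂ) • τ x u

lemma norm_cutOrbit (a : ℝ) (u : V) (x : E) : ‖cutOrbit τ a u x‖ = gw a x * ‖u‖ := by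
  rw [cutOrbit, norm_smul, LinearIsometryEquiv.norm_map, Complex.norm_real, Real.norm_eq_abs,
    abs_of_pos (gw_pos _ _)]

lemma continuous_cutOrbit (hcont : ∀ u, Continuous fun x => τ x u) (a : ℝ) (u : V) :
    Continuous (cutOrbit τ a u) := by
  unfold cutOrbit
  exact (Complex.continuous_ofReal.comp (continuous_gw a)).smul (hcont u)

lemma integrable_cutOrbit (hcont : ∀ u, Continuous fun x => τ x u) {a : ℝ} (ha : 0 < a) (u : V) :
    Integrable (cutOrbit τ a u) := by
  refine (integrable_norm_iff (continuous_cutOrbit hcont a u).aestronglyMeasurable).1 ?_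
  simp_rw [norm_cutOrbit]
  exact (integrable_gw ha).mul_const _

lemma memLp_cutOrbit (hcont : ∀ u, Continuous fun x => τ x u) {a : ℝ} (ha : 0 < a) (u : V) :
    MemLp (cutOrbit τ a u) 2 := by
  refine (memLp_two_iff_integrable_sq_norm
    (continuous_cutOrbit hcont a u).aestronglyMeasurable).2 ?_
  have h : ∀ x : E, ‖cutOrbit τ a u x‖ ^ 2 = gw (2 * a) x * ‖u‖ ^ 2 := by
    intro x
    rw [norm_cutOrbit, mul_pow]
    congr 1
    rw [gw, gw, ← Real.exp_nat_mul]
    congr 1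
    push_cast; ring
  simp_rw [h]
  exact (integrable_gw (by positivity)).mul_const _

/-- The windowed Fourier transform of an orbit map. -/
noncomputable def winF (τ : E → (V ≃ₗᵢ[ℂ] V)) (a : ℝ) (u : V) (ξ : E) : V :=
  𝓕 (cutOrbit τ a u) ξ

lemma continuous_winF (hcont : ∀ u, Continuous fun x => τ x u) {a : ℝ} (ha : 0 < a) (u : V) :
    Continuous (winF τ a u) :=
  VectorFourier.fourierIntegral_continuous Real.continuous_fourierChar
      (by exact continuous_inner) (integrable_cutOrbit hcont ha u)

lemma memLp_winF (hcont : ∀ u, Continuous fun x => τ x u) {a : ℝ} (ha : 0 < a) (u : V) :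
    MemLp (winF τ a u) 2 :=
  memLp_fourier (integrable_cutOrbit hcont ha u) (memLp_cutOrbit hcont ha u)

lemma norm_winF_le (a : ℝ) (u : V) (ξ : E) :
    ‖winF τ a u ξ‖ ≤ (∫ x : E, gw a x) * ‖u‖ := by
  refine (VectorFourier.norm_fourierIntegral_le_integral_norm _ _ _ _ _).trans ?_
  simp_rw [norm_cutOrbit]
  rw [integral_mul_const]

/-- The windowed Fourier transform at a fixed frequency as a bounded operator. -/
noncomputable def winFL (τ : E → (V ≃ₗᵢ[ℂ] V)) (hcont : ∀ u, Continuous fun x => τ x u)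
    {a : ℝ} (ha : 0 < a) (ξ : E) : V →L[ℂ] V :=
  LinearMap.mkContinuous
    { toFun := fun u => winF τ a u ξ
      map_add' := fun u w => by
        simp only [winF]
        have : cutOrbit τ a (u + w) = cutOrbit τ a u + cutOrbit τ a w := by
          ext x; simp [cutOrbit]
        rw [this]
        exact congrFun (VectorFourier.fourierIntegral_add Real.continuous_fourierChar
          (by exact continuous_inner) (integrable_cutOrbit hcont ha u)
          (integrable_cutOrbit hcont ha w)) ξ
      map_smul' := fun c u => by
        simp only [winF, RingHom.id_apply]
        have : cutOrbit τ a (c • u) = c • cutOrbit τ a u := by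
          ext x; simp only [cutOrbit, map_smul, Pi.smul_apply]; rw [smul_comm]
        rw [this, ← Pi.smul_apply]
        exact congrFun (VectorFourier.fourierIntegral_const_smul _ _ _ _ _) ξ }
    (∫ x : E, gw a x) (fun u => norm_winF_le a u ξ)

lemma winFL_apply (hcont : ∀ u, Continuous fun x => τ x u) {a : ℝ} (ha : 0 < a) (ξ : E) (u : V) :
    winFL τ hcont ha ξ u = winF τ a u ξ := rfl

lemma continuous_winF_prod (hcont : ∀ u, Continuous fun x => τ x u) {a : ℝ} (ha : 0 < a) :
    Continuous fun p : V × E => winF τ a p.1 p.2 := by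
  refine continuous_prod_of_continuous_lipschitzWith _ (∫ x : E, gw a x).toNNReal
    (fun u => continuous_winF hcont ha u) (fun ξ => ?_)
  refine LipschitzWith.of_dist_le_mul fun u w => ?_
  simp only [dist_eq_norm]
  rw [← winFL_apply hcont ha, ← winFL_apply hcont ha, ← map_sub]
  rw [Real.coe_toNNReal _ (integral_nonneg fun x => (gw_pos _ _).le)]
  exact norm_winF_le a _ ξ

lemma integral_inner_winF (hcont : ∀ u, Continuous fun x => τ x u) {a : ℝ} (ha : 0 < a)
    (u w : V) : ∫ ξ, ⟪winF τ a u ξ, winF τ a w ξ⟫_ℂ = gmass E a * ⟪u, w⟫_ℂ := by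
  unfold winF
  rw [integral_inner_fourier_fourier (integrable_cutOrbit hcont ha u) (memLp_cutOrbit hcont ha u)
    (integrable_cutOrbit hcont ha w) (memLp_cutOrbit hcont ha w)]
  have h : ∀ x : E, ⟪cutOrbit τ a u x, cutOrbit τ a w x⟫_ℂ =
      ((gw a x * gw a (x + 0) : ℝ) : ℂ) * ⟪u, w⟫_ℂ := by
    intro x
    simp only [cutOrbit, inner_smul_left, inner_smul_right, LinearIsometryEquiv.inner_map_map,
      Complex.conj_ofReal, add_zero]
    push_cast; ring
  simp_rw [h]
  rw [integral_mul_const, integral_complex_ofReal, integral_gw_mul_gw]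
  simp

lemma integral_exp_mul_winF (hadd : ∀ x y u, τ (x + y) u = τ x (τ y u))
    (hcont : ∀ u, Continuous fun x => τ x u) {a : ℝ} (ha : 0 < a) (u : V) (t : E) :
    ∫ ξ, Complex.exp (⟪ξ, t⟫_ℝ * Complex.I) * (‖winF τ a u ξ‖ ^ 2 : ℝ) =
      Real.exp (-a * ‖(2 * Real.pi)⁻¹ • t‖ ^ 2 / 2) * gmass E a *
        ⟪u, τ ((2 * Real.pi)⁻¹ • t) u⟫_ℂ := by
  set z := (2 * Real.pi)⁻¹ • t with hz
  have hpre := integral_inner_fourier_fourier (integrable_cutOrbit hcont ha u)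
    (memLp_cutOrbit hcont ha u) ((integrable_cutOrbit hcont ha u).comp_add_right z)
    ((memLp_cutOrbit hcont ha u).comp_measurePreserving
      (measurePreserving_add_right volume z))
  have h1 : ∀ ξ : E, ⟪𝓕 (cutOrbit τ a u) ξ, 𝓕 (cutOrbit τ a u ∘ fun x => x + z) ξ⟫_ℂ =
      Complex.exp (⟪ξ, t⟫_ℝ * Complex.I) * (‖winF τ a u ξ‖ ^ 2 : ℝ) := by
    intro ξ
    have h2 := congrFun (VectorFourier.fourierIntegral_comp_add_right Real.fourierChar
      (volume : Measure E) (innerₗ E) (cutOrbit τ a u) z) ξ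
    change ⟪𝓕 (cutOrbit τ a u) ξ, VectorFourier.fourierIntegral Real.fourierChar
      (volume : Measure E) (innerₗ E) (cutOrbit τ a u ∘ fun x => x + z) ξ⟫_ℂ = _
    rw [h2, Circle.smul_def, inner_smul_right]
    congr 1
    · rw [Real.fourierChar_apply]
      congr 2
      simp only [innerₗ_apply_apply, hz, inner_smul_left]
      rw [real_inner_comm]
      norm_cast
      simp only [conj_trivial]
      field_simp
    · change ⟪winF τ a u ξ, winF τ a u ξ⟫_ℂ = _
      rw [inner_self_eq_norm_sq_to_K]
      norm_cast
  have h3 : ∀ x : E, ⟪cutOrbit τ a u x, cutOrbit τ a u (x + z)⟫_ℂ =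
      ((gw a x * gw a (x + z) : ℝ) : ℂ) * ⟪u, τ z u⟫_ℂ := by
    intro x
    simp only [cutOrbit, inner_smul_left, inner_smul_right, hadd,
      LinearIsometryEquiv.inner_map_map, Complex.conj_ofReal]
    push_cast; ring
  have h4 : ∫ ξ, Complex.exp (⟪ξ, t⟫_ℝ * Complex.I) * (‖winF τ a u ξ‖ ^ 2 : ℝ) =
      ∫ x : E, ⟪cutOrbit τ a u x, cutOrbit τ a u (x + z)⟫_ℂ := by
    rw [← hpre]
    exact (integral_congr_ae (ae_of_all _ h1)).symm
  rw [h4]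
  simp_rw [h3]
  rw [integral_mul_const, integral_complex_ofReal, integral_gw_mul_gw]
  push_cast
  ring

/-- The approximate spectral density. -/
noncomputable def specDens (τ : E → (V ≃ₗᵢ[ℂ] V)) (a : ℝ) (u : V) (ξ : E) : ℝ :=
  ‖winF τ a u ξ‖ ^ 2 / gmass E a

lemma specDens_nonneg {a : ℝ} (ha : 0 < a) (u : V) (ξ : E) : 0 ≤ specDens τ a u ξ :=
  div_nonneg (by positivity) (gmass_pos ha).le

lemma continuous_specDens_prod (hcont : ∀ u, Continuous fun x => τ x u) {a : ℝ} (ha : 0 < a) :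
    Continuous fun p : V × E => specDens τ a p.1 p.2 :=
  ((continuous_winF_prod hcont ha).norm.pow 2).div_const _

lemma integrable_specDens (hcont : ∀ u, Continuous fun x => τ x u) {a : ℝ} (ha : 0 < a) (u : V) :
    Integrable (specDens τ a u) :=
  ((memLp_winF hcont ha u).integrable_norm_pow two_ne_zero).div_const _

lemma integral_specDens (hcont : ∀ u, Continuous fun x => τ x u) {a : ℝ} (ha : 0 < a) (u : V) :
    ∫ ξ, specDens τ a u ξ = ‖u‖ ^ 2 := by
  have h := integral_inner_winF hcont ha u u
  have h1 : ∀ ξ : E, ⟪winF τ a u ξ, winF τ a u ξ⟫_ℂ = ((‖winF τ a u ξ‖ ^ 2 : ℝ) : ℂ) := by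
    intro ξ
    rw [inner_self_eq_norm_sq_to_K]; norm_cast
  simp_rw [h1] at h
  rw [integral_complex_ofReal, inner_self_eq_norm_sq_to_K] at h
  have h2 : ∫ ξ : E, ‖winF τ a u ξ‖ ^ 2 = gmass E a * ‖u‖ ^ 2 := by
    apply Complex.ofReal_injective
    rw [h]
    push_cast
    rfl
  simp only [specDens]
  rw [integral_div, h2, mul_div_cancel_left₀ _ (gmass_pos ha).ne']

/-- The approximate spectral measure. -/
noncomputable def specMeas (τ : E → (V ≃ₗᵢ[ℂ] V)) (a : ℝ) (u : V) : Measure E :=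
  volume.withDensity fun ξ => ((specDens τ a u ξ).toNNReal : ENNReal)

lemma isProbabilityMeasure_specMeas (hcont : ∀ u, Continuous fun x => τ x u) {a : ℝ} (ha : 0 < a)
    {u : V} (hu : ‖u‖ = 1) : IsProbabilityMeasure (specMeas τ a u) := by
  constructor
  rw [specMeas, withDensity_apply _ MeasurableSet.univ, Measure.restrict_univ]
  have := ofReal_integral_eq_lintegral_ofReal (integrable_specDens hcont ha u)
    (ae_of_all _ fun ξ => specDens_nonneg ha u ξ)
  rw [integral_specDens hcont ha, hu] at this
  simpa [ENNReal.ofReal] using this.symm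

lemma integral_specMeas {G : Type*} [NormedAddCommGroup G] [NormedSpace ℝ G]
    (hcont : ∀ u, Continuous fun x => τ x u) {a : ℝ} (ha : 0 < a)
    (u : V) (f : E → G) : ∫ ξ, f ξ ∂(specMeas τ a u) = ∫ ξ, specDens τ a u ξ • f ξ := by
  have hc : Continuous (specDens τ a u) := 
    ((continuous_winF hcont ha u).norm.pow 2).div_const _
  rw [specMeas, integral_withDensity_eq_integral_smul hc.measurable.real_toNNReal]
  refine integral_congr_ae (ae_of_all _ fun ξ => ?_)
  simp only [NNReal.smul_def, Real.coe_toNNReal _ (specDens_nonneg ha u ξ)]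

/-- The spectral measure of a unit vector exists. -/
theorem exists_spectral_measure (hadd : ∀ x y u, τ (x + y) u = τ x (τ y u))
    (hcont : ∀ u, Continuous fun x => τ x u) {u : V} (hu : ‖u‖ = 1) :
    ∃ ν : ProbabilityMeasure E,
      (∀ t, charFun (ν : Measure E) t = ⟪u, τ ((2 * Real.pi)⁻¹ • t) u⟫_ℂ) ∧
      ∀ f : BoundedContinuousFunction E ℝ, Tendsto (fun n : ℕ =>
        ∫ ξ, specDens τ (1 / ((n : ℝ) + 1)) u ξ * f ξ) atTop (𝓝 (∫ ξ, f ξ ∂(ν : Measure E))) := by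
  have hpos : ∀ n : ℕ, (0 : ℝ) < 1 / ((n : ℝ) + 1) := fun n => by positivity
  let m : ℕ → ProbabilityMeasure E := fun n =>
    ⟨specMeas τ (1 / ((n : ℝ) + 1)) u, isProbabilityMeasure_specMeas hcont (hpos n) hu⟩
  have hchar : ∀ t, Tendsto (fun n => charFun (m n : Measure E) t) atTop
      (𝓝 ⟪u, τ ((2 * Real.pi)⁻¹ • t) u⟫_ℂ) := by
    intro t
    have h1 : ∀ n : ℕ, charFun (m n : Measure E) t =
        Real.exp (-(1 / ((n : ℝ) + 1)) * ‖(2 * Real.pi)⁻¹ • t‖ ^ 2 / 2) *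
        ⟪u, τ ((2 * Real.pi)⁻¹ • t) u⟫_ℂ := by
      intro n
      have h2 := integral_exp_mul_winF hadd hcont (hpos n) u t
      rw [charFun_apply]
      change ∫ x, _ ∂(specMeas τ (1 / ((n : ℝ) + 1)) u) = _
      rw [integral_specMeas hcont (hpos n)]
      have h3 : ∀ ξ : E, specDens τ (1 / ((n : ℝ) + 1)) u ξ •
          Complex.exp (⟪ξ, t⟫_ℝ * Complex.I) = (gmass E (1 / ((n : ℝ) + 1)) : ℂ)⁻¹ *
          (Complex.exp (⟪ξ, t⟫_ℝ * Complex.I) *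
            (‖winF τ (1 / ((n : ℝ) + 1)) u ξ‖ ^ 2 : ℝ)) := by
        intro ξ
        rw [Complex.real_smul, specDens]
        push_cast
        ring
      simp_rw [h3]
      rw [integral_const_mul, h2]
      have : (gmass E (1 / ((n : ℝ) + 1)) : ℂ) ≠ 0 := by
        exact_mod_cast (gmass_pos (hpos n)).ne'
      field_simp
    simp_rw [h1]
    have h5 : Tendsto (fun n : ℕ => (Real.exp (-(1 / ((n : ℝ) + 1)) *
        ‖(2 * Real.pi)⁻¹ • t‖ ^ 2 / 2) : ℂ)) atTop (𝓝 ((Real.exp (-0 *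
        ‖(2 * Real.pi)⁻¹ • t‖ ^ 2 / 2) : ℝ) : ℂ)) := by
      refine (Complex.continuous_ofReal.tendsto _).comp ((Real.continuous_exp.tendsto _).comp ?_)
      exact ((tendsto_one_div_add_atTop_nhds_zero_nat (𝕜 := ℝ)).neg.mul_const _).div_const _
    simpa using h5.mul_const _
  have hc : ContinuousAt (fun t : E => ⟪u, τ ((2 * Real.pi)⁻¹ • t) u⟫_ℂ) 0 := by
    refine Continuous.continuousAt ?_
    exact continuous_const.inner ((hcont u).comp (continuous_const.smul continuous_id))
  obtain ⟨ν, hν, hlim⟩ := exists_tendsto_of_tendsto_charFun hc hchar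
  refine ⟨ν, hν, fun f => ?_⟩
  have := (ProbabilityMeasure.tendsto_iff_forall_integral_tendsto.1 hlim) f
  refine this.congr fun n => ?_
  change ∫ x, _ ∂(specMeas τ (1 / ((n : ℝ) + 1)) u) = _
  rw [integral_specMeas hcont (hpos n)]
  rfl

end Spectral

section SpectralMeasure

open scoped InnerProductSpace

variable {E V : Type*} [NormedAddCommGroup E] [InnerProductSpace ℝ E] [FiniteDimensional ℝ E]
  [MeasurableSpace E] [BorelSpace E]
  [NormedAddCommGroup V] [InnerProductSpace ℂ V] [CompleteSpace V]
  {τ : E → (V ≃ₗᵢ[ℂ] V)}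

open Classical in
/-- The spectral measure of a unit vector. -/
noncomputable def spm (τ : E → (V ≃ₗᵢ[ℂ] V)) (u : V) : Measure E :=
  if h : ∃ ν : ProbabilityMeasure E,
      (∀ t, charFun (ν : Measure E) t = ⟪u, τ ((2 * Real.pi)⁻¹ • t) u⟫_ℂ) ∧
      ∀ f : BoundedContinuousFunction E ℝ, Tendsto (fun n : ℕ =>
        ∫ ξ, specDens τ (1 / ((n : ℝ) + 1)) u ξ * f ξ) atTop (𝓝 (∫ ξ, f ξ ∂(ν : Measure E)))
  then (h.choose : Measure E) else 0

lemma spm_spec (hadd : ∀ x y u, τ (x + y) u = τ x (τ y u))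
    (hcont : ∀ u, Continuous fun x => τ x u) {u : V} (hu : ‖u‖ = 1) :
    IsProbabilityMeasure (spm τ u) ∧
      (∀ t, charFun (spm τ u) t = ⟪u, τ ((2 * Real.pi)⁻¹ • t) u⟫_ℂ) ∧
      ∀ f : BoundedContinuousFunction E ℝ, Tendsto (fun n : ℕ =>
        ∫ ξ, specDens τ (1 / ((n : ℝ) + 1)) u ξ * f ξ) atTop (𝓝 (∫ ξ, f ξ ∂(spm τ u))) := by
  have h := exists_spectral_measure hadd hcont hu
  rw [spm, dif_pos h]
  exact ⟨inferInstance, h.choose_spec⟩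

lemma spm_map (hadd : ∀ x y u, τ (x + y) u = τ x (τ y u))
    (hcont : ∀ u, Continuous fun x => τ x u) {u : V} (hu : ‖u‖ = 1)
    (P : V ≃ₗᵢ[ℂ] V) {A L : E → E} (hA : Continuous A)
    (hL : ∀ (c : ℝ) x, L (c • x) = c • L x)
    (hAL : ∀ x y, ⟪A x, y⟫_ℝ = ⟪x, L y⟫_ℝ) (hP : ∀ x w, τ x (P w) = P (τ (L x) w)) :
    spm τ (P u) = (spm τ u).map A := by
  obtain ⟨i1, h1, -⟩ := spm_spec hadd hcont hu
  obtain ⟨i2, h2, -⟩ := spm_spec hadd hcont (u := P u) (by simpa using hu)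
  have i3 : IsProbabilityMeasure ((spm τ u).map A) :=
    Measure.isProbabilityMeasure_map hA.measurable.aemeasurable
  refine Measure.ext_of_charFun (funext fun t => ?_)
  rw [h2, charFun_apply, integral_map hA.measurable.aemeasurable
    (by fun_prop), hP, LinearIsometryEquiv.inner_map_map, hL, ← h1, charFun_apply]
  simp_rw [hAL]

lemma lintegral_specDens_mul (hcont : ∀ u, Continuous fun x => τ x u) {a : ℝ} (ha : 0 < a) (u : V)
    {η : E → ℝ} (hη : Continuous η) (hη0 : ∀ ξ, 0 ≤ η ξ) {B : ℝ} (hB : ∀ ξ, η ξ ≤ B) :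
    ∫⁻ ξ, ENNReal.ofReal (specDens τ a u ξ * η ξ) =
      ENNReal.ofReal (∫ ξ, specDens τ a u ξ * η ξ) := by
  rw [ofReal_integral_eq_lintegral_ofReal]
  · exact (integrable_specDens hcont ha u).mul_bdd (c := B) hη.aestronglyMeasurable
      (ae_of_all _ fun ξ => by rw [Real.norm_eq_abs, abs_of_nonneg (hη0 ξ)]; exact hB ξ)
  · exact ae_of_all _ fun ξ => mul_nonneg (specDens_nonneg ha u ξ) (hη0 ξ)

lemma lintegral_specDens_mul_le (hcont : ∀ u, Continuous fun x => τ x u) {a : ℝ} (ha : 0 < a)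
    {u : V} (hu : ‖u‖ = 1) {η : E → ℝ} {B : ℝ} (hB : ∀ ξ, η ξ ≤ B) :
    ∫⁻ ξ, ENNReal.ofReal (specDens τ a u ξ * η ξ) ≤ ENNReal.ofReal B := by
  calc _ ≤ ∫⁻ ξ, ENNReal.ofReal B * ENNReal.ofReal (specDens τ a u ξ) := by
        refine lintegral_mono fun ξ => ?_
        rw [mul_comm (ENNReal.ofReal B), ← ENNReal.ofReal_mul (specDens_nonneg ha u ξ)]
        exact ENNReal.ofReal_le_ofReal
          (mul_le_mul_of_nonneg_left (hB ξ) (specDens_nonneg ha u ξ))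
    _ = ENNReal.ofReal B := by
        rw [lintegral_const_mul' _ _ ENNReal.ofReal_ne_top, ← ofReal_integral_eq_lintegral_ofReal
          (integrable_specDens hcont ha u) (ae_of_all _ fun ξ => specDens_nonneg ha u ξ),
          integral_specDens hcont ha, hu]
        simp

lemma tendsto_lintegral_specDens (hadd : ∀ x y u, τ (x + y) u = τ x (τ y u))
    (hcont : ∀ u, Continuous fun x => τ x u) {u : V} (hu : ‖u‖ = 1)
    {η : E → ℝ} (hη : Continuous η) (hη0 : ∀ ξ, 0 ≤ η ξ) {B : ℝ} (hB : ∀ ξ, η ξ ≤ B) :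
    Tendsto (fun n : ℕ => ∫⁻ ξ, ENNReal.ofReal (specDens τ (1 / ((n : ℝ) + 1)) u ξ * η ξ)) atTop
      (𝓝 (∫⁻ ξ, ENNReal.ofReal (η ξ) ∂(spm τ u))) := by
  obtain ⟨i1, -, h⟩ := spm_spec hadd hcont hu
  let f : BoundedContinuousFunction E ℝ := BoundedContinuousFunction.ofNormedAddCommGroup η hη B
    (fun ξ => by rw [Real.norm_eq_abs, abs_of_nonneg (hη0 ξ)]; exact hB ξ)
  have h1 := ENNReal.tendsto_ofReal (h f)
  rw [ofReal_integral_eq_lintegral_ofReal (f.integrable _) (ae_of_all _ hη0)] at h1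
  refine h1.congr fun n => ?_
  rw [lintegral_specDens_mul hcont (by positivity) u hη hη0 hB]
  rfl

/-- `u` is dominated by the family `U`, quadratically, as far as bounded operators can see. -/
def DomBy {Y : Type*} [MeasurableSpace Y] (ρ : Measure Y) (U : Y → V) (C : ENNReal)
    (u : V) : Prop :=
  ∀ W : V →L[ℂ] V, ENNReal.ofReal (‖W u‖ ^ 2) ≤ C * ∫⁻ y, ENNReal.ofReal (‖W (U y)‖ ^ 2) ∂ρ

variable {Y : Type*} [MeasurableSpace Y] [TopologicalSpace Y] [OpensMeasurableSpace Y]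
  {ρ : Measure Y} [IsFiniteMeasure ρ] {U : Y → V}

lemma measurable_specDens_fam (hcont : ∀ u, Continuous fun x => τ x u) (hU : Continuous U)
    {a : ℝ} (ha : 0 < a) {η : E → ℝ} (hη : Continuous η) :
    Measurable fun p : Y × E => ENNReal.ofReal (specDens τ a (U p.1) p.2 * η p.2) := by
  refine ENNReal.measurable_ofReal.comp (Continuous.measurable ?_)
  exact ((continuous_specDens_prod hcont ha).comp
    ((hU.comp continuous_fst).prodMk continuous_snd)).mul (hη.comp continuous_snd)

lemma lintegral_specDens_of_domBy (hcont : ∀ u, Continuous fun x => τ x u) (hU : Continuous U)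
    {C : ENNReal} {u : V} (hdom : DomBy ρ U C u) {a : ℝ} (ha : 0 < a) {η : E → ℝ}
    (hη : Continuous η) (hη0 : ∀ ξ, 0 ≤ η ξ) :
    ∫⁻ ξ, ENNReal.ofReal (specDens τ a u ξ * η ξ) ≤
      C * ∫⁻ y, (∫⁻ ξ, ENNReal.ofReal (specDens τ a (U y) ξ * η ξ)) ∂ρ := by
  have hm := measurable_specDens_fam hcont hU ha hη
  rw [lintegral_lintegral_swap hm.aemeasurable]
  have hl : Measurable fun ξ => ∫⁻ y, ENNReal.ofReal (specDens τ a (U y) ξ * η ξ) ∂ρ :=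
    hm.lintegral_prod_left'
  rw [← lintegral_const_mul C hl]
  refine lintegral_mono fun ξ => ?_
  have h := hdom (winFL τ hcont ha ξ)
  simp only [winFL_apply] at h
  have hc : 0 ≤ η ξ / gmass E a := div_nonneg (hη0 ξ) (gmass_pos ha).le
  have e : ∀ w : V, ENNReal.ofReal (specDens τ a w ξ * η ξ) =
      ENNReal.ofReal (η ξ / gmass E a) * ENNReal.ofReal (‖winF τ a w ξ‖ ^ 2) := by
    intro w
    rw [← ENNReal.ofReal_mul hc, specDens]
    congr 1; ring
  simp only [e]
  rw [lintegral_const_mul' _ _ ENNReal.ofReal_ne_top, mul_left_comm]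
  gcongr

lemma tendsto_lintegral_fam (hadd : ∀ x y u, τ (x + y) u = τ x (τ y u))
    (hcont : ∀ u, Continuous fun x => τ x u) (hU : Continuous U) (hU1 : ∀ y, ‖U y‖ = 1)
    {η : E → ℝ} (hη : Continuous η) (hη0 : ∀ ξ, 0 ≤ η ξ) {B : ℝ} (hB : ∀ ξ, η ξ ≤ B) :
    Tendsto (fun n : ℕ =>
      ∫⁻ y, (∫⁻ ξ, ENNReal.ofReal (specDens τ (1 / ((n : ℝ) + 1)) (U y) ξ * η ξ)) ∂ρ) atTop
      (𝓝 (∫⁻ y, ∫⁻ ξ, ENNReal.ofReal (η ξ) ∂(spm τ (U y)) ∂ρ)) := by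
  refine tendsto_lintegral_of_dominated_convergence (fun _ => ENNReal.ofReal B)
    (fun n => (measurable_specDens_fam hcont hU (by positivity) hη).lintegral_prod_right')
    (fun n => ae_of_all _ fun y => lintegral_specDens_mul_le hcont (by positivity) (hU1 y) hB)
    ?_ (ae_of_all _ fun y => tendsto_lintegral_specDens hadd hcont (hU1 y) hη hη0 hB)
  simp [ENNReal.mul_eq_top]

lemma measurable_lintegral_spm (hadd : ∀ x y u, τ (x + y) u = τ x (τ y u))
    (hcont : ∀ u, Continuous fun x => τ x u) (hU : Continuous U) (hU1 : ∀ y, ‖U y‖ = 1)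
    {η : E → ℝ} (hη : Continuous η) (hη0 : ∀ ξ, 0 ≤ η ξ) {B : ℝ} (hB : ∀ ξ, η ξ ≤ B) :
    Measurable fun y => ∫⁻ ξ, ENNReal.ofReal (η ξ) ∂(spm τ (U y)) := by
  refine measurable_of_tendsto_metrizable (f := fun (n : ℕ) y =>
    ∫⁻ ξ, ENNReal.ofReal (specDens τ (1 / ((n : ℝ) + 1)) (U y) ξ * η ξ))
    (fun n => (measurable_specDens_fam hcont hU (by positivity) hη).lintegral_prod_right') ?_
  exact tendsto_pi_nhds.2 fun y => tendsto_lintegral_specDens hadd hcont (hU1 y) hη hη0 hB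

lemma norm_inner_le_specDens (hcont : ∀ u, Continuous fun x => τ x u) {a : ℝ} (ha : 0 < a)
    (u w : V) {η : E → ℝ} (hη0 : ∀ ξ, 0 < η ξ) :
    ENNReal.ofReal ‖⟪u, w⟫_ℂ‖ ≤ ∫⁻ ξ, ENNReal.ofReal (specDens τ a u ξ * η ξ) +
      ENNReal.ofReal (specDens τ a w ξ * (η ξ)⁻¹) := by
  have h := integral_inner_winF hcont ha u w
  have hg := gmass_pos (E := E) ha
  have h1 : ⟪u, w⟫_ℂ = ∫ ξ : E, (gmass E a : ℂ)⁻¹ * ⟪winF τ a u ξ, winF τ a w ξ⟫_ℂ := by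
    rw [integral_const_mul, h, inv_mul_cancel_left₀]
    exact_mod_cast hg.ne'
  rw [h1, ofReal_norm]
  refine (enorm_integral_le_lintegral_enorm _).trans (lintegral_mono fun ξ => ?_)
  rw [← ofReal_norm, ← ENNReal.ofReal_add
    (mul_nonneg (specDens_nonneg ha u ξ) (hη0 ξ).le)
    (mul_nonneg (specDens_nonneg ha w ξ) (inv_nonneg.2 (hη0 ξ).le))]
  refine ENNReal.ofReal_le_ofReal ?_
  rw [norm_mul, norm_inv, Complex.norm_real, Real.norm_eq_abs, abs_of_pos hg]
  have h2 := norm_inner_le_norm (𝕜 := ℂ) (winF τ a u ξ) (winF τ a w ξ)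
  set x := ‖winF τ a u ξ‖
  set y := ‖winF τ a w ξ‖
  have hx : 0 ≤ x := norm_nonneg _
  have hy : 0 ≤ y := norm_nonneg _
  have h3 : x * y ≤ x ^ 2 * η ξ + y ^ 2 * (η ξ)⁻¹ := by
    have hs := hη0 ξ
    have : x ^ 2 * η ξ + y ^ 2 * (η ξ)⁻¹ - x * y =
        ((x * η ξ - y / 2) ^ 2 + 3 / 4 * y ^ 2) * (η ξ)⁻¹ := by field_simp; ring
    have : 0 ≤ x ^ 2 * η ξ + y ^ 2 * (η ξ)⁻¹ - x * y := by rw [this]; positivity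
    linarith
  calc (gmass E a)⁻¹ * ‖⟪winF τ a u ξ, winF τ a w ξ⟫_ℂ‖
      ≤ (gmass E a)⁻¹ * (x ^ 2 * η ξ + y ^ 2 * (η ξ)⁻¹) := by gcongr; linarith
    _ = _ := by simp only [specDens, x, y]; ring

/-- Weighted Cauchy-Schwarz bound of a matrix coefficient through spectral measures. -/
theorem norm_inner_le_of_domBy {Y' : Type*} [MeasurableSpace Y'] [TopologicalSpace Y']
    [OpensMeasurableSpace Y'] {ρ' : Measure Y'} [IsFiniteMeasure ρ'] {U' : Y' → V}
    (hadd : ∀ x y u, τ (x + y) u = τ x (τ y u))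
    (hcont : ∀ u, Continuous fun x => τ x u) (hU : Continuous U) (hU1 : ∀ y, ‖U y‖ = 1)
    (hU' : Continuous U') (hU1' : ∀ y, ‖U' y‖ = 1) {C C' : ENNReal} (hC : C ≠ ⊤) (hC' : C' ≠ ⊤)
    {u w : V} (hu : DomBy ρ U C u) (hw : DomBy ρ' U' C' w)
    {η : E → ℝ} (hη : Continuous η) (hη0 : ∀ ξ, 0 < η ξ) {B : ℝ} (hB : ∀ ξ, η ξ ≤ B)
    (hB' : ∀ ξ, (η ξ)⁻¹ ≤ B) :
    ENNReal.ofReal ‖⟪u, w⟫_ℂ‖ ≤ C * ∫⁻ y, ∫⁻ ξ, ENNReal.ofReal (η ξ) ∂(spm τ (U y)) ∂ρ +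
      C' * ∫⁻ y, ∫⁻ ξ, ENNReal.ofReal (η ξ)⁻¹ ∂(spm τ (U' y)) ∂ρ' := by
  have hηi : Continuous fun ξ => (η ξ)⁻¹ := hη.inv₀ fun ξ => (hη0 ξ).ne'
  have hηi0 : ∀ ξ, 0 ≤ (η ξ)⁻¹ := fun ξ => inv_nonneg.2 (hη0 ξ).le
  have t1 := ENNReal.Tendsto.const_mul (a := C) (tendsto_lintegral_fam (ρ := ρ) hadd hcont hU hU1 hη
    (fun ξ => (hη0 ξ).le) hB) (Or.inr hC)
  have t2 := ENNReal.Tendsto.const_mul (a := C') (tendsto_lintegral_fam (ρ := ρ') hadd hcont hU'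
    hU1' hηi hηi0 hB') (Or.inr hC')
  refine ge_of_tendsto' (t1.add t2) fun n => ?_
  have hn : (0 : ℝ) < 1 / ((n : ℝ) + 1) := by positivity
  refine (norm_inner_le_specDens hcont hn u w hη0).trans ?_
  rw [lintegral_add_right]
  · exact add_le_add (lintegral_specDens_of_domBy hcont hU hu hn hη fun ξ => (hη0 ξ).le)
      (lintegral_specDens_of_domBy hcont hU' hw hn hηi hηi0)
  · refine ENNReal.measurable_ofReal.comp (Continuous.measurable ?_)
    exact (((continuous_winF hcont hn w).norm.pow 2).div_const _).mul hηi

end SpectralMeasure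

section PlaneAction

open scoped InnerProductSpace

/-- The Euclidean plane. -/
abbrev E2 := EuclideanSpace ℝ (Fin 2)

/-- The abelian unipotent subgroup `1 + x₀ E₀₁ + x₁ E₂₁`. -/
def uEl (x : E2) : SL3 := ⟨!![1, x 0, 0; 0, 1, 0; 0, x 1, 1], by simp [Matrix.det_fin_three]⟩

/-- The unipotent `1 + y E₂₀`. -/
def n20 (y : ℝ) : SL3 := ⟨!![1, 0, 0; 0, 1, 0; y, 0, 1], by simp [Matrix.det_fin_three]⟩

/-- The unipotent `1 + y E₀₂`. -/
def n02 (y : ℝ) : SL3 := ⟨!![1, 0, y; 0, 1, 0; 0, 0, 1], by simp [Matrix.det_fin_three]⟩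

/-- The diagonal element `diag(t, 1, t⁻¹)`. -/
noncomputable def dT (t : ℝ) (ht : t ≠ 0) : SL3 :=
  ⟨!![t, 0, 0; 0, 1, 0; 0, 0, t⁻¹], by simp [Matrix.det_fin_three, ht]⟩

lemma uEl_coe (x : E2) :
    (uEl x : Matrix (Fin 3) (Fin 3) ℝ) = !![1, x 0, 0; 0, 1, 0; 0, x 1, 1] := rfl

lemma n20_coe (y : ℝ) :
    (n20 y : Matrix (Fin 3) (Fin 3) ℝ) = !![1, 0, 0; 0, 1, 0; y, 0, 1] := rfl

lemma n02_coe (y : ℝ) :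
    (n02 y : Matrix (Fin 3) (Fin 3) ℝ) = !![1, 0, y; 0, 1, 0; 0, 0, 1] := rfl

lemma dT_coe (t : ℝ) (ht : t ≠ 0) :
    (dT t ht : Matrix (Fin 3) (Fin 3) ℝ) = !![t, 0, 0; 0, 1, 0; 0, 0, t⁻¹] := rfl

lemma continuous_uEl : Continuous uEl := by
  refine SL3.continuous_mk (continuous_matrix fun i j => ?_) _
  fin_cases i <;> fin_cases j <;> simp <;> fun_prop

lemma continuous_n20 : Continuous n20 := by
  refine SL3.continuous_mk (continuous_matrix fun i j => ?_) _
  fin_cases i <;> fin_cases j <;> simp <;> fun_prop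

lemma continuous_n02 : Continuous n02 := by
  refine SL3.continuous_mk (continuous_matrix fun i j => ?_) _
  fin_cases i <;> fin_cases j <;> simp <;> fun_prop

lemma uEl_add (x y : E2) : uEl (x + y) = uEl x * uEl y := by
  apply Subtype.ext
  rw [Matrix.SpecialLinearGroup.coe_mul, uEl_coe, uEl_coe, uEl_coe]
  ext i j
  fin_cases i <;> fin_cases j <;> simp [add_comm]

/-- The map dual to conjugation by `dT t`. -/
noncomputable def AT (t : ℝ) (ξ : E2) : E2 := !₂[ξ 0 / t, t * ξ 1]

/-- The map dual to conjugation by `n20 y`. -/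
noncomputable def A20 (y : ℝ) (ξ : E2) : E2 := !₂[ξ 0 - y * ξ 1, ξ 1]

/-- The map dual to conjugation by `n02 y`. -/
noncomputable def A02 (y : ℝ) (ξ : E2) : E2 := !₂[ξ 0, ξ 1 - y * ξ 0]

lemma continuous_AT (t : ℝ) : Continuous (AT t) := by
  unfold AT
  refine (PiLp.continuous_toLp 2 _).comp (continuous_pi fun i => ?_)
  fin_cases i <;> simp <;> fun_prop

lemma continuous_A20 : Continuous fun p : ℝ × E2 => A20 p.1 p.2 := by
  unfold A20
  refine (PiLp.continuous_toLp 2 _).comp (continuous_pi fun i => ?_)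
  fin_cases i <;> simp <;> fun_prop

lemma continuous_A02 : Continuous fun p : ℝ × E2 => A02 p.1 p.2 := by
  unfold A02
  refine (PiLp.continuous_toLp 2 _).comp (continuous_pi fun i => ?_)
  fin_cases i <;> simp <;> fun_prop

variable {V : Type*} [NormedAddCommGroup V] [InnerProductSpace ℂ V] [CompleteSpace V]
  {π : SL3 →* (V ≃ₗᵢ[ℂ] V)}

/-- The action of the plane through `uEl`. -/
noncomputable def tauU (π : SL3 →* (V ≃ₗᵢ[ℂ] V)) (x : E2) : V ≃ₗᵢ[ℂ] V := π (uEl x)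

lemma tauU_add (x y : E2) (u : V) : tauU π (x + y) u = tauU π x (tauU π y u) := by
  rw [tauU, uEl_add, pi_mul_apply]; rfl

lemma continuous_tauU (hπ : ∀ v, Continuous fun g => π g v) (u : V) :
    Continuous fun x => tauU π x u := (hπ u).comp continuous_uEl

lemma spm_dT (hπ : ∀ v, Continuous fun g => π g v) {u : V} (hu : ‖u‖ = 1) {t : ℝ} (ht : t ≠ 0) :
    spm (tauU π) (π (dT t ht) u) = (spm (tauU π) u).map (AT t) := by
  refine spm_map tauU_add (continuous_tauU hπ) hu (π (dT t ht)) (continuous_AT t)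
    (L := fun x => !₂[x 0 / t, t * x 1]) ?_ ?_ ?_
  · intro c x; ext i; fin_cases i <;> simp <;> ring
  · intro x y; simp [AT, PiLp.inner_apply, Fin.sum_univ_two]; ring
  · intro x w
    simp only [tauU]
    rw [← pi_mul_apply, ← pi_mul_apply]
    congr 2
    apply Subtype.ext
    rw [Matrix.SpecialLinearGroup.coe_mul, Matrix.SpecialLinearGroup.coe_mul, uEl_coe, uEl_coe,
      dT_coe]
    ext i j
    fin_cases i <;> fin_cases j <;> simp <;> field_simp

lemma spm_n20 (hπ : ∀ v, Continuous fun g => π g v) {u : V} (hu : ‖u‖ = 1) (y : ℝ) :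
    spm (tauU π) (π (n20 y) u) = (spm (tauU π) u).map (A20 y) := by
  refine spm_map tauU_add (continuous_tauU hπ) hu (π (n20 y))
    (continuous_A20.comp (continuous_const.prodMk continuous_id))
    (L := fun x => !₂[x 0, x 1 - y * x 0]) ?_ ?_ ?_
  · intro c x; ext i; fin_cases i <;> simp; ring
  · intro x z; simp [A20, PiLp.inner_apply, Fin.sum_univ_two]; ring
  · intro x w
    simp only [tauU]
    rw [← pi_mul_apply, ← pi_mul_apply]
    congr 2
    apply Subtype.ext
    rw [Matrix.SpecialLinearGroup.coe_mul, Matrix.SpecialLinearGroup.coe_mul, uEl_coe, uEl_coe,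
      n20_coe]
    ext i j
    fin_cases i <;> fin_cases j <;> simp

lemma spm_n02 (hπ : ∀ v, Continuous fun g => π g v) {u : V} (hu : ‖u‖ = 1) (y : ℝ) :
    spm (tauU π) (π (n02 y) u) = (spm (tauU π) u).map (A02 y) := by
  refine spm_map tauU_add (continuous_tauU hπ) hu (π (n02 y))
    (continuous_A02.comp (continuous_const.prodMk continuous_id))
    (L := fun x => !₂[x 0 - y * x 1, x 1]) ?_ ?_ ?_
  · intro c x; ext i; fin_cases i <;> simp; ring
  · intro x z; simp [A02, PiLp.inner_apply, Fin.sum_univ_two]; ring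
  · intro x w
    simp only [tauU]
    rw [← pi_mul_apply, ← pi_mul_apply]
    congr 2
    apply Subtype.ext
    rw [Matrix.SpecialLinearGroup.coe_mul, Matrix.SpecialLinearGroup.coe_mul, uEl_coe, uEl_coe,
      n02_coe]
    ext i j
    fin_cases i <;> fin_cases j <;> simp

end PlaneAction

section AtomAtZero

open scoped InnerProductSpace

variable {E V : Type*} [NormedAddCommGroup E] [InnerProductSpace ℝ E] [FiniteDimensional ℝ E]
  [MeasurableSpace E] [BorelSpace E]
  [NormedAddCommGroup V] [InnerProductSpace ℂ V] [CompleteSpace V]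
  {τ : E → (V ≃ₗᵢ[ℂ] V)}

lemma sq_mul_spm_zero_le (hadd : ∀ x y u, τ (x + y) u = τ x (τ y u))
    (hcont : ∀ u, Continuous fun x => τ x u) {u : V} (hu : ‖u‖ = 1) (N : ℕ) (x : ℕ → E) :
    (N : ℝ) ^ 2 * (spm τ u).real {0} ≤ ‖∑ i ∈ Finset.range N, τ (x i) u‖ ^ 2 := by
  obtain ⟨i1, hc, -⟩ := spm_spec hadd hcont hu
  let e : ℕ → E → ℂ := fun j ξ => Complex.exp (⟪ξ, (2 * Real.pi) • x j⟫_ℝ * Complex.I)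
  have he : ∀ j, Continuous (e j) := fun j => by fun_prop
  have henorm : ∀ j ξ, ‖e j ξ‖ = 1 := fun j ξ => Complex.norm_exp_ofReal_mul_I _
  have key : ∀ i j, ⟪τ (x i) u, τ (x j) u⟫_ℂ = ∫ ξ, (starRingEnd ℂ) (e i ξ) * e j ξ ∂(spm τ u) := by
    intro i j
    have h1 : τ (x j) u = τ (x i) (τ (x j - x i) u) := by rw [← hadd]; simp
    rw [h1, LinearIsometryEquiv.inner_map_map]
    have h2 := hc ((2 * Real.pi) • (x j - x i))
    rw [smul_smul, inv_mul_cancel₀ (by positivity), one_smul] at h2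
    rw [← h2, charFun_apply]
    refine integral_congr_ae (ae_of_all _ fun ξ => ?_)
    simp only [e]
    rw [← Complex.exp_conj, ← Complex.exp_add]
    congr 1
    simp [smul_sub, inner_sub_right]
    ring
  have h_int : ∀ i j, Integrable (fun ξ => (starRingEnd ℂ) (e i ξ) * e j ξ) (spm τ u) := by
    intro i j
    refine Integrable.of_bound (C := 1) ?_ (ae_of_all _ fun ξ => ?_)
    · exact ((Complex.continuous_conj.comp (he i)).mul (he j)).aestronglyMeasurable
    · simp [henorm]
  have hexp : ((‖∑ i ∈ Finset.range N, τ (x i) u‖ ^ 2 : ℝ) : ℂ) =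
      ((∫ ξ, ‖∑ j ∈ Finset.range N, e j ξ‖ ^ 2 ∂(spm τ u) : ℝ) : ℂ) := by
    have h1 : ((‖∑ i ∈ Finset.range N, τ (x i) u‖ ^ 2 : ℝ) : ℂ) =
      ⟪∑ i ∈ Finset.range N, τ (x i) u, ∑ i ∈ Finset.range N, τ (x i) u⟫_ℂ := by
      rw [inner_self_eq_norm_sq_to_K]; norm_cast
    rw [h1, ← integral_complex_ofReal, sum_inner]
    simp_rw [inner_sum, key]
    rw [← Finset.sum_congr rfl fun i _ => integral_finsetSum _ fun j _ => h_int i j,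
      ← integral_finsetSum _ fun i _ => integrable_finsetSum _ fun j _ => h_int i j]
    refine integral_congr_ae (ae_of_all _ fun ξ => ?_)
    simp only
    rw [Complex.sq_norm, Complex.normSq_eq_conj_mul_self, map_sum, Finset.sum_mul_sum]
  rw [Complex.ofReal_inj.1 hexp]
  have h2 : (N : ℝ) ^ 2 * (spm τ u).real {0} =
      ∫ ξ, Set.indicator {0} (fun _ => (N : ℝ) ^ 2) ξ ∂(spm τ u) := by
    rw [integral_indicator_const _ (measurableSet_singleton _)]; simp [mul_comm]
  rw [h2]
  refine integral_mono_of_nonneg (ae_of_all _ fun ξ => ?_) ?_ (ae_of_all _ fun ξ => ?_)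
  · exact Set.indicator_nonneg (fun _ _ => by positivity) _
  · refine Integrable.of_bound (C := (N : ℝ) ^ 2) ?_ (ae_of_all _ fun ξ => ?_)
    · exact ((continuous_finsetSum _ fun j _ => he j).norm.pow 2).aestronglyMeasurable
    · rw [norm_pow, norm_norm]
      gcongr
      refine (norm_sum_le _ _).trans ?_
      simp [henorm]
  · by_cases h : ξ = 0
    · subst h; simp [e]
    · rw [Set.indicator_of_notMem (by simpa using h)]; positivity

end AtomAtZero

section AtomPlane

open scoped InnerProductSpace

variable {V : Type*} [NormedAddCommGroup V] [InnerProductSpace ℂ V] [CompleteSpace V]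
  {π : SL3 →* (V ≃ₗᵢ[ℂ] V)}

lemma spm_zero_of_orthogonal (hπ : ∀ v, Continuous fun g => π g v) {u : V} (hu : ‖u‖ = 1)
    (hperp : u ∈ (invVec π)ᗮ) : spm (tauU π) u {0} = 0 := by
  obtain ⟨i1, -, -⟩ := spm_spec (τ := tauU π) tauU_add (continuous_tauU hπ) hu
  let f : V →L[ℂ] V := (π (elem ne01 1)).toContinuousLinearEquiv.toContinuousLinearMap
  have hf : ‖f‖ ≤ 1 := f.opNorm_le_bound zero_le_one fun v => by simp [f]
  have hlim := f.tendsto_birkhoffAverage_orthogonalProjection hf u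
  have hz : (f.eqLocus (1 : V →L[ℂ] V)).orthogonalProjectionOnto u = 0 := by
    rw [Submodule.orthogonalProjectionOnto_eq_zero_iff]
    refine Submodule.orthogonal_le ?_ hperp
    intro v hv
    exact mem_invVec_of_elem hπ (LinearMap.mem_eqLocus.1 hv)
  rw [hz] at hlim
  have hit : ∀ n : ℕ, f^[n] u = tauU π (!₂[(n : ℝ), 0]) u := by
    intro n
    induction n with
    | zero =>
      have : uEl !₂[((0 : ℕ) : ℝ), 0] = 1 := by
        apply Subtype.ext
        ext i j
        fin_cases i <;> fin_cases j <;> simp [uEl]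
      rw [tauU, this, map_one]; rfl
    | succ n ih =>
      rw [Function.iterate_succ_apply', ih]
      change π (elem ne01 1) _ = _
      simp only [tauU]
      rw [← pi_mul_apply]
      congr 2
      apply Subtype.ext
      rw [Matrix.SpecialLinearGroup.coe_mul, elem_coe]
      ext i j
      fin_cases i <;> fin_cases j <;>
        simp [uEl, Matrix.mul_apply,
          Fin.sum_univ_three, Matrix.single_apply]
  have hle : ∀ N : ℕ, N ≠ 0 → (spm (tauU π) u).real {0} ≤ ‖birkhoffAverage ℂ f id N u‖ ^ 2 := by
    intro N hN
    have h := sq_mul_spm_zero_le (τ := tauU π) tauU_add (continuous_tauU hπ) hu N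
      (fun n => !₂[(n : ℝ), 0])
    simp_rw [← hit] at h
    rw [birkhoffAverage, birkhoffSum, norm_smul, mul_pow, norm_inv, Complex.norm_natCast, inv_pow]
    have : (0 : ℝ) < (N : ℝ) ^ 2 := by positivity
    rw [inv_mul_eq_div, le_div_iff₀ this, mul_comm]
    exact h
  have h0 : (spm (tauU π) u).real {0} ≤ 0 := by
    have h1 : Tendsto (fun N => ‖birkhoffAverage ℂ f id N u‖ ^ 2) atTop (𝓝 0) := by
      simpa using (hlim.norm.pow 2)
    refine ge_of_tendsto h1 ?_
    filter_upwards [eventually_ne_atTop 0] with N hN using hle N hN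
  have := le_antisymm h0 measureReal_nonneg
  rwa [measureReal_eq_zero_iff] at this

end AtomPlane

section Weights

/-- A universal constant bounding averages of `|ρ - y|^{-1/2}`. -/
noncomputable def avgK : ENNReal :=
  6 + ∫⁻ x in Set.Icc (-1 : ℝ) 1, ENNReal.ofReal (√(2 / |x|))

lemma avgK_ne_top : avgK ≠ ⊤ := by
  have h1 : IntervalIntegrable (fun x : ℝ => (x : ℂ) ^ (((-1 / 2 : ℝ)) : ℂ)) volume (-1) 1 :=
    intervalIntegral.intervalIntegrable_cpow' (by norm_num)
  have h2 := h1.norm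
  rw [intervalIntegrable_iff_integrableOn_Icc_of_le (by norm_num)] at h2
  have h3 : ∀ x : ℝ, √(2 / |x|) = √2 * ‖(x : ℂ) ^ (((-1 / 2 : ℝ)) : ℂ)‖ := by
    intro x
    rw [Complex.norm_cpow_real, Complex.norm_real, Real.norm_eq_abs, Real.sqrt_div (by norm_num),
      div_eq_mul_inv, Real.sqrt_eq_rpow |x|, ← Real.rpow_neg (abs_nonneg x)]
    norm_num
  have h4 : IntegrableOn (fun x : ℝ => √(2 / |x|)) (Set.Icc (-1) 1) := by
    simp_rw [h3]; exact h2.const_mul _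
  refine ENNReal.add_ne_top.2 ⟨by norm_num, ?_⟩
  exact (Integrable.lintegral_lt_top h4).ne

lemma lintegral_avg_le (ρ : ℝ) :
    ∫⁻ y in Set.Icc (-1 : ℝ) 1, ENNReal.ofReal (1 + √(2 / |ρ - y|)) ≤ avgK := by
  have h : ∀ x : ℝ, ENNReal.ofReal (1 + √(2 / |x|)) ≤
      3 + (Set.Icc (-1 : ℝ) 1).indicator (fun x => ENNReal.ofReal (√(2 / |x|))) x := by
    intro x
    by_cases hx : x ∈ Set.Icc (-1 : ℝ) 1
    · rw [Set.indicator_of_mem hx, ENNReal.ofReal_add zero_le_one (Real.sqrt_nonneg _)]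
      gcongr
      simp
    · rw [Set.indicator_of_notMem hx, add_zero]
      have hx1 : 1 ≤ |x| := by
        by_contra hlt
        exact hx (abs_le.1 (not_le.1 hlt).le)
      have : √(2 / |x|) ≤ 2 := by
        rw [Real.sqrt_le_left (by norm_num), div_le_iff₀ (by linarith)]
        linarith
      calc ENNReal.ofReal (1 + √(2 / |x|)) ≤ ENNReal.ofReal 3 :=
            ENNReal.ofReal_le_ofReal (by linarith)
        _ = 3 := by simp
  calc _ ≤ ∫⁻ y in Set.Icc (-1 : ℝ) 1, (3 +
        (Set.Icc (-1 : ℝ) 1).indicator (fun x => ENNReal.ofReal (√(2 / |x|))) (ρ - y)) :=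
        lintegral_mono fun y => h (ρ - y)
    _ = 6 + ∫⁻ y in Set.Icc (-1 : ℝ) 1,
        (Set.Icc (-1 : ℝ) 1).indicator (fun x => ENNReal.ofReal (√(2 / |x|))) (ρ - y) := by
        rw [lintegral_add_left measurable_const]
        congr 1
        rw [setLIntegral_const, Real.volume_Icc]
        norm_num
    _ ≤ 6 + ∫⁻ y,
        (Set.Icc (-1 : ℝ) 1).indicator (fun x => ENNReal.ofReal (√(2 / |x|))) (ρ - y) := by
        gcongr
        exact Measure.restrict_le_self
    _ = avgK := by
        rw [lintegral_sub_left_eq_self (fun x => (Set.Icc (-1 : ℝ) 1).indicator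
          (fun x => ENNReal.ofReal (√(2 / |x|))) x) ρ, lintegral_indicator measurableSet_Icc, avgK]

lemma lintegral_avg_pair_le {p q : ℝ} (h : p ≠ 0 ∨ q ≠ 0) :
    ∃ δ₀ > 0, ∀ δ, δ < δ₀ →
      ∫⁻ y in Set.Icc (-1 : ℝ) 1, ENNReal.ofReal (1 + √((|p| + δ) / |q - y * p|)) ≤ avgK := by
  by_cases hp : p = 0
  · subst hp
    have hq : q ≠ 0 := by simpa using h
    refine ⟨|q|, by positivity, fun δ hδ => ?_⟩
    have : ∀ y : ℝ, ENNReal.ofReal (1 + √((|0| + δ) / |q - y * 0|)) ≤ 2 := by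
      intro y
      have : √((|0| + δ) / |q - y * 0|) ≤ 1 := by
        rw [Real.sqrt_le_one, abs_zero, zero_add, mul_zero, sub_zero, div_le_one (by positivity)]
        exact hδ.le
      calc _ ≤ ENNReal.ofReal 2 := ENNReal.ofReal_le_ofReal (by linarith)
        _ = 2 := by simp
    refine (lintegral_mono this).trans ?_
    rw [setLIntegral_const, Real.volume_Icc, avgK]
    refine le_trans ?_ le_self_add
    norm_num
  · refine ⟨|p|, by positivity, fun δ hδ => le_trans (lintegral_mono fun y => ?_)
      (lintegral_avg_le (q / p))⟩
    refine ENNReal.ofReal_le_ofReal ?_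
    gcongr 1 + √?_
    have e : |q - y * p| = |p| * |q / p - y| := by
      rw [← abs_mul]; congr 1; field_simp
    have hp' : 0 < |p| := abs_pos.2 hp
    rw [e, ← div_div]
    gcongr
    rw [div_le_iff₀ hp']
    linarith

/-- The numerator of the weight. -/
noncomputable def wN (t δ : ℝ) (ξ : E2) : ℝ := |ξ 0| + |ξ 1| / t ^ 2 + δ

/-- The denominator of the weight. -/
noncomputable def wM (t δ : ℝ) (ξ : E2) : ℝ := |ξ 1| + |ξ 0| / t ^ 2 + δ

/-- The weight used in the Cauchy-Schwarz inequality. -/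
noncomputable def wt (t δ : ℝ) (ξ : E2) : ℝ := √t * √(wN t δ ξ / wM t δ ξ)

variable {t δ : ℝ}

lemma wN_pos (hδ : 0 < δ) (ξ : E2) : 0 < wN t δ ξ := by unfold wN; positivity

lemma wM_pos (hδ : 0 < δ) (ξ : E2) : 0 < wM t δ ξ := by unfold wM; positivity

lemma wt_pos (ht : 1 ≤ t) (hδ : 0 < δ) (ξ : E2) : 0 < wt t δ ξ := by
  have := wN_pos (t := t) hδ ξ
  have := wM_pos (t := t) hδ ξ
  unfold wt; positivity

lemma continuous_wt (hδ : 0 < δ) : Continuous (wt t δ) := by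
  unfold wt
  refine continuous_const.mul (Continuous.sqrt (Continuous.div₀ ?_ ?_ fun ξ => (wM_pos hδ ξ).ne'))
  · unfold wN; fun_prop
  · unfold wM; fun_prop

lemma wN_div_wM_le (ht : 1 ≤ t) (hδ : 0 < δ) (ξ : E2) : wN t δ ξ / wM t δ ξ ≤ t ^ 2 := by
  have h0 : (0 : ℝ) < t ^ 2 := by positivity
  rw [div_le_iff₀ (wM_pos hδ ξ)]
  unfold wN wM
  have h1 : (1 : ℝ) ≤ t ^ 2 := one_le_pow₀ ht
  have h2 : |ξ 1| / t ^ 2 ≤ t ^ 2 * |ξ 1| := by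
    rw [div_le_iff₀ h0]
    nlinarith [abs_nonneg (ξ 1), mul_nonneg (abs_nonneg (ξ 1)) h0.le,
      mul_nonneg (mul_nonneg (abs_nonneg (ξ 1)) h0.le) (sub_nonneg.2 h1)]
  have h3 : t ^ 2 * (|ξ 0| / t ^ 2) = |ξ 0| := by field_simp
  nlinarith

lemma wM_div_wN_le (ht : 1 ≤ t) (hδ : 0 < δ) (ξ : E2) : wM t δ ξ / wN t δ ξ ≤ t ^ 2 := by
  have := wN_div_wM_le ht hδ (!₂[ξ 1, ξ 0])
  simpa [wN, wM] using this

lemma wt_le (ht : 1 ≤ t) (hδ : 0 < δ) (ξ : E2) : wt t δ ξ ≤ t ^ 2 := by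
  have h1 : √(wN t δ ξ / wM t δ ξ) ≤ t :=
    (Real.sqrt_le_left (by linarith)).2 (wN_div_wM_le ht hδ ξ)
  have h2 : √t ≤ t := (Real.sqrt_le_left (by linarith)).2 (by nlinarith)
  unfold wt
  rw [sq]
  exact mul_le_mul h2 h1 (Real.sqrt_nonneg _) (by linarith)

lemma wt_inv_eq (ξ : E2) : (wt t δ ξ)⁻¹ = (√t)⁻¹ * √(wM t δ ξ / wN t δ ξ) := by
  rw [wt, mul_inv, ← Real.sqrt_inv (wN t δ ξ / wM t δ ξ), inv_div]

lemma wt_inv_le (ht : 1 ≤ t) (hδ : 0 < δ) (ξ : E2) : (wt t δ ξ)⁻¹ ≤ t ^ 2 := by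
  have h1 : √(wM t δ ξ / wN t δ ξ) ≤ t :=
    (Real.sqrt_le_left (by linarith)).2 (wM_div_wN_le ht hδ ξ)
  have h2 : (√t)⁻¹ ≤ 1 := inv_le_one_of_one_le₀ (Real.one_le_sqrt.2 ht)
  rw [wt_inv_eq, sq]
  exact mul_le_mul (h2.trans ht) h1 (Real.sqrt_nonneg _) (by linarith)

lemma sqrt_one_add_le {x : ℝ} (hx : 0 ≤ x) : √(1 + x) ≤ 1 + √x := by
  rw [Real.sqrt_le_left (by positivity)]
  nlinarith [Real.sq_sqrt hx, Real.sqrt_nonneg x]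

lemma wt_AT_A02_le (ht : 1 ≤ t) (hδ : 0 < δ) (ξ : E2) (y : ℝ) (hz : ξ 1 - y * ξ 0 ≠ 0) :
    wt t δ (AT t (A02 y ξ)) ≤ (√t)⁻¹ * (1 + √((|ξ 0| + t * δ) / |ξ 1 - y * ξ 0|)) := by
  have ht0 : 0 < t := by linarith
  have e : √t = (√t)⁻¹ * t := by
    rw [eq_inv_mul_iff_mul_eq₀ (by positivity)]; exact Real.mul_self_sqrt ht0.le
  rw [wt]
  nth_rw 1 [e]
  rw [mul_assoc]
  gcongr
  refine le_trans ?_ (sqrt_one_add_le (by positivity))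
  rw [← Real.sqrt_sq ht0.le, ← Real.sqrt_mul (by positivity), Real.sqrt_sq ht0.le]
  refine Real.sqrt_le_sqrt ?_
  have hM := wM_pos (t := t) hδ (AT t (A02 y ξ))
  rw [← mul_div_assoc, div_le_iff₀ hM]
  have hz' : 0 < |ξ 1 - y * ξ 0| := abs_pos.2 hz
  set z := ξ 1 - y * ξ 0 with hzdef
  have hN : t ^ 2 * wN t δ (AT t (A02 y ξ)) = t * (|ξ 0| + |z| + t * δ) := by
    simp only [wN, AT, A02, ← hzdef]
    simp [abs_div, abs_mul, abs_of_pos ht0]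
    field_simp
  have hM1 : t * |z| ≤ wM t δ (AT t (A02 y ξ)) := by
    simp only [wM, AT, A02, ← hzdef]
    simp [abs_div, abs_mul, abs_of_pos ht0]
    have : 0 ≤ |ξ 0| / t / t ^ 2 := by positivity
    linarith
  rw [hN]
  calc t * (|ξ 0| + |z| + t * δ) = (1 + (|ξ 0| + t * δ) / |z|) * (t * |z|) := by
        field_simp; ring
    _ ≤ _ := by gcongr

lemma wt_inv_A20_le (ht : 1 ≤ t) (hδ : 0 < δ) (ξ : E2) (y : ℝ) (hz : ξ 0 - y * ξ 1 ≠ 0) :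
    (wt t δ (A20 y ξ))⁻¹ ≤ (√t)⁻¹ * (1 + √((|ξ 1| + t * δ) / |ξ 0 - y * ξ 1|)) := by
  have ht0 : 0 < t := by linarith
  rw [wt_inv_eq]
  gcongr
  refine le_trans ?_ (sqrt_one_add_le (by positivity))
  refine Real.sqrt_le_sqrt ?_
  rw [div_le_iff₀ (wN_pos hδ _)]
  have hz' : 0 < |ξ 0 - y * ξ 1| := abs_pos.2 hz
  set z := ξ 0 - y * ξ 1 with hzdef
  have hM : wM t δ (A20 y ξ) ≤ |ξ 1| + |z| + t * δ := by
    simp only [wM, A20, ← hzdef]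
    simp
    have : |z| / t ^ 2 ≤ |z| := div_le_self (abs_nonneg _) (one_le_pow₀ ht)
    nlinarith
  have hN : |z| ≤ wN t δ (A20 y ξ) := by
    simp only [wN, A20, ← hzdef]
    simp
    have : 0 ≤ |ξ 1| / t ^ 2 := by positivity
    linarith
  calc _ ≤ |ξ 1| + |z| + t * δ := hM
    _ = (1 + (|ξ 1| + t * δ) / |z|) * |z| := by field_simp; ring
    _ ≤ _ := by gcongr

lemma ae_sub_mul_ne {p q : ℝ} (h : p ≠ 0 ∨ q ≠ 0) : ∀ᵐ y : ℝ, q - y * p ≠ 0 := by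
  have : ∀ᵐ y : ℝ, y ≠ q / p := Measure.ae_ne volume _
  filter_upwards [this] with y hy h0
  by_cases hp : p = 0
  · subst hp; simp at h h0; exact h h0
  · exact hy (by field_simp; linarith)

lemma E2_ne_zero {ξ : E2} (h : ξ ≠ 0) : ξ 0 ≠ 0 ∨ ξ 1 ≠ 0 := by
  by_contra hc
  push Not at hc
  exact h (by ext i; fin_cases i <;> simp [hc.1, hc.2])

lemma eventually_lintegral_weight_le (ht : 1 ≤ t) {p q : ℝ} (h : p ≠ 0 ∨ q ≠ 0)
    {F : ℕ → ℝ → ℝ} (hF : ∀ (n : ℕ) y, q - y * p ≠ 0 →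
      F n y ≤ (√t)⁻¹ * (1 + √((|p| + t * (1 / ((n : ℝ) + 1))) / |q - y * p|))) :
    ∀ᶠ n in atTop, ∫⁻ y in Set.Icc (-1 : ℝ) 1, ENNReal.ofReal (F n y) ≤
      ENNReal.ofReal (√t)⁻¹ * avgK := by
  obtain ⟨δ₀, h0, hδ⟩ := lintegral_avg_pair_le h
  have hlim : Tendsto (fun n : ℕ => t * (1 / ((n : ℝ) + 1))) atTop (𝓝 0) := by
    simpa using (tendsto_one_div_add_atTop_nhds_zero_nat (𝕜 := ℝ)).const_mul t
  filter_upwards [hlim.eventually (gt_mem_nhds h0)] with n hn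
  refine le_trans ?_ (mul_le_mul_right (hδ _ hn) (ENNReal.ofReal (√t)⁻¹))
  rw [← lintegral_const_mul' _ _ ENNReal.ofReal_ne_top]
  refine lintegral_mono_ae (ae_restrict_of_ae ?_)
  filter_upwards [ae_sub_mul_ne h] with y hy
  rw [← ENNReal.ofReal_mul (by positivity)]
  exact ENNReal.ofReal_le_ofReal (hF n y hy)

end Weights

section Smoothing

open scoped InnerProductSpace

variable {V : Type*} [NormedAddCommGroup V] [InnerProductSpace ℂ V] [CompleteSpace V]
  {π : SL3 →* (V ≃ₗᵢ[ℂ] V)} {μ : Measure SL3} [μ.IsHaarMeasure]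

/-- The vector obtained by smoothing `v` with `φ`. -/
noncomputable def smoothVec (π : SL3 →* (V ≃ₗᵢ[ℂ] V)) (μ : Measure SL3) (φ : SL3 → ℝ) (v : V) : V :=
  ∫ g, (φ g : ℂ) • π g v ∂μ

lemma integrable_smooth (hπ : ∀ v, Continuous fun g => π g v) {φ : SL3 → ℝ} (hφ : Continuous φ)
    (hs : HasCompactSupport φ) (v : V) : Integrable (fun g => (φ g : ℂ) • π g v) μ := by
  refine Continuous.integrable_of_hasCompactSupport ?_ ?_
  · exact (Complex.continuous_ofReal.comp hφ).smul (hπ v)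
  · refine HasCompactSupport.smul_right (f := fun g => (φ g : ℂ)) ?_
    exact hs.comp_left (g := fun x : ℝ => (x : ℂ)) (by simp)

lemma sq_lintegral_le {α : Type*} [MeasurableSpace α] (ν : Measure α) {f : α → ENNReal}
    (hf : AEMeasurable f ν) : (∫⁻ a, f a ∂ν) ^ 2 ≤ ν Set.univ * ∫⁻ a, f a ^ 2 ∂ν := by
  have h := ENNReal.lintegral_mul_le_Lp_mul_Lq ν Real.HolderConjugate.two_two hf
    (aemeasurable_const (b := (1 : ENNReal)))
  simp only [Pi.mul_apply, mul_one, ENNReal.one_rpow, lintegral_const, one_mul] at h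
  have h2 := pow_le_pow_left' h 2
  rw [mul_pow] at h2
  have e : ∀ x : ENNReal, (x ^ (1 / 2 : ℝ)) ^ 2 = x := by
    intro x
    rw [← ENNReal.rpow_natCast, ← ENNReal.rpow_mul]; norm_num
  rw [e, e] at h2
  rw [mul_comm]
  simpa using h2

/-- A smoothed vector is dominated by its averages along a one-parameter family. -/
lemma domBy_smooth (hπ : ∀ v, Continuous fun g => π g v) {φ : SL3 → ℝ} (hφ : Continuous φ)
    (hs : HasCompactSupport φ) {M : ℝ} (hM : ∀ g, |φ g| ≤ M) (v : V) {n : ℝ → SL3}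
    (hn : Continuous n) {D : Set SL3} (hDm : MeasurableSet D) (k b : SL3)
    (hD : ∀ y ∈ Set.Icc (-1 : ℝ) 1, ∀ g, φ (k⁻¹ * n y * g) ≠ 0 → g ∈ D) :
    DomBy ((μ.restrict D).prod (volume.restrict (Set.Icc (-1 : ℝ) 1)))
      (fun p : SL3 × ℝ => π (b * n p.2 * p.1) v) (ENNReal.ofReal (M ^ 2) * μ D)
      (π b (π k (smoothVec π μ φ v))) := by
  intro W
  have hcU : Continuous fun p : SL3 × ℝ => π (b * n p.2 * p.1) v :=
    (hπ v).comp ((continuous_const.mul (hn.comp continuous_snd)).mul continuous_fst)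
  have hF : Continuous fun p : SL3 × ℝ => ENNReal.ofReal (‖W (π (b * n p.2 * p.1) v)‖ ^ 2) :=
    ENNReal.continuous_ofReal.comp ((W.continuous.comp hcU).norm.pow 2)
  have key : ∀ y ∈ Set.Icc (-1 : ℝ) 1,
      ENNReal.ofReal (‖W (π b (π k (smoothVec π μ φ v)))‖ ^ 2) ≤
      ENNReal.ofReal (M ^ 2) * μ D *
        ∫⁻ g in D, ENNReal.ofReal (‖W (π (b * n y * g) v)‖ ^ 2) ∂μ := by
    intro y hy
    let T : V →L[ℂ] V := W.comp ((π (b * k)).toContinuousLinearEquiv.toContinuousLinearMap)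
    have h1 : W (π b (π k (smoothVec π μ φ v))) =
        ∫ g, ((φ (k⁻¹ * n y * g) : ℝ) : ℂ) • W (π (b * n y * g) v) ∂μ := by
      have hT : W (π b (π k (smoothVec π μ φ v))) = T (smoothVec π μ φ v) := by
        simp [T]
      rw [hT, smoothVec, ← T.integral_comp_comm (integrable_smooth hπ hφ hs v),
        ← integral_mul_left_eq_self _ (k⁻¹ * n y)]
      refine integral_congr_ae (ae_of_all _ fun g => ?_)
      simp only [map_smul]
      congr 1
      change W (π (b * k) (π (k⁻¹ * n y * g) v)) = _
      rw [← pi_mul_apply]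
      congr 3
      group
    have h2 : ‖W (π b (π k (smoothVec π μ φ v)))‖ₑ ≤
        ∫⁻ g in D, ENNReal.ofReal M * ‖W (π (b * n y * g) v)‖ₑ ∂μ := by
      rw [h1, ← lintegral_indicator hDm]
      refine (enorm_integral_le_lintegral_enorm _).trans (lintegral_mono fun g => ?_)
      by_cases hg : φ (k⁻¹ * n y * g) = 0
      · simp [hg]
      · rw [Set.indicator_of_mem (hD y hy g hg), enorm_smul]
        gcongr
        rw [← ofReal_norm, Complex.norm_real]
        exact ENNReal.ofReal_le_ofReal (hM _)
    have hmeas : Measurable fun g => ENNReal.ofReal M * ‖W (π (b * n y * g) v)‖ₑ := by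
      have hc : Continuous fun g => ‖W (π (b * n y * g) v)‖ₑ :=
        continuous_enorm.comp (W.continuous.comp ((hπ v).comp (continuous_const.mul continuous_id)))
      exact hc.measurable.const_mul _
    have h3 := (pow_le_pow_left' h2 2).trans (sq_lintegral_le (μ.restrict D) hmeas.aemeasurable)
    rw [Measure.restrict_apply_univ] at h3
    rw [ENNReal.ofReal_pow (norm_nonneg _), ofReal_norm]
    refine h3.trans (le_of_eq ?_)
    have hM0 : 0 ≤ M := (abs_nonneg _).trans (hM 1)
    simp_rw [mul_pow, ENNReal.ofReal_pow (norm_nonneg _), ofReal_norm, ENNReal.ofReal_pow hM0]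
    rw [lintegral_const_mul' _ _ (by simp)]
    ring
  rw [lintegral_prod_symm _ hF.measurable.aemeasurable]
  have hl : Measurable fun y => ∫⁻ g in D, ENNReal.ofReal (‖W (π (b * n y * g) v)‖ ^ 2) ∂μ :=
    hF.measurable.lintegral_prod_left'
  rw [← lintegral_const_mul _ hl]
  calc ENNReal.ofReal (‖W (π b (π k (smoothVec π μ φ v)))‖ ^ 2)
      ≤ ENNReal.ofReal (‖W (π b (π k (smoothVec π μ φ v)))‖ ^ 2) *
        volume (Set.Icc (-1 : ℝ) 1) := by
        refine le_mul_of_one_le_right' ?_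
        rw [Real.volume_Icc]; norm_num
    _ = ∫⁻ y in Set.Icc (-1 : ℝ) 1,
        ENNReal.ofReal (‖W (π b (π k (smoothVec π μ φ v)))‖ ^ 2) := by
        rw [setLIntegral_const]
    _ ≤ _ := setLIntegral_mono (hl.const_mul _) key

lemma limsup_lintegral_weight_le {Y : Type*} [TopologicalSpace Y]
    [MeasurableSpace Y] [OpensMeasurableSpace Y] [SecondCountableTopology Y] {ρ : Measure Y}
    [IsFiniteMeasure ρ]
    (hπ : ∀ v, Continuous fun g => π g v) {U : Y × ℝ → V} (hU : Continuous U)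
    (hU1 : ∀ p, ‖U p‖ = 1) {u : Y → V} (hu : ∀ g, ‖u g‖ = 1)
    (hu0 : ∀ g, spm (tauU π) (u g) {0} = 0)
    {T : ℝ → E2 → E2} (hT : Continuous fun p : ℝ × E2 => T p.1 p.2)
    (hUT : ∀ g y, spm (tauU π) (U (g, y)) = (spm (tauU π) (u g)).map (T y))
    {η : ℕ → E2 → ℝ} (hη : ∀ n, Continuous (η n)) (hη0 : ∀ n ξ, 0 ≤ η n ξ) {B : ℝ}
    (hB : ∀ n ξ, η n ξ ≤ B) {K : ENNReal}
    (hK : ∀ ξ ≠ 0, ∀ᶠ n in atTop,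
      ∫⁻ y in Set.Icc (-1 : ℝ) 1, ENNReal.ofReal (η n (T y ξ)) ≤ K) :
    limsup (fun n => ∫⁻ p, ∫⁻ ξ, ENNReal.ofReal (η n ξ) ∂(spm (tauU π) (U p))
      ∂(ρ.prod (volume.restrict (Set.Icc (-1 : ℝ) 1)))) atTop ≤ ρ Set.univ * K := by
  have hτ := continuous_tauU hπ
  have hTy : ∀ y, Continuous (T y) := fun y => hT.comp (continuous_const.prodMk continuous_id)
  have hmη : ∀ n, Measurable fun q : ℝ × E2 => ENNReal.ofReal (η n (T q.1 q.2)) := fun n =>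
    (ENNReal.continuous_ofReal.comp ((hη n).comp hT)).measurable
  let G : ℕ → E2 → ENNReal := fun n ξ =>
    ∫⁻ y in Set.Icc (-1 : ℝ) 1, ENNReal.ofReal (η n (T y ξ))
  have hGm : ∀ n, Measurable (G n) := fun n => (hmη n).lintegral_prod_left'
  have hbd : ∀ n ξ, G n ξ ≤ ENNReal.ofReal B * 2 := by
    intro n ξ
    calc G n ξ ≤ ∫⁻ y in Set.Icc (-1 : ℝ) 1, ENNReal.ofReal B :=
          lintegral_mono fun y => ENNReal.ofReal_le_ofReal (hB n _)
      _ = ENNReal.ofReal B * 2 := by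
          rw [setLIntegral_const, Real.volume_Icc]; norm_num
  have hFm : ∀ n, Measurable fun p => ∫⁻ ξ, ENNReal.ofReal (η n ξ) ∂(spm (tauU π) (U p)) :=
    fun n => measurable_lintegral_spm tauU_add hτ hU hU1 (hη n) (hη0 n) (hB n)
  have hprob : ∀ g, IsProbabilityMeasure (spm (tauU π) (u g)) := fun g =>
    (spm_spec tauU_add hτ (hu g)).1
  have hH : ∀ n g, ∫⁻ y in Set.Icc (-1 : ℝ) 1, ∫⁻ ξ, ENNReal.ofReal (η n ξ)
      ∂(spm (tauU π) (U (g, y))) = ∫⁻ ξ, G n ξ ∂(spm (tauU π) (u g)) := by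
    intro n g
    have h1 : ∀ y, ∫⁻ ξ, ENNReal.ofReal (η n ξ) ∂(spm (tauU π) (U (g, y))) =
        ∫⁻ ξ, ENNReal.ofReal (η n (T y ξ)) ∂(spm (tauU π) (u g)) := by
      intro y
      have hm : Measurable fun ξ => ENNReal.ofReal (η n ξ) :=
        (ENNReal.continuous_ofReal.comp (hη n)).measurable
      rw [hUT, lintegral_map hm (hTy y).measurable]
    simp_rw [h1]
    exact lintegral_lintegral_swap (hmη n).aemeasurable
  have e : ∀ n, ∫⁻ p, ∫⁻ ξ, ENNReal.ofReal (η n ξ) ∂(spm (tauU π) (U p))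
      ∂(ρ.prod (volume.restrict (Set.Icc (-1 : ℝ) 1))) =
      ∫⁻ g, ∫⁻ ξ, G n ξ ∂(spm (tauU π) (u g)) ∂ρ := by
    intro n
    rw [lintegral_prod _ (hFm n).aemeasurable]
    exact lintegral_congr fun g => hH n g
  have hHm : ∀ n, Measurable fun g => ∫⁻ ξ, G n ξ ∂(spm (tauU π) (u g)) := by
    intro n
    have := (hFm n).lintegral_prod_right' (ν := volume.restrict (Set.Icc (-1 : ℝ) 1))
    simpa only [hH] using this
  simp_rw [e]
  refine (limsup_lintegral_le (fun _ => ENNReal.ofReal B * 2) hHm (fun n => ae_of_all _ fun g => ?_)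
    ?_).trans ?_
  · refine (lintegral_mono (hbd n)).trans ?_
    simp
  · simp [ENNReal.mul_eq_top]
  · calc _ ≤ ∫⁻ g, K ∂ρ := by
          refine lintegral_mono fun g => ?_
          refine (limsup_lintegral_le (fun _ => ENNReal.ofReal B * 2) hGm
            (fun n => ae_of_all _ (hbd n)) ?_).trans ?_
          · simp [ENNReal.mul_eq_top]
          · have h0 : ∀ᵐ ξ ∂(spm (tauU π) (u g)), ξ ≠ 0 := by
              rw [ae_iff]; simpa using hu0 g
            calc _ ≤ ∫⁻ ξ, K ∂(spm (tauU π) (u g)) := by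
                  refine lintegral_mono_ae ?_
                  filter_upwards [h0] with ξ hξ
                  exact limsup_le_of_le (by isBoundedDefault) (hK ξ hξ)
              _ = K := by simp
      _ = ρ Set.univ * K := by simp [mul_comm]

end Smoothing

section MatrixCoefficients

open scoped InnerProductSpace

variable {V : Type*} [NormedAddCommGroup V] [InnerProductSpace ℂ V] [CompleteSpace V]
  {π : SL3 →* (V ≃ₗᵢ[ℂ] V)} {μ : Measure SL3} [μ.IsHaarMeasure]

lemma pi_mem_orthogonal {u : V} (h : u ∈ (invVec π)ᗮ) (g : SL3) : π g u ∈ (invVec π)ᗮ := by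
  rw [Submodule.mem_orthogonal'] at h ⊢
  intro w hw
  rw [inner_pi_left, hw g⁻¹]
  exact h w hw

lemma le_add_of_limsup_le {a b : ℕ → ENNReal} {A B x : ENNReal} (ha : limsup a atTop ≤ A)
    (hb : limsup b atTop ≤ B) (h : ∀ n, x ≤ a n + b n) : x ≤ A + B := by
  refine ENNReal.le_of_forall_pos_le_add fun ε hε hAB => ?_
  rw [ENNReal.add_lt_top] at hAB
  have h0 : (ε / 2 : ENNReal) ≠ 0 := by simp [hε.ne']
  have h1 := eventually_lt_of_limsup_lt (ha.trans_lt (ENNReal.lt_add_right hAB.1.ne h0))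
  have h2 := eventually_lt_of_limsup_lt (hb.trans_lt (ENNReal.lt_add_right hAB.2.ne h0))
  obtain ⟨n, hn1, hn2⟩ := (h1.and h2).exists
  calc x ≤ a n + b n := h n
    _ ≤ (A + ε / 2) + (B + ε / 2) := add_le_add hn1.le hn2.le
    _ = A + B + (ε / 2 + ε / 2) := by ring
    _ = A + B + ε := by rw [ENNReal.add_halves]

/-- A compact set containing the translates of the support needed for the averaging trick. -/
lemma exists_compact_translates {φ : SL3 → ℝ} (hs : HasCompactSupport φ) {Kc : Set SL3}
    (hK : IsCompact Kc) {n : ℝ → SL3} (hn : Continuous n) :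
    ∃ D : Set SL3, IsCompact D ∧ ∀ k ∈ Kc, ∀ y ∈ Set.Icc (-1 : ℝ) 1, ∀ g,
      φ (k⁻¹ * n y * g) ≠ 0 → g ∈ D := by
  refine ⟨(fun p : ℝ × SL3 × SL3 => (n p.1)⁻¹ * p.2.1 * p.2.2) ''
    (Set.Icc (-1 : ℝ) 1 ×ˢ Kc ×ˢ tsupport φ), ?_, ?_⟩
  · refine (isCompact_Icc.prod (hK.prod hs)).image ?_
    exact ((hn.comp continuous_fst).inv.mul (continuous_fst.comp continuous_snd)).mul
      (continuous_snd.comp continuous_snd)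
  · intro k hk y hy g hg
    refine ⟨(y, k, k⁻¹ * n y * g), ⟨hy, hk, subset_tsupport _ hg⟩, ?_⟩
    simp only
    group

theorem exists_decay_bound (hπ : ∀ v, Continuous fun g => π g v) {φ : SL3 → ℝ}
    (hφ : Continuous φ) (hs : HasCompactSupport φ) {v : V} (hv : ‖v‖ = 1)
    (hperp : v ∈ (invVec π)ᗮ) {Kc : Set SL3} (hK : IsCompact Kc) :
    ∃ C : ℝ, 0 ≤ C ∧ ∀ t : ℝ, 1 ≤ t → ∀ ht : t ≠ 0, ∀ k₁ ∈ Kc, ∀ k₂ ∈ Kc,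
      ‖⟪π (dT t ht) (π k₁ (smoothVec π μ φ v)), π k₂ (smoothVec π μ φ v)⟫_ℂ‖ ≤
        C * (√t)⁻¹ := by
  obtain ⟨M, hM⟩ : ∃ M : ℝ, ∀ g, |φ g| ≤ M := by
    obtain ⟨M, hM⟩ := hs.exists_bound_of_continuous hφ
    exact ⟨M, hM⟩
  obtain ⟨D, hDc, hD⟩ := exists_compact_translates hs hK continuous_n02
  obtain ⟨D', hDc', hD'⟩ := exists_compact_translates hs hK continuous_n20
  have : IsFiniteMeasure (μ.restrict D) := ⟨by
    rw [Measure.restrict_apply_univ]; exact hDc.measure_lt_top⟩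
  have : IsFiniteMeasure (μ.restrict D') := ⟨by
    rw [Measure.restrict_apply_univ]; exact hDc'.measure_lt_top⟩
  set c : ENNReal := ENNReal.ofReal (M ^ 2) * μ D with hc
  set c' : ENNReal := ENNReal.ofReal (M ^ 2) * μ D' with hc'
  have hcT : c ≠ ⊤ := ENNReal.mul_ne_top ENNReal.ofReal_ne_top hDc.measure_lt_top.ne
  have hcT' : c' ≠ ⊤ := ENNReal.mul_ne_top ENNReal.ofReal_ne_top hDc'.measure_lt_top.ne
  set Z : ENNReal := (c * μ D + c' * μ D') * avgK with hZ
  have hZT : Z ≠ ⊤ := ENNReal.mul_ne_top (ENNReal.add_ne_top.2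
    ⟨ENNReal.mul_ne_top hcT hDc.measure_lt_top.ne, ENNReal.mul_ne_top hcT' hDc'.measure_lt_top.ne⟩)
    avgK_ne_top
  refine ⟨Z.toReal, ENNReal.toReal_nonneg, ?_⟩
  intro t ht ht0 k₁ hk₁ k₂ hk₂
  have hdom := domBy_smooth (μ := μ) hπ hφ hs hM v continuous_n02 hDc.measurableSet k₁ (dT t ht0)
    (hD k₁ hk₁)
  have hdom' := domBy_smooth (μ := μ) hπ hφ hs hM v continuous_n20 hDc'.measurableSet k₂ 1
    (hD' k₂ hk₂)
  rw [map_one] at hdom'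
  have hcU : ∀ (b : SL3) (n : ℝ → SL3), Continuous n →
      Continuous fun p : SL3 × ℝ => π (b * n p.2 * p.1) v := fun b n hn =>
    (hπ v).comp ((continuous_const.mul (hn.comp continuous_snd)).mul continuous_fst)
  have hn1 : ∀ g, ‖π g v‖ = 1 := fun g => by rw [LinearIsometryEquiv.norm_map, hv]
  have hδ : ∀ n : ℕ, (0 : ℝ) < 1 / ((n : ℝ) + 1) := fun n => by positivity
  have hmain := fun n : ℕ => norm_inner_le_of_domBy tauU_add (continuous_tauU hπ)
    (hcU (dT t ht0) n02 continuous_n02) (fun p => hn1 _) (hcU 1 n20 continuous_n20)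
    (fun p => hn1 _) hcT hcT' hdom hdom' (continuous_wt (t := t) (hδ n)) (wt_pos ht (hδ n))
    (wt_le ht (hδ n)) (wt_inv_le ht (hδ n))
  have hz : ∀ g, spm (tauU π) (π g v) {0} = 0 := fun g =>
    spm_zero_of_orthogonal hπ (hn1 g) (pi_mem_orthogonal hperp g)
  have l1 := limsup_lintegral_weight_le (ρ := μ.restrict D) hπ
    (hcU (dT t ht0) n02 continuous_n02) (fun p => hn1 _)
    (u := fun g => π g v) hn1 hz (T := fun y ξ => AT t (A02 y ξ))
    ((continuous_AT t).comp continuous_A02) (by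
      intro g y
      simp only
      rw [mul_assoc, pi_mul_apply, spm_dT hπ (hn1 _), pi_mul_apply, spm_n02 hπ (hn1 _),
        Measure.map_map (continuous_AT t).measurable
        (show Continuous (A02 y) from
          continuous_A02.comp (continuous_const.prodMk continuous_id)).measurable]
      rfl)
    (η := fun n => wt t (1 / ((n : ℝ) + 1))) (fun n => continuous_wt (hδ n))
    (fun n ξ => (wt_pos ht (hδ n) ξ).le) (fun n ξ => wt_le ht (hδ n) ξ)
    (K := ENNReal.ofReal (√t)⁻¹ * avgK) (fun ξ hξ =>
      eventually_lintegral_weight_le ht (E2_ne_zero hξ) fun n y hy => wt_AT_A02_le ht (hδ n) ξ y hy)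
  have l2 := limsup_lintegral_weight_le (ρ := μ.restrict D') hπ
    (hcU 1 n20 continuous_n20) (fun p => hn1 _)
    (u := fun g => π g v) hn1 hz (T := A20)
    continuous_A20 (by
      intro g y
      simp only
      rw [one_mul, pi_mul_apply, spm_n20 hπ (hn1 _)])
    (η := fun n ξ => (wt t (1 / ((n : ℝ) + 1)) ξ)⁻¹)
    (fun n => (continuous_wt (hδ n)).inv₀ fun ξ => (wt_pos ht (hδ n) ξ).ne')
    (fun n ξ => inv_nonneg.2 (wt_pos ht (hδ n) ξ).le) (fun n ξ => wt_inv_le ht (hδ n) ξ)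
    (K := ENNReal.ofReal (√t)⁻¹ * avgK) (fun ξ hξ =>
      eventually_lintegral_weight_le ht (E2_ne_zero hξ).symm fun n y hy =>
        wt_inv_A20_le ht (hδ n) ξ y hy)
  have hfin : ENNReal.ofReal ‖⟪π (dT t ht0) (π k₁ (smoothVec π μ φ v)),
      π k₂ (smoothVec π μ φ v)⟫_ℂ‖ ≤ Z * ENNReal.ofReal (√t)⁻¹ := by
    rw [Measure.restrict_apply_univ] at l1 l2
    refine (le_add_of_limsup_le (A := c * (μ D * (ENNReal.ofReal (√t)⁻¹ * avgK)))
      (B := c' * (μ D' * (ENNReal.ofReal (√t)⁻¹ * avgK))) ?_ ?_ hmain).trans (le_of_eq ?_)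
    · rw [ENNReal.limsup_const_mul_of_ne_top hcT]
      exact mul_le_mul_right l1 _
    · rw [ENNReal.limsup_const_mul_of_ne_top hcT']
      exact mul_le_mul_right l2 _
    rw [hZ]; ring
  have hr : Z * ENNReal.ofReal (√t)⁻¹ = ENNReal.ofReal (Z.toReal * (√t)⁻¹) := by
    rw [ENNReal.ofReal_mul ENNReal.toReal_nonneg, ENNReal.ofReal_toReal hZT]
  rw [hr] at hfin
  exact (ENNReal.ofReal_le_ofReal_iff (by positivity)).1 hfin

end MatrixCoefficients

section Averaging

open scoped InnerProductSpace

variable {V : Type*} [NormedAddCommGroup V] [InnerProductSpace ℂ V] [CompleteSpace V]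
  {π : SL3 →* (V ≃ₗᵢ[ℂ] V)}
  {Ω : Type*} [TopologicalSpace Ω] [MeasurableSpace Ω] [OpensMeasurableSpace Ω]
  [SecondCountableTopology Ω] {ρ : Measure Ω} [IsProbabilityMeasure ρ]

lemma integrable_pi_apply (hπ : ∀ v, Continuous fun g => π g v) {θ : Ω → SL3} (hθ : Continuous θ)
    (v : V) : Integrable (fun ω => π (θ ω) v) ρ := by
  refine Integrable.of_bound ((hπ v).comp hθ).aestronglyMeasurable ‖v‖ (ae_of_all _ fun ω => ?_)
  rw [LinearIsometryEquiv.norm_map]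

/-- The average of the operators `π (θ ω)`. -/
noncomputable def avgOp (hπ : ∀ v, Continuous fun g => π g v) (ρ : Measure Ω)
    [IsProbabilityMeasure ρ] {θ : Ω → SL3} (hθ : Continuous θ) : V →L[ℂ] V :=
  LinearMap.mkContinuous
    { toFun := fun v => ∫ ω, π (θ ω) v ∂ρ
      map_add' := fun v w => by
        simp only [map_add]
        exact integral_add (integrable_pi_apply hπ hθ v) (integrable_pi_apply hπ hθ w)
      map_smul' := fun c v => by
        simp only [map_smul, RingHom.id_apply]
        exact integral_smul c _ } 1 fun v => by
    simp only [LinearMap.coe_mk, AddHom.coe_mk, one_mul]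
    refine (norm_integral_le_of_norm_le_const (C := ‖v‖) (ae_of_all _ fun ω => ?_)).trans ?_
    · rw [LinearIsometryEquiv.norm_map]
    · simp

lemma avgOp_apply (hπ : ∀ v, Continuous fun g => π g v) {θ : Ω → SL3} (hθ : Continuous θ) (v : V) :
    avgOp hπ ρ hθ v = ∫ ω, π (θ ω) v ∂ρ := rfl

lemma inner_avgOp (hπ : ∀ v, Continuous fun g => π g v) {θ : Ω → SL3} (hθ : Continuous θ)
    (u w : V) : ⟪w, avgOp hπ ρ hθ u⟫_ℂ = ∫ ω, ⟪w, π (θ ω) u⟫_ℂ ∂ρ := by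
  rw [avgOp_apply]
  exact (integral_inner (integrable_pi_apply hπ hθ u) w).symm

lemma inner_avgOp_left (hπ : ∀ v, Continuous fun g => π g v) {θ : Ω → SL3} (hθ : Continuous θ)
    (u w : V) : ⟪w, avgOp hπ ρ hθ u⟫_ℂ = ⟪avgOp hπ ρ hθ.inv w, u⟫_ℂ := by
  rw [← inner_conj_symm (avgOp hπ ρ hθ.inv w) u, inner_avgOp, inner_avgOp, ← integral_conj]
  refine integral_congr_ae (ae_of_all _ fun ω => ?_)
  simp only [inner_conj_symm]
  rw [inner_pi_left, Pi.inv_apply, inv_inv]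

/-- Averaging improves an upper bound for matrix coefficients. -/
lemma norm_inner_avgOp_le (hπ : ∀ v, Continuous fun g => π g v) {θ : Ω → SL3} (hθ : Continuous θ)
    {H : Subgroup SL3} (hH : ∀ ω, θ ω ∈ H) {ψ : SL3 → ℝ} {l : ℝ}
    (hi : ∀ h ∈ H, Integrable (fun ω => ψ (h * θ ω)) ρ)
    (hl : ∀ h ∈ H, ∫ ω, ψ (h * θ ω) ∂ρ = l * ψ h) {c : ℝ} {w v : V}
    (hw : ∀ h ∈ H, ‖⟪v, π h w⟫_ℂ‖ ≤ c * ψ h) (h : SL3) (hh : h ∈ H) :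
    ‖⟪v, π h (avgOp hπ ρ hθ w)⟫_ℂ‖ ≤ c * l * ψ h := by
  have e : ⟪v, π h (avgOp hπ ρ hθ w)⟫_ℂ = ∫ ω, ⟪v, π (h * θ ω) w⟫_ℂ ∂ρ := by
    rw [← inv_inv h, ← inner_pi_left, inner_avgOp]
    refine integral_congr_ae (ae_of_all _ fun ω => ?_)
    simp only
    rw [inner_pi_left, pi_mul_apply]
  rw [e]
  refine (norm_integral_le_of_norm_le ((hi h hh).const_mul c)
    (ae_of_all _ fun ω => hw _ (H.mul_mem hh (hH ω)))).trans (le_of_eq ?_)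
  rw [integral_const_mul, hl h hh, mul_assoc]

/-- A self-adjoint operator whose moments at `v` grow at most like `l ^ (2 * n)`. -/
lemma norm_sq_le_of_moments {S S' : V →L[ℂ] V} (hS : ∀ u w, ⟪w, S u⟫_ℂ = ⟪S' w, u⟫_ℂ) {v : V}
    {c l : ℝ} (hl : 0 < l)
    (hm : ∀ n, ‖⟪v, ((S' * S) ^ n) v⟫_ℂ‖ ≤ c * l ^ (2 * n)) : ‖S v‖ ≤ l * ‖v‖ := by
  have hS' : ∀ u w, ⟪w, S' u⟫_ℂ = ⟪S w, u⟫_ℂ := fun u w => by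
    rw [← inner_conj_symm w, ← hS, inner_conj_symm]
  set T := S' * S with hT
  have hsa : ∀ u w, ⟪w, T u⟫_ℂ = ⟪T w, u⟫_ℂ := fun u w => by
    simp only [hT, mul_apply_eq_comp]
    rw [hS', hS]
  have hsan : ∀ n u w, ⟪w, (T ^ n) u⟫_ℂ = ⟪(T ^ n) w, u⟫_ℂ := by
    intro n
    induction n with
    | zero => intro u w; simp
    | succ n ih =>
      intro u w
      rw [pow_succ, mul_apply_eq_comp, ih, hsa, ← mul_apply_eq_comp,
        ← pow_succ', ← pow_succ]
  have hdouble : ∀ n, ‖⟪v, (T ^ (2 * n)) v⟫_ℂ‖ = ‖(T ^ n) v‖ ^ 2 := by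
    intro n
    rw [two_mul, pow_add, mul_apply_eq_comp, hsan, inner_self_eq_norm_sq_to_K, norm_pow,
      RCLike.norm_ofReal, abs_norm]
  have hm1 : ‖⟪v, (T ^ 1) v⟫_ℂ‖ = ‖S v‖ ^ 2 := by
    rw [pow_one, hT, mul_apply_eq_comp, hS', inner_self_eq_norm_sq_to_K, norm_pow,
      RCLike.norm_ofReal, abs_norm]
  by_cases hv : v = 0
  · simp [hv]
  have hv0 : 0 < ‖v‖ := norm_pos_iff.2 hv
  have key : ∀ k : ℕ, (‖S v‖ ^ 2) ^ 2 ^ k ≤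
      ‖⟪v, (T ^ (2 ^ k)) v⟫_ℂ‖ * (‖v‖ ^ 2) ^ (2 ^ k - 1) := by
    intro k
    induction k with
    | zero => simp [← hm1]
    | succ k ih =>
      have h1 : ‖⟪v, (T ^ (2 ^ k)) v⟫_ℂ‖ ^ 2 ≤ ‖⟪v, (T ^ (2 ^ (k + 1))) v⟫_ℂ‖ * ‖v‖ ^ 2 := by
        rw [pow_succ' 2 k, hdouble, ← mul_pow]
        refine pow_le_pow_left₀ (norm_nonneg _) ?_ 2
        rw [mul_comm]
        exact norm_inner_le_norm _ _
      have h2 := pow_le_pow_left₀ (by positivity) ih 2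
      rw [← pow_mul, ← pow_succ, mul_pow] at h2
      refine h2.trans ((mul_le_mul_of_nonneg_right h1 (by positivity)).trans (le_of_eq ?_))
      have e : 2 ^ (k + 1) - 1 = 1 + (2 ^ k - 1) * 2 := by
        have := Nat.one_le_two_pow (n := k)
        rw [pow_succ]; omega
      have e' : (‖v‖ ^ 2) ^ (2 ^ (k + 1) - 1) = ‖v‖ ^ 2 * ((‖v‖ ^ 2) ^ (2 ^ k - 1)) ^ 2 := by
        rw [e, pow_add, pow_one]; ring
      rw [e']
      ring
  by_contra hcon
  push Not at hcon
  set q : ℝ := (‖S v‖ / (l * ‖v‖)) ^ 2 with hq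
  have hq1 : 1 < q := by
    rw [hq]
    exact one_lt_pow₀ ((one_lt_div (by positivity)).2 hcon) (by norm_num)
  have hb : ∀ k : ℕ, q ^ 2 ^ k ≤ c / ‖v‖ ^ 2 := by
    intro k
    have h1 := (key k).trans (mul_le_mul_of_nonneg_right (hm (2 ^ k)) (by positivity))
    have h2 : (‖v‖ ^ 2) ^ (2 ^ k - 1) = (‖v‖ ^ 2) ^ 2 ^ k / ‖v‖ ^ 2 := by
      rw [eq_div_iff (by positivity), ← pow_succ, Nat.sub_add_cancel Nat.one_le_two_pow]
    rw [h2, pow_mul] at h1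
    rw [hq, div_pow, div_pow, div_le_iff₀ (by positivity)]
    refine h1.trans (le_of_eq ?_)
    rw [mul_pow, mul_pow]; ring
  obtain ⟨n, hn⟩ := pow_unbounded_of_one_lt (c / ‖v‖ ^ 2) hq1
  exact absurd (hb n) (not_le.2 (hn.trans_le (pow_le_pow_right₀ hq1.le Nat.lt_two_pow_self.le)))

theorem norm_avgOp_le (hπ : ∀ v, Continuous fun g => π g v) {θ : Ω → SL3} (hθ : Continuous θ)
    {H : Subgroup SL3} (hH : ∀ ω, θ ω ∈ H) {ψ : SL3 → ℝ} {l : ℝ} (hl0 : 0 < l)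
    (hi : ∀ h ∈ H, Integrable (fun ω => ψ (h * θ ω)) ρ)
    (hl : ∀ h ∈ H, ∫ ω, ψ (h * θ ω) ∂ρ = l * ψ h)
    (hi' : ∀ h ∈ H, Integrable (fun ω => ψ (h * (θ ω)⁻¹)) ρ)
    (hl' : ∀ h ∈ H, ∫ ω, ψ (h * (θ ω)⁻¹) ∂ρ = l * ψ h) {c : ℝ} {v : V}
    (hv : ∀ h ∈ H, ‖⟪v, π h v⟫_ℂ‖ ≤ c * ψ h) : ‖avgOp hπ ρ hθ v‖ ≤ l * ‖v‖ := by
  have hind : ∀ n, ∀ h ∈ H,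
      ‖⟪v, π h (((avgOp hπ ρ hθ.inv * avgOp hπ ρ hθ) ^ n) v)⟫_ℂ‖ ≤ c * l ^ (2 * n) * ψ h := by
    intro n
    induction n with
    | zero => simpa using hv
    | succ n ih =>
      intro h hh
      rw [pow_succ', mul_apply_eq_comp, mul_apply_eq_comp]
      refine (norm_inner_avgOp_le hπ hθ.inv (fun ω => H.inv_mem (hH ω)) hi' hl'
        (norm_inner_avgOp_le hπ hθ hH hi hl ih) h hh).trans (le_of_eq ?_)
      ring
  refine norm_sq_le_of_moments (S' := avgOp hπ ρ hθ.inv) (c := c * ψ 1)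
    (inner_avgOp_left hπ hθ) hl0 fun n => ?_
  have := hind n 1 H.one_mem
  rw [map_one] at this
  refine this.trans (le_of_eq (by ring))

end Averaging

section Lorentz

lemma Jmat_mul_self : Jmat * Jmat = 1 := by
  unfold Jmat
  rw [Matrix.diagonal_mul_diagonal, ← Matrix.diagonal_one]
  congr 1
  ext i; fin_cases i <;> simp

lemma mul_Jmat_transpose {h : Matrix (Fin 3) (Fin 3) ℝ} (hh : hᵀ * Jmat * h = Jmat) :
    h * Jmat * hᵀ = Jmat := by
  have h1 : (Jmat * hᵀ * Jmat) * h = 1 := by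
    rw [mul_assoc, mul_assoc, ← mul_assoc hᵀ, hh, Jmat_mul_self]
  have h2 := mul_eq_one_comm.1 h1
  calc h * Jmat * hᵀ = h * (Jmat * hᵀ * Jmat) * Jmat := by
        simp only [mul_assoc, Jmat_mul_self, mul_one]
    _ = Jmat := by rw [h2, one_mul]

/-- The quadratic form `x₂² - x₀² - x₁²` in coordinates. -/
lemma transpose_Jmat_apply (h : Matrix (Fin 3) (Fin 3) ℝ) (i j : Fin 3) :
    (hᵀ * Jmat * h) i j = -(h 0 i * h 0 j) - h 1 i * h 1 j + h 2 i * h 2 j := by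
  simp [Jmat, Matrix.mul_apply, Fin.sum_univ_three, Matrix.diagonal_apply]
  ring

lemma Jmat_transpose_apply (h : Matrix (Fin 3) (Fin 3) ℝ) (i j : Fin 3) :
    (h * Jmat * hᵀ) i j = -(h i 0 * h j 0) - h i 1 * h j 1 + h i 2 * h j 2 := by
  simpa using transpose_Jmat_apply hᵀ i j

lemma pos_of_cone {a b c x y z : ℝ} (hc : 0 < c) (hz : 0 < z) (h1 : c ^ 2 = 1 + a ^ 2 + b ^ 2)
    (h2 : x ^ 2 + y ^ 2 ≤ z ^ 2) : 0 < a * x + b * y + c * z := by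
  have h3 : (a * x + b * y) ^ 2 < (c * z) ^ 2 := by
    have : (a * x + b * y) ^ 2 ≤ (a ^ 2 + b ^ 2) * (x ^ 2 + y ^ 2) := by
      nlinarith [sq_nonneg (a * y - b * x)]
    have : (a ^ 2 + b ^ 2) * (x ^ 2 + y ^ 2) ≤ (a ^ 2 + b ^ 2) * z ^ 2 := by gcongr
    have : (c * z) ^ 2 = (1 + a ^ 2 + b ^ 2) * z ^ 2 := by rw [mul_pow, h1]
    nlinarith [sq_pos_of_pos hz]
  have h4 := abs_lt_of_sq_lt_sq h3 (by positivity)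
  have := neg_abs_le (a * x + b * y)
  rw [abs_lt] at h4
  linarith [h4.1]

/-- The group preserving the form and the time direction. -/
def SO21 : Subgroup SL3 where
  carrier := {h | h.1ᵀ * Jmat * h.1 = Jmat ∧ 0 < h.1 2 2}
  mul_mem' := by
    rintro g h ⟨hg, hg0⟩ ⟨hh, hh0⟩
    refine ⟨?_, ?_⟩
    · change (g.1 * h.1)ᵀ * Jmat * (g.1 * h.1) = Jmat
      rw [Matrix.transpose_mul]
      calc h.1ᵀ * g.1ᵀ * Jmat * (g.1 * h.1) = h.1ᵀ * (g.1ᵀ * Jmat * g.1) * h.1 := by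
            simp only [mul_assoc]
        _ = Jmat := by rw [hg, hh]
    · change 0 < (g.1 * h.1) 2 2
      have e1 := congrFun (congrFun (mul_Jmat_transpose hg) 2) 2
      have e2 := congrFun (congrFun hh 2) 2
      rw [Jmat_transpose_apply] at e1
      rw [transpose_Jmat_apply] at e2
      simp [Jmat] at e1 e2
      simp only [Matrix.mul_apply, Fin.sum_univ_three]
      exact pos_of_cone hg0 hh0 (by linarith) (by linarith)
  one_mem' := by simp
  inv_mem' := by
    rintro g ⟨hg, hg0⟩
    have h1 : (Jmat * g.1ᵀ * Jmat) * g.1 = 1 := by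
      rw [mul_assoc, mul_assoc, ← mul_assoc g.1ᵀ, hg, Jmat_mul_self]
    have e : (g⁻¹).1 = Jmat * g.1ᵀ * Jmat := by
      have h2 : (g⁻¹).1 * g.1 = 1 := by
        rw [← Matrix.SpecialLinearGroup.coe_mul, inv_mul_cancel]; rfl
      have h3 : g.1 * (g⁻¹).1 = 1 := mul_eq_one_comm.1 h2
      calc (g⁻¹).1 = (Jmat * g.1ᵀ * Jmat) * g.1 * (g⁻¹).1 := by rw [h1, one_mul]
        _ = _ := by rw [mul_assoc _ g.1, h3, mul_one]
    have hT : Jmatᵀ = Jmat := by simp [Jmat]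
    refine ⟨?_, ?_⟩
    · rw [e]
      simp only [Matrix.transpose_mul, Matrix.transpose_transpose, hT]
      calc Jmat * (g.1 * Jmat) * Jmat * (Jmat * g.1ᵀ * Jmat)
          = Jmat * (g.1 * (Jmat * (Jmat * Jmat)) * g.1ᵀ) * Jmat := by simp only [mul_assoc]
        _ = Jmat * (g.1 * Jmat * g.1ᵀ) * Jmat := by rw [Jmat_mul_self, mul_one]
        _ = Jmat := by rw [mul_Jmat_transpose hg, Jmat_mul_self, one_mul]
    · rw [e]
      simpa [Jmat, Matrix.mul_apply, Fin.sum_univ_three, Matrix.diagonal_apply] using hg0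

lemma mem_SO21 {h : SL3} : h ∈ SO21 ↔ h.1ᵀ * Jmat * h.1 = Jmat ∧ 0 < h.1 2 2 := Iff.rfl

/-- Rotation in the first two coordinates. -/
noncomputable def rot (x : ℝ) : SL3 :=
  ⟨!![Real.cos x, -Real.sin x, 0; Real.sin x, Real.cos x, 0; 0, 0, 1], by
    simp [Matrix.det_fin_three, ← sq]⟩

/-- Lorentz boost in the first and last coordinates. -/
noncomputable def boost (s : ℝ) : SL3 :=
  ⟨!![Real.cosh s, 0, Real.sinh s; 0, 1, 0; Real.sinh s, 0, Real.cosh s], by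
    simp [Matrix.det_fin_three]; linarith [Real.cosh_sq s]⟩

lemma rot_coe (x : ℝ) : (rot x : Matrix (Fin 3) (Fin 3) ℝ) =
    !![Real.cos x, -Real.sin x, 0; Real.sin x, Real.cos x, 0; 0, 0, 1] := rfl

lemma boost_coe (s : ℝ) : (boost s : Matrix (Fin 3) (Fin 3) ℝ) =
    !![Real.cosh s, 0, Real.sinh s; 0, 1, 0; Real.sinh s, 0, Real.cosh s] := rfl

lemma continuous_rot : Continuous rot := by
  refine SL3.continuous_mk (continuous_matrix fun i j => ?_) _
  fin_cases i <;> fin_cases j <;> simp <;> fun_prop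

lemma rot_mem (x : ℝ) : rot x ∈ SO21 := by
  refine ⟨?_, ?_⟩
  · ext i j
    rw [transpose_Jmat_apply, rot_coe]
    have := Real.sin_sq_add_cos_sq x
    fin_cases i <;> fin_cases j <;> simp [Jmat] <;> nlinarith
  · rw [rot_coe]; simp

lemma boost_mem (s : ℝ) : boost s ∈ SO21 := by
  refine ⟨?_, ?_⟩
  · ext i j
    rw [transpose_Jmat_apply, boost_coe]
    have := Real.cosh_sq s
    fin_cases i <;> fin_cases j <;> simp [Jmat] <;> nlinarith
  · rw [boost_coe]; simpa using Real.cosh_pos s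

lemma rot_inv (x : ℝ) : (rot x)⁻¹ = rot (-x) := by
  rw [inv_eq_iff_mul_eq_one]
  refine Subtype.ext ?_
  rw [Matrix.SpecialLinearGroup.coe_mul, rot_coe, rot_coe]
  have := Real.sin_sq_add_cos_sq x
  ext i j; fin_cases i <;> fin_cases j <;> simp <;> nlinarith

lemma boost_inv (s : ℝ) : (boost s)⁻¹ = boost (-s) := by
  rw [inv_eq_iff_mul_eq_one]
  refine Subtype.ext ?_
  rw [Matrix.SpecialLinearGroup.coe_mul, boost_coe, boost_coe]
  have := Real.cosh_sq s
  ext i j; fin_cases i <;> fin_cases j <;> simp <;> nlinarith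

lemma exists_rot_of_mem {g : SL3} (hg : g ∈ SO21) (h0 : g.1 0 2 = 0) (h1 : g.1 1 2 = 0)
    (h2 : g.1 2 2 = 1) : ∃ x, g = rot x := by
  have e := Jmat_transpose_apply g.1
  have e' := transpose_Jmat_apply g.1
  rw [mul_Jmat_transpose hg.1] at e
  rw [hg.1] at e'
  have r := e 2 2
  have c0 := e' 0 0
  have c1 := e' 1 1
  have c01 := e' 0 1
  have d := g.2
  rw [Matrix.det_fin_three] at d
  simp [Jmat, h2] at r c0 c1 c01
  have z0 : g.1 2 0 = 0 := by nlinarith [sq_nonneg (g.1 2 1), sq_nonneg (g.1 2 0)]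
  have z1 : g.1 2 1 = 0 := by nlinarith [sq_nonneg (g.1 2 1), sq_nonneg (g.1 2 0)]
  rw [z0] at c0 c01
  rw [z1] at c1 c01
  rw [h0, h1, h2, z0, z1] at d
  ring_nf at d c0 c1 c01
  have hu : g.1 0 0 ^ 2 + g.1 1 0 ^ 2 = 1 := by linarith
  obtain ⟨x, hx⟩ : ∃ x : ℝ, (⟨g.1 0 0, g.1 1 0⟩ : ℂ) = Complex.exp (x * Complex.I) := by
    refine ⟨Complex.arg ⟨g.1 0 0, g.1 1 0⟩, ?_⟩
    have hn : ‖(⟨g.1 0 0, g.1 1 0⟩ : ℂ)‖ = 1 := by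
      rw [Complex.norm_def, Complex.normSq_mk, ← sq, ← sq, hu, Real.sqrt_one]
    have := Complex.norm_mul_exp_arg_mul_I ⟨g.1 0 0, g.1 1 0⟩
    rw [hn] at this
    simpa using this.symm
  have hc : g.1 0 0 = Real.cos x := by
    have := congrArg Complex.re hx
    simpa [Complex.exp_ofReal_mul_I_re] using this
  have hs : g.1 1 0 = Real.sin x := by
    have := congrArg Complex.im hx
    simpa [Complex.exp_ofReal_mul_I_im] using this
  have h11 : g.1 1 1 = g.1 0 0 := by
    linear_combination (-g.1 1 1) * hu + g.1 0 0 * d + g.1 1 0 * c01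
  have h01 : g.1 0 1 = -g.1 1 0 := by
    linear_combination (-g.1 0 1) * hu - g.1 1 0 * d + g.1 0 0 * c01
  refine ⟨x, Subtype.ext ?_⟩
  rw [rot_coe]
  ext i j
  fin_cases i <;> fin_cases j <;> simp [h0, h1, h2, z0, z1, h11, h01, hc, hs]

/-- The Cartan decomposition. -/
lemma exists_cartan {h : SL3} (hh : h ∈ SO21) :
    ∃ a s b : ℝ, 0 ≤ s ∧ h = rot a * boost s * rot b := by
  have e' := transpose_Jmat_apply h.1 2 2
  rw [hh.1] at e'
  simp [Jmat] at e'
  obtain ⟨s, hs0, hs⟩ : ∃ s, 0 ≤ s ∧ Real.cosh s = h.1 2 2 :=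
    ⟨Real.arcosh (h.1 2 2), Real.arcosh_nonneg (by nlinarith [hh.2]),
      Real.cosh_arcosh (by nlinarith [hh.2])⟩
  have hsh : 0 ≤ Real.sinh s := Real.sinh_nonneg_iff.2 hs0
  have hsq : Real.sinh s ^ 2 = h.1 0 2 ^ 2 + h.1 1 2 ^ 2 := by
    have := Real.cosh_sq s
    rw [hs] at this; nlinarith
  obtain ⟨a, ha⟩ : ∃ a : ℝ, (⟨h.1 0 2, h.1 1 2⟩ : ℂ) =
      Real.sinh s * Complex.exp (a * Complex.I) := by
    refine ⟨Complex.arg ⟨h.1 0 2, h.1 1 2⟩, ?_⟩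
    have hn : ‖(⟨h.1 0 2, h.1 1 2⟩ : ℂ)‖ = Real.sinh s := by
      rw [Complex.norm_def, Complex.normSq_mk, ← sq, ← sq, ← hsq, Real.sqrt_sq hsh]
    rw [← hn, Complex.norm_mul_exp_arg_mul_I]
  have hc : h.1 0 2 = Real.sinh s * Real.cos a := by
    have := congrArg Complex.re ha
    rw [Complex.re_ofReal_mul, Complex.exp_ofReal_mul_I_re] at this
    exact this
  have hsn : h.1 1 2 = Real.sinh s * Real.sin a := by
    have := congrArg Complex.im ha
    rw [Complex.im_ofReal_mul, Complex.exp_ofReal_mul_I_im] at this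
    exact this
  have hgm : boost (-s) * rot (-a) * h ∈ SO21 :=
    SO21.mul_mem (SO21.mul_mem (boost_mem _) (rot_mem _)) hh
  have hcs := Real.sin_sq_add_cos_sq a
  have hch := Real.cosh_sq s
  obtain ⟨b, hb⟩ := exists_rot_of_mem hgm
    (by
      simp [Matrix.mul_apply, Fin.sum_univ_three, boost_coe, rot_coe, hc, hsn, ← hs]
      linear_combination (Real.cosh s * Real.sinh s) * hcs)
    (by
      simp [Matrix.mul_apply, Fin.sum_univ_three, boost_coe, rot_coe, hc, hsn]
      ring)
    (by
      simp [Matrix.mul_apply, Fin.sum_univ_three, boost_coe, rot_coe, hc, hsn, ← hs]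
      linear_combination (-(Real.sinh s) ^ 2) * hcs + hch)
  refine ⟨a, s, b, hs0, ?_⟩
  rw [← hb, ← boost_inv, ← rot_inv]
  group

end Lorentz

section SphericalAverage

open Real

/-- The family of elements of Cartan radius `s`. -/
noncomputable def theta (s : ℝ) (p : ℝ × ℝ) : SL3 := rot p.1 * boost s * rot p.2

lemma continuous_theta (s : ℝ) : Continuous (theta s) :=
  ((continuous_rot.comp continuous_fst).mul continuous_const).mul
    (continuous_rot.comp continuous_snd)

lemma theta_mem (s : ℝ) (p : ℝ × ℝ) : theta s p ∈ SO21 :=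
  SO21.mul_mem (SO21.mul_mem (rot_mem _) (boost_mem _)) (rot_mem _)

lemma theta_inv (s : ℝ) (p : ℝ × ℝ) : (theta s p)⁻¹ = theta (-s) (-p.2, -p.1) := by
  simp only [theta, _root_.mul_inv_rev, rot_inv, boost_inv, mul_assoc]

/-- The reference spherical-type function. -/
noncomputable def psi (σ : ℝ) (h : SL3) : ℝ := (h.1 2 2 - h.1 0 2) ^ (-σ)

/-- Normalized Lebesgue measure on a period. -/
noncomputable def circ : Measure ℝ :=
  (ENNReal.ofReal (2 * π))⁻¹ • volume.restrict (Set.Ioc (-π) π)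

instance : IsProbabilityMeasure circ := ⟨by
  have h : (0 : ℝ) < 2 * π := by positivity
  simp only [circ, Measure.smul_apply, Measure.restrict_apply_univ, Real.volume_Ioc, smul_eq_mul]
  rw [show π - -π = 2 * π by ring]
  exact ENNReal.inv_mul_cancel (by simpa using h) ENNReal.ofReal_ne_top⟩

lemma integral_circ (f : ℝ → ℝ) : ∫ x, f x ∂circ = (2 * π)⁻¹ * ∫ x in (-π)..π, f x := by
  rw [circ, integral_smul_measure, intervalIntegral.integral_of_le (by linarith [pi_pos]),
    ENNReal.toReal_inv, ENNReal.toReal_ofReal (by positivity), smul_eq_mul]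

lemma circ_eq_of_periodic {f : ℝ → ℝ} (hf : Function.Periodic f (2 * π)) (b : ℝ) :
    ∫ x, f (x + b) ∂circ = ∫ x, f x ∂circ := by
  rw [integral_circ, integral_circ, intervalIntegral.integral_comp_add_right]
  congr 1
  have := hf.intervalIntegral_add_eq (-π + b) (-π)
  rw [show π + b = -π + b + 2 * π by ring, this]
  congr 1; ring

/-- The spherical average governing the spectral bound. -/
noncomputable def lam (σ s : ℝ) : ℝ := ∫ x, (cosh s - sinh s * cos x) ^ (-σ) ∂circ

lemma cosh_sub_sinh_mul_pos (s : ℝ) {c : ℝ} (hc : |c| ≤ 1) : 0 < cosh s - sinh s * c := by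
  have h : |sinh s * c| < cosh s := by
    rw [abs_mul]
    have : |sinh s| < cosh s := by
      refine abs_lt_of_sq_lt_sq ?_ (cosh_pos s).le
      rw [cosh_sq]; linarith
    nlinarith [abs_nonneg (sinh s), abs_nonneg c]
  linarith [(abs_lt.1 h).2]

lemma continuous_lam_integrand (σ s b : ℝ) :
    Continuous fun x => (cosh s - sinh s * cos (x + b)) ^ (-σ) := by
  refine Continuous.rpow_const (by fun_prop) fun x => Or.inl ?_
  exact (cosh_sub_sinh_mul_pos s (abs_cos_le_one _)).ne'

lemma integrable_circ {f : ℝ → ℝ} (hf : Continuous f) : Integrable f circ := by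
  refine Integrable.smul_measure ?_ (by simp [pi_pos])
  exact (hf.integrableOn_Icc (a := -π) (b := π)).mono_set Set.Ioc_subset_Icc_self

lemma lam_shift (σ s b : ℝ) :
    ∫ x, (cosh s - sinh s * cos (x + b)) ^ (-σ) ∂circ = lam σ s :=
  circ_eq_of_periodic (f := fun x => (cosh s - sinh s * cos x) ^ (-σ))
    (fun x => by simp [cos_add_two_pi]) b

lemma lam_neg (σ s : ℝ) : lam σ (-s) = lam σ s := by
  rw [← lam_shift σ s π, lam]
  simp [cos_add_pi]

lemma lam_pos (σ s : ℝ) : 0 < lam σ s := by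
  have hi := integrable_circ (continuous_lam_integrand σ s 0)
  simp only [add_zero] at hi
  have hp : ∀ x, 0 < (cosh s - sinh s * cos x) ^ (-σ) := fun x =>
    rpow_pos_of_pos (cosh_sub_sinh_mul_pos s (abs_cos_le_one _)) _
  rw [lam, integral_pos_iff_support_of_nonneg (fun x => (hp x).le) hi]
  have : Function.support (fun x => (cosh s - sinh s * cos x) ^ (-σ)) = Set.univ :=
    Set.eq_univ_of_forall fun x => (hp x).ne'
  rw [this]; simp

lemma psi_mul_theta {h : SL3} (hh : h ∈ SO21) :
    ∃ b, ∀ σ s p, psi σ (h * theta s p) =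
      psi σ h * (cosh s - sinh s * cos (p.1 + b)) ^ (-σ) := by
  have e := Jmat_transpose_apply h.1
  rw [mul_Jmat_transpose hh.1] at e
  have e22 := e 2 2
  have e00 := e 0 0
  have e02 := e 0 2
  simp [Jmat] at e22 e00 e02
  set x := h.1 0 0 - h.1 2 0 with hx
  set y := h.1 0 1 - h.1 2 1 with hy
  set z := h.1 2 2 - h.1 0 2 with hz
  have hnull : x ^ 2 + y ^ 2 = z ^ 2 := by rw [hx, hy, hz]; nlinarith
  have hz0 : 0 < z := by
    have c := transpose_Jmat_apply h.1 2 2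
    rw [hh.1] at c
    simp [Jmat] at c
    have : |h.1 0 2| < h.1 2 2 := by
      refine abs_lt_of_sq_lt_sq ?_ hh.2.le
      nlinarith [sq_nonneg (h.1 1 2)]
    linarith [(abs_lt.1 this).2]
  obtain ⟨b, hb⟩ : ∃ b : ℝ, (⟨x, -y⟩ : ℂ) = z * Complex.exp (b * Complex.I) := by
    refine ⟨Complex.arg ⟨x, -y⟩, ?_⟩
    have hn : ‖(⟨x, -y⟩ : ℂ)‖ = z := by
      rw [Complex.norm_def, Complex.normSq_mk, ← sq, ← sq, neg_sq, hnull, Real.sqrt_sq hz0.le]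
    rw [← hn, Complex.norm_mul_exp_arg_mul_I]
  have hc : x = z * cos b := by
    have := congrArg Complex.re hb
    rw [Complex.re_ofReal_mul, Complex.exp_ofReal_mul_I_re] at this
    exact this
  have hsn : -y = z * sin b := by
    have := congrArg Complex.im hb
    rw [Complex.im_ofReal_mul, Complex.exp_ofReal_mul_I_im] at this
    exact this
  refine ⟨b, fun σ s p => ?_⟩
  have key : (h * theta s p).1 2 2 - (h * theta s p).1 0 2 =
      z * (cosh s - sinh s * cos (p.1 + b)) := by
    have h1 : (h * theta s p).1 2 2 - (h * theta s p).1 0 2 =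
        z * cosh s - x * (cos p.1 * sinh s) - y * (sin p.1 * sinh s) := by
      simp [theta, Matrix.mul_apply, Fin.sum_univ_three, boost_coe, rot_coe, hx, hy, hz]
      ring
    rw [h1, cos_add, hc, show y = -(z * sin b) by linarith]
    ring
  rw [psi, key, mul_rpow hz0.le (cosh_sub_sinh_mul_pos s (abs_cos_le_one _)).le]
  rfl

lemma integrable_psi_theta (σ s : ℝ) {h : SL3} (hh : h ∈ SO21) :
    Integrable (fun p => psi σ (h * theta s p)) (circ.prod circ) := by
  obtain ⟨b, hb⟩ := psi_mul_theta hh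
  simp_rw [hb]
  exact ((integrable_circ (continuous_lam_integrand σ s b)).const_mul (psi σ h)).comp_fst _

lemma integral_psi_theta (σ s : ℝ) {h : SL3} (hh : h ∈ SO21) :
    ∫ p, psi σ (h * theta s p) ∂(circ.prod circ) = lam σ s * psi σ h := by
  obtain ⟨b, hb⟩ := psi_mul_theta hh
  simp_rw [hb]
  rw [integral_fun_fst (f := fun x => psi σ h * (cosh s - sinh s * cos (x + b)) ^ (-σ)),
    integral_const_mul, lam_shift, mul_comm]
  simp

lemma integrable_psi_theta_inv (σ s : ℝ) {h : SL3} (hh : h ∈ SO21) :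
    Integrable (fun p => psi σ (h * (theta s p)⁻¹)) (circ.prod circ) := by
  obtain ⟨b, hb⟩ := psi_mul_theta hh
  simp_rw [theta_inv, hb, ← sub_eq_neg_add, ← cos_neg (b - _), neg_sub, sub_eq_add_neg _ b]
  exact ((integrable_circ (continuous_lam_integrand σ (-s) (-b))).const_mul (psi σ h)).comp_snd _

lemma integral_psi_theta_inv (σ s : ℝ) {h : SL3} (hh : h ∈ SO21) :
    ∫ p, psi σ (h * (theta s p)⁻¹) ∂(circ.prod circ) = lam σ s * psi σ h := by
  obtain ⟨b, hb⟩ := psi_mul_theta hh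
  simp_rw [theta_inv, hb, ← sub_eq_neg_add, ← cos_neg (b - _), neg_sub, sub_eq_add_neg _ b]
  rw [integral_fun_snd (f := fun x => psi σ h * (cosh (-s) - sinh (-s) * cos (x + -b)) ^ (-σ)),
    integral_const_mul, lam_shift, lam_neg, mul_comm]
  simp

/-- The spherical average decays exponentially. -/
lemma exists_lam_le {σ : ℝ} (h0 : 0 < σ) (h1 : σ < 1 / 2) :
    ∃ C, 0 < C ∧ ∀ s, 0 ≤ s → lam σ s ≤ C * rexp (-(σ * s)) := by
  have hI : IntervalIntegrable (fun x : ℝ => (|x| / π) ^ (-(2 * σ))) volume (-π) π := by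
    have h2 : IntervalIntegrable (fun x : ℝ => (|x| / π) ^ (-(2 * σ))) volume 0 π := by
      have h3 := (intervalIntegral.intervalIntegrable_rpow' (a := 0) (b := π)
        (r := -(2 * σ)) (by linarith)).div_const (π ^ (-(2 * σ)))
      refine h3.congr fun x hx => ?_
      rw [Set.uIoc_of_le pi_pos.le] at hx
      rw [abs_of_pos hx.1, div_rpow hx.1.le pi_pos.le]
    have h3 : IntervalIntegrable (fun x : ℝ => (|x| / π) ^ (-(2 * σ))) volume (-π) 0 := by
      have := (IntervalIntegrable.iff_comp_neg (f := fun x : ℝ => (|x| / π) ^ (-(2 * σ)))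
        (a := 0) (b := π)).1 h2
      simpa using this.symm
    exact h3.trans h2
  set C := (2 * π)⁻¹ * ∫ x in (-π)..π, (|x| / π) ^ (-(2 * σ)) with hC
  refine ⟨max C 1, by positivity, fun s hs => ?_⟩
  rw [lam, integral_circ]
  have hle : ∫ x in (-π)..π, (cosh s - sinh s * cos x) ^ (-σ) ≤
      ∫ x in (-π)..π, rexp (-(σ * s)) * (|x| / π) ^ (-(2 * σ)) := by
    have hci := (continuous_lam_integrand σ s 0).intervalIntegrable (μ := volume) (-π) π
    simp only [add_zero] at hci
    refine intervalIntegral.integral_mono_ae_restrict (by linarith [pi_pos]) hci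
      (hI.const_mul _) ?_
    have hae : ∀ᵐ x ∂(volume.restrict (Set.Icc (-π) π)), x ≠ 0 := by
      refine ae_restrict_of_ae ?_
      simp [ae_iff]
    filter_upwards [hae, ae_restrict_mem measurableSet_Icc] with x hx0 hx
    have hxp : 0 < |x| := abs_pos.2 hx0
    have hxpi : |x| ≤ π := abs_le.2 hx
    have hq : (|x| / π) ^ 2 ≤ sin (x / 2) ^ 2 := by
      have := mul_le_sin (x := |x| / 2) (by positivity) (by linarith)
      have e : sin (|x| / 2) ^ 2 = sin (x / 2) ^ 2 := by
        rcases abs_choice x with h | h <;> rw [h]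
        rw [neg_div, sin_neg, neg_sq]
      rw [← e]
      refine pow_le_pow_left₀ (by positivity) (le_trans (le_of_eq ?_) this) 2
      field_simp
    have hlow : rexp s * (|x| / π) ^ 2 ≤ cosh s - sinh s * cos x := by
      have hcos : cos x = 1 - 2 * sin (x / 2) ^ 2 := by
        have := cos_two_mul (x / 2)
        rw [show 2 * (x / 2) = x by ring] at this
        nlinarith [sin_sq_add_cos_sq (x / 2)]
      have h1 : cosh s - sinh s * cos x =
          rexp s * sin (x / 2) ^ 2 + rexp (-s) * (1 - sin (x / 2) ^ 2) := by
        rw [hcos, cosh_eq, sinh_eq]; ring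
      rw [h1]
      have h2 : 0 ≤ rexp (-s) * (1 - sin (x / 2) ^ 2) :=
        mul_nonneg (exp_pos _).le (by nlinarith [sin_sq_le_one (x / 2)])
      have h3 := mul_le_mul_of_nonneg_left hq (exp_pos s).le
      linarith
    have hbase : 0 < |x| / π := by positivity
    calc (cosh s - sinh s * cos x) ^ (-σ) ≤ (rexp s * (|x| / π) ^ 2) ^ (-σ) :=
          rpow_le_rpow_of_nonpos (by positivity) hlow (by linarith)
      _ = rexp (-(σ * s)) * (|x| / π) ^ (-(2 * σ)) := by
          rw [mul_rpow (exp_pos s).le (by positivity), ← exp_mul, ← rpow_natCast,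
            ← rpow_mul hbase.le]
          congr 2 <;> push_cast <;> ring
  rw [intervalIntegral.integral_const_mul] at hle
  calc (2 * π)⁻¹ * ∫ x in (-π)..π, (cosh s - sinh s * cos x) ^ (-σ)
      ≤ (2 * π)⁻¹ * (rexp (-(σ * s)) * ∫ x in (-π)..π, (|x| / π) ^ (-(2 * σ))) := by gcongr
    _ = C * rexp (-(σ * s)) := by rw [hC]; ring
    _ ≤ max C 1 * rexp (-(σ * s)) := by gcongr; exact le_max_left _ _

end SphericalAverage

section SpectralGap

open scoped InnerProductSpace

variable {V : Type*} [NormedAddCommGroup V] [InnerProductSpace ℂ V] [CompleteSpace V]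
  {π : SL3 →* (V ≃ₗᵢ[ℂ] V)} {μ : Measure SL3} [μ.IsHaarMeasure]

/-- The matrix diagonalizing the boosts. -/
noncomputable def diagC : SL3 :=
  ⟨!![√2 / 2, 0, -(√2 / 2); 0, 1, 0; √2 / 2, 0, √2 / 2], by
    have := Real.sq_sqrt (show (0 : ℝ) ≤ 2 by norm_num)
    simp [Matrix.det_fin_three]; nlinarith⟩

lemma diagC_coe : (diagC : Matrix (Fin 3) (Fin 3) ℝ) =
    !![√2 / 2, 0, -(√2 / 2); 0, 1, 0; √2 / 2, 0, √2 / 2] := rfl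

lemma boost_eq (s : ℝ) : boost s = diagC * dT (Real.exp s) (Real.exp_pos s).ne' * diagC⁻¹ := by
  rw [eq_mul_inv_iff_mul_eq]
  refine Subtype.ext ?_
  rw [Matrix.SpecialLinearGroup.coe_mul, Matrix.SpecialLinearGroup.coe_mul, boost_coe, dT_coe,
    diagC_coe]
  ext i j
  fin_cases i <;> fin_cases j <;>
    simp [Real.cosh_eq, Real.sinh_eq, ← Real.exp_neg, Fin.sum_univ_three, Matrix.mul_apply] <;> ring

lemma isCompact_range_rot (c : SL3) : IsCompact (Set.range fun x => c * rot x) := by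
  have hper : Function.Periodic (fun x => c * rot x) (2 * Real.pi) := by
    intro x
    simp only
    congr 1
    refine Subtype.ext ?_
    rw [rot_coe, rot_coe, Real.cos_add_two_pi, Real.sin_add_two_pi]
  rw [← hper.image_Icc (by positivity) 0]
  exact isCompact_Icc.image (continuous_const.mul continuous_rot)

lemma psi_cartan (σ a s b : ℝ) : psi σ (rot a * boost s * rot b) =
    (Real.cosh s - Real.sinh s * Real.cos a) ^ (-σ) := by
  rw [psi]
  congr 1
  simp [Matrix.mul_apply, Fin.sum_univ_three, boost_coe, rot_coe]
  ring

lemma exp_le_psi {σ : ℝ} (h0 : 0 < σ) (h1 : σ < 1 / 2) (a b : ℝ) {s : ℝ} (hs : 0 ≤ s) :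
    (√(Real.exp s))⁻¹ ≤ psi σ (rot a * boost s * rot b) := by
  rw [psi_cartan, Real.sqrt_eq_rpow, ← Real.exp_mul, ← Real.exp_neg]
  have hp := cosh_sub_sinh_mul_pos s (Real.abs_cos_le_one a)
  have hle : Real.cosh s - Real.sinh s * Real.cos a ≤ Real.exp s := by
    rw [← Real.cosh_add_sinh]
    nlinarith [Real.neg_one_le_cos a, Real.sinh_nonneg_iff.2 hs]
  refine le_trans ?_ (Real.rpow_le_rpow_of_nonpos hp hle (by linarith))
  rw [← Real.exp_mul]
  exact Real.exp_le_exp.2 (by nlinarith)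

lemma exists_coeff_bound (hπ : ∀ v, Continuous fun g => π g v) {φ : SL3 → ℝ}
    (hφ : Continuous φ) (hs : HasCompactSupport φ) {v : V} (hv : ‖v‖ = 1)
    (hperp : v ∈ (invVec π)ᗮ) {σ : ℝ} (h0 : 0 < σ) (h1 : σ < 1 / 2) :
    ∃ C : ℝ, ∀ h ∈ SO21,
      ‖⟪smoothVec π μ φ v, π h (smoothVec π μ φ v)⟫_ℂ‖ ≤ C * psi σ h := by
  obtain ⟨C, hC0, hC⟩ := exists_decay_bound (μ := μ) hπ hφ hs hv hperp
    (isCompact_range_rot diagC⁻¹)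
  refine ⟨C, fun h hh => ?_⟩
  obtain ⟨a, s, b, hs0, rfl⟩ := exists_cartan hh
  have hb := hC (Real.exp s) (Real.one_le_exp hs0) (Real.exp_pos s).ne' _ ⟨b, rfl⟩ _ ⟨-a, rfl⟩
  refine le_trans (le_of_eq ?_) (hb.trans (mul_le_mul_of_nonneg_left
    (exp_le_psi h0 h1 a b hs0) hC0))
  rw [← norm_inner_symm, inner_pi_left, inner_pi_left, inner_pi_left, boost_eq]
  simp only [← pi_mul_apply]
  congr 5
  rw [← rot_inv]
  simp only [_root_.mul_inv_rev, inv_inv, mul_assoc]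

/-- Smoothing by an approximate identity. -/
lemma exists_smooth_near (hπ : ∀ v, Continuous fun g => π g v) (μ : Measure SL3)
    [μ.IsHaarMeasure] (v : V) {ε : ℝ} (hε : 0 < ε) :
    ∃ φ : SL3 → ℝ, Continuous φ ∧ HasCompactSupport φ ∧ ‖smoothVec π μ φ v - v‖ ≤ ε := by
  have hU : IsOpen {g : SL3 | ‖π g v - v‖ < ε} :=
    isOpen_lt ((hπ v).sub continuous_const).norm continuous_const
  have h1 : (1 : SL3) ∈ {g : SL3 | ‖π g v - v‖ < ε} := by
    simp [map_one, hε]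
  obtain ⟨f, hf1, hf0, hfs, hf⟩ := exists_continuous_one_zero_of_isCompact
    (isCompact_singleton (x := (1 : SL3))) hU.isClosed_compl
    (by rw [Set.disjoint_singleton_left]; simpa using h1)
  have hfi : Integrable f μ := f.continuous.integrable_of_hasCompactSupport hfs
  have hpos : 0 < ∫ g, f g ∂μ :=
    f.continuous.integral_pos_of_hasCompactSupport_nonneg_nonzero hfs (fun g => (hf g).1)
      (x := 1) (by rw [hf1 rfl]; simp)
  set I := ∫ g, f g ∂μ with hI
  have hφ : Continuous fun g => f g / I := f.continuous.div_const _
  have hφs : HasCompactSupport fun g => f g / I :=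
    hfs.comp_left (g := fun x => x / I) (by simp)
  refine ⟨fun g => f g / I, hφ, hφs, ?_⟩
  have hint1 : ∫ g, f g / I ∂μ = 1 := by rw [integral_div, div_self hpos.ne']
  have hφi : Integrable (fun g => f g / I) μ := hfi.div_const _
  have hc : ∫ g, ((f g / I : ℝ) : ℂ) • v ∂μ = v := by
    rw [integral_smul_const, integral_complex_ofReal, hint1]; simp
  have he : smoothVec π μ (fun g => f g / I) v - v =
      ∫ g, ((f g / I : ℝ) : ℂ) • (π g v - v) ∂μ := by
    have hi : Integrable (fun g => ((f g / I : ℝ) : ℂ) • v) μ :=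
      (hφi.ofReal (𝕜 := ℂ)).smul_const v
    nth_rw 2 [← hc]
    rw [smoothVec, ← integral_sub (integrable_smooth hπ hφ hφs v) hi]
    simp_rw [smul_sub]
  rw [he]
  refine (norm_integral_le_of_norm_le (hφi.const_mul ε) (ae_of_all _ fun g => ?_)).trans
    (le_of_eq ?_)
  · rw [norm_smul, Complex.norm_real, Real.norm_of_nonneg (div_nonneg (hf g).1 hpos.le), mul_comm]
    by_cases hg : ‖π g v - v‖ < ε
    · exact mul_le_mul_of_nonneg_right hg.le (div_nonneg (hf g).1 hpos.le)
    · have : f g = 0 := hf0 hg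
      simp [this]
  · rw [integral_const_mul, hint1, mul_one]

/-- The spectral bound for spherical averages on vectors without invariant component. -/
theorem norm_avg_theta_le (hπ : ∀ v, Continuous fun g => π g v) {σ : ℝ} (h0 : 0 < σ)
    (h1 : σ < 1 / 2) (s : ℝ) {v : V} (hperp : v ∈ (invVec π)ᗮ) :
    ‖∫ p, π (theta s p) v ∂(circ.prod circ)‖ ≤ lam σ s * ‖v‖ := by
  have hunit : ∀ v : V, ‖v‖ = 1 → v ∈ (invVec π)ᗮ →
      ‖avgOp hπ (circ.prod circ) (continuous_theta s) v‖ ≤ lam σ s := by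
    intro v hv hperp
    refine le_of_forall_pos_le_add fun ε hε => ?_
    have hl := lam_pos σ s
    set δ := ε / (lam σ s + 1) with hδ
    have hδ0 : 0 < δ := by positivity
    let K₀ : TopologicalSpace.PositiveCompacts SL3 := Classical.arbitrary _
    obtain ⟨φ, hφ, hs, hn⟩ := exists_smooth_near hπ (Measure.haarMeasure K₀) v hδ0
    obtain ⟨C, hC⟩ := exists_coeff_bound (μ := Measure.haarMeasure K₀) hπ hφ hs hv hperp h0 h1
    set w := smoothVec π (Measure.haarMeasure K₀) φ v
    have hw := norm_avgOp_le (ρ := circ.prod circ) hπ (continuous_theta s) (theta_mem s) hl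
      (fun h hh => integrable_psi_theta σ s hh) (fun h hh => integral_psi_theta σ s hh)
      (fun h hh => integrable_psi_theta_inv σ s hh) (fun h hh => integral_psi_theta_inv σ s hh) hC
    have hop : ∀ u, ‖avgOp hπ (circ.prod circ) (continuous_theta s) u‖ ≤ ‖u‖ := fun u => by
      rw [avgOp_apply]
      refine (norm_integral_le_of_norm_le_const (C := ‖u‖) (ae_of_all _ fun ω => ?_)).trans ?_
      · rw [LinearIsometryEquiv.norm_map]
      · simp
    have hwn : ‖w‖ ≤ 1 + δ := by
      calc ‖w‖ = ‖v + (w - v)‖ := by congr 1; abel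
        _ ≤ ‖v‖ + ‖w - v‖ := norm_add_le _ _
        _ ≤ 1 + δ := by rw [hv]; gcongr
    calc ‖avgOp hπ (circ.prod circ) (continuous_theta s) v‖
        = ‖avgOp hπ (circ.prod circ) (continuous_theta s) w -
            avgOp hπ (circ.prod circ) (continuous_theta s) (w - v)‖ := by
          rw [← map_sub]; congr 2; abel
      _ ≤ ‖avgOp hπ (circ.prod circ) (continuous_theta s) w‖ +
            ‖avgOp hπ (circ.prod circ) (continuous_theta s) (w - v)‖ := norm_sub_le _ _
      _ ≤ lam σ s * (1 + δ) + δ :=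
          add_le_add (hw.trans (by gcongr)) ((hop _).trans hn)
      _ = lam σ s + ε := by rw [hδ]; field_simp; ring
  by_cases hv : v = 0
  · simp [hv]
  have hv0 : 0 < ‖v‖ := norm_pos_iff.2 hv
  have h := hunit ((‖v‖ : ℂ)⁻¹ • v) (by simp [norm_smul, hv]) (Submodule.smul_mem _ _ hperp)
  rw [map_smul, norm_smul, norm_inv, Complex.norm_real, norm_norm, avgOp_apply,
    inv_mul_le_iff₀ hv0, mul_comm] at h
  exact h

end SpectralGap

section Koopman

open scoped ENNReal InnerProductSpace

variable {X : Type*} [TopologicalSpace X] [R1Space X] [MeasurableSpace X] [BorelSpace X]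
  [MulAction SL3 X] [ContinuousSMul SL3 X] {m : Measure X} [IsProbabilityMeasure m]
  [m.InnerRegularCompactLTTop] [ErgodicSMul SL3 X m]

variable (m) in
/-- The Koopman representation of `SL(3, ℝ)` on `L²(X, m)`. -/
noncomputable def koopman : SL3 →* (Lp ℂ 2 m ≃ₗᵢ[ℂ] Lp ℂ 2 m) where
  toFun g :=
    { toFun f := DomMulAct.mk g⁻¹ • f
      invFun f := DomMulAct.mk g • f
      map_add' f f' := smul_add _ _ _
      map_smul' c f := smul_comm _ _ _
      left_inv f := by simp [smul_smul]
      right_inv f := by simp [smul_smul]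
      norm_map' f := DomMulAct.norm_smul_Lp _ _ }
  map_one' := by
    ext1 f
    change DomMulAct.mk (1 : SL3)⁻¹ • f = f
    simp
  map_mul' g h := by
    ext1 f
    change DomMulAct.mk (g * h)⁻¹ • f = DomMulAct.mk g⁻¹ • DomMulAct.mk h⁻¹ • f
    rw [_root_.mul_inv_rev, smul_smul, DomMulAct.mk_mul]

lemma koopman_apply (g : SL3) (f : Lp ℂ 2 m) : koopman m g f = DomMulAct.mk g⁻¹ • f := rfl

lemma continuous_koopman (f : Lp ℂ 2 m) : Continuous fun g : SL3 => koopman m g f := by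
  have : Fact ((2 : ℝ≥0∞) ≠ ∞) := ⟨by simp⟩
  simp only [koopman_apply]
  have : Continuous fun g : SL3 => DomMulAct.mk g⁻¹ :=
    DomMulAct.continuous_mk.comp continuous_inv
  exact this.smul continuous_const

lemma exists_ae_eq_const_of_mem_invVec {v : Lp ℂ 2 m} (hv : v ∈ invVec (koopman m)) :
    ∃ c : ℂ, v =ᵐ[m] fun _ => c := by
  refine Filter.exists_eventuallyEq_const_of_forall_separating
    (l := ae m) (f := v) (p := MeasurableSet) (fun U hU => ?_)
  · have hm : MeasurableSet (v ⁻¹' U) := (Lp.stronglyMeasurable v).measurable hU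
    have := ErgodicSMul.aeconst_of_forall_preimage_smul_ae_eq (G := SL3) (μ := m) hm fun g => by
      have h1 : DomMulAct.mk g • v = v := by
        have := hv g⁻¹
        rwa [koopman_apply, inv_inv] at this
      have h2 := DomMulAct.smul_Lp_ae_eq (DomMulAct.mk g) v
      rw [h1] at h2
      filter_upwards [h2] with x hx
      apply propext
      change v (g • x) ∈ U ↔ v x ∈ U
      rw [hx]; rfl
    rcases eventuallyConst_set.1 this with h | h
    · exact Or.inl h
    · exact Or.inr h

/-- The spherical averages equidistribute: a set missed by all translates of `B` by
`theta s p` is small. -/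
theorem measure_mul_measure_le {σ : ℝ} (h0 : 0 < σ) (h1 : σ < 1 / 2) (s : ℝ) {B E : Set X}
    (hB : MeasurableSet B) (hE : MeasurableSet E)
    (hdisj : ∀ p, ∀ x ∈ B, theta s p • x ∉ E) :
    m.real B * m.real E ≤ lam σ s ^ 2 := by
  set b : ℂ := (m.real B : ℂ) with hb
  set oB : Lp ℂ 2 m := indicatorConstLp 2 hB (measure_ne_top _ _) 1
  set oE : Lp ℂ 2 m := indicatorConstLp 2 hE (measure_ne_top _ _) 1
  set c1 : Lp ℂ 2 m := indicatorConstLp 2 MeasurableSet.univ (measure_ne_top _ _) 1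
  set v : Lp ℂ 2 m := oB - b • c1 with hv
  have hc1 (u : Lp ℂ 2 m) : ⟪c1, u⟫_ℂ = ∫ x, u x ∂m := by
    rw [L2.inner_indicatorConstLp_one]; simp
  have hcB : ⟪c1, oB⟫_ℂ = b := by
    rw [hc1, integral_indicatorConstLp]; simp [hb]
  have hcE : ⟪c1, oE⟫_ℂ = (m.real E : ℂ) := by
    rw [hc1, integral_indicatorConstLp]; simp
  have hcc : ⟪c1, c1⟫_ℂ = 1 := by
    rw [hc1, integral_indicatorConstLp]; simp
  have hperp : v ∈ (invVec (koopman m))ᗮ := by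
    intro u hu
    obtain ⟨c, hc⟩ := exists_ae_eq_const_of_mem_invVec hu
    have : u = c • c1 := by
      apply Lp.ext
      filter_upwards [hc, Lp.coeFn_smul c c1, indicatorConstLp_coeFn (p := 2) (μ := m)
        (hs := MeasurableSet.univ) (hμs := measure_ne_top m _) (c := (1 : ℂ))] with x h1 h2 h3
      rw [h1, h2, Pi.smul_apply, h3]; simp
    rw [this, inner_smul_left, hv, inner_sub_right, inner_smul_right, hcB, hcc]; simp
  have hc1inv (g : SL3) : koopman m g c1 = c1 := by
    rw [koopman_apply, DomMulAct.mk_smul_indicatorConstLp]; simp [c1]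
  have key := norm_avg_theta_le (π := koopman m) continuous_koopman h0 h1 s hperp
  have hin (p : ℝ × ℝ) : ⟪oE, koopman m (theta s p) v⟫_ℂ = -(m.real B * m.real E : ℝ) := by
    rw [hv, map_sub, map_smul, hc1inv, inner_sub_right, inner_smul_right,
      ← inner_conj_symm oE c1, hcE]
    have : ⟪oE, koopman m (theta s p) oB⟫_ℂ = 0 := by
      rw [koopman_apply, DomMulAct.mk_smul_indicatorConstLp, L2.inner_indicatorConstLp_one,
        setIntegral_indicatorConstLp hE]
      have : (fun x : X => (theta s p)⁻¹ • x) ⁻¹' B ∩ E = ∅ := by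
        ext x
        simp only [Set.mem_inter_iff, Set.mem_preimage, Set.mem_empty_iff_false, iff_false, not_and]
        intro hx
        simpa using hdisj p _ hx
      rw [this]; simp
    rw [this]; simp [hb]
  have h_int : Integrable (fun p => koopman m (theta s p) v) (circ.prod circ) := by
    refine Integrable.of_bound (C := ‖v‖)
      ((continuous_koopman v).comp (continuous_theta s)).aestronglyMeasurable ?_
    exact .of_forall fun p => by simp
  have hS : ⟪oE, ∫ p, koopman m (theta s p) v ∂(circ.prod circ)⟫_ℂ
      = -(m.real B * m.real E : ℝ) := by
    rw [← integral_inner h_int]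
    simp only [hin]
    simp
  have hle : m.real B * m.real E ≤ ‖oE‖ * (lam σ s * ‖v‖) := by
    calc m.real B * m.real E = ‖⟪oE, ∫ p, koopman m (theta s p) v ∂(circ.prod circ)⟫_ℂ‖ := by
          rw [hS, norm_neg, Complex.norm_real, Real.norm_of_nonneg (by positivity)]
      _ ≤ ‖oE‖ * ‖∫ p, koopman m (theta s p) v ∂(circ.prod circ)‖ := norm_inner_le_norm _ _
      _ ≤ _ := mul_le_mul_of_nonneg_left key (norm_nonneg _)
  have hnE : ‖oE‖ ^ 2 = m.real E := by
    have : (((‖oE‖ ^ 2 : ℝ)) : ℂ) = m.real E := by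
      have h := inner_self_eq_norm_sq_to_K (𝕜 := ℂ) oE
      rw [Complex.ofReal_pow]
      refine h.symm.trans ?_
      rw [L2.inner_indicatorConstLp_one,
        setIntegral_indicatorConstLp hE]
      simp
    exact_mod_cast this
  have hBB : ⟪oB, oB⟫_ℂ = b := by
    rw [L2.inner_indicatorConstLp_one, setIntegral_indicatorConstLp hB]
    simp [hb]
  have hnv : ‖v‖ ^ 2 ≤ m.real B := by
    have : (((‖v‖ ^ 2 : ℝ)) : ℂ) = (m.real B - m.real B ^ 2 : ℝ) := by
      have h := inner_self_eq_norm_sq_to_K (𝕜 := ℂ) v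
      rw [Complex.ofReal_pow]
      refine h.symm.trans ?_
      rw [hv, inner_sub_left, inner_sub_right,
        inner_sub_right, inner_smul_left, inner_smul_left, inner_smul_right, inner_smul_right,
        hcc, hcB, ← inner_conj_symm oB c1, hcB, hBB]
      simp [hb]; ring
    have h' : ‖v‖ ^ 2 = m.real B - m.real B ^ 2 := by exact_mod_cast this
    rw [h']; nlinarith [sq_nonneg (m.real B)]
  have hB0 : 0 ≤ m.real B := measureReal_nonneg
  have hE0 : 0 ≤ m.real E := measureReal_nonneg
  rcases eq_or_lt_of_le (mul_nonneg hB0 hE0) with h | h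
  · rw [← h]; positivity
  · have h2 : (m.real B * m.real E) ^ 2 ≤ m.real E * (lam σ s ^ 2 * m.real B) := by
      calc (m.real B * m.real E) ^ 2 ≤ (‖oE‖ * (lam σ s * ‖v‖)) ^ 2 := by gcongr
        _ = ‖oE‖ ^ 2 * (lam σ s ^ 2 * ‖v‖ ^ 2) := by ring
        _ ≤ _ := by rw [hnE]; gcongr
    nlinarith

end Koopman

section HaarModel

open scoped ENNReal

/-- Triples of vectors of `ℝ³`, regarded as the columns of a matrix. -/
abbrev Cols := Fin 3 → Fin 3 → ℝ

/-- The matrix with given columns. -/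
def colMat (c : Cols) : Matrix (Fin 3) (Fin 3) ℝ := (Matrix.of c)ᵀ

lemma colMat_apply (c : Cols) (i j : Fin 3) : colMat c i j = c j i := rfl

lemma continuous_colMat : Continuous colMat :=
  continuous_matrix fun i j => (continuous_apply i).comp (continuous_apply j)

/-- Left multiplication on columns. -/
noncomputable def lmul (g : Matrix (Fin 3) (Fin 3) ℝ) : Cols →ₗ[ℝ] Cols :=
  LinearMap.pi fun i => (Matrix.toLin' g) ∘ₗ LinearMap.proj i

lemma colMat_lmul (g : Matrix (Fin 3) (Fin 3) ℝ) (c : Cols) :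
    colMat (lmul g c) = g * colMat c := by
  ext i j
  simp [colMat_apply, lmul, Matrix.mul_apply, Matrix.mulVec, dotProduct]

lemma det_lmul (g : Matrix (Fin 3) (Fin 3) ℝ) : LinearMap.det (lmul g) = g.det ^ 3 := by
  rw [lmul, LinearMap.det_pi]; simp

/-- Exchange of rows and columns. -/
def colSwap : Cols ≃ₗ[ℝ] Cols where
  toFun c i j := c j i
  invFun c i j := c j i
  map_add' _ _ := rfl
  map_smul' _ _ := rfl
  left_inv _ := rfl
  right_inv _ := rfl

/-- Right multiplication on columns. -/
noncomputable def rmul (g : Matrix (Fin 3) (Fin 3) ℝ) : Cols →ₗ[ℝ] Cols :=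
  (colSwap : Cols →ₗ[ℝ] Cols) ∘ₗ lmul gᵀ ∘ₗ (colSwap.symm : Cols →ₗ[ℝ] Cols)

lemma colMat_rmul (g : Matrix (Fin 3) (Fin 3) ℝ) (c : Cols) :
    colMat (rmul g c) = colMat c * g := by
  ext i j
  simp [colMat_apply, rmul, lmul, Matrix.mul_apply, Matrix.mulVec, dotProduct, colSwap, mul_comm]

lemma det_rmul (g : Matrix (Fin 3) (Fin 3) ℝ) : LinearMap.det (rmul g) = g.det ^ 3 := by
  rw [rmul, LinearMap.det_conj, det_lmul, Matrix.det_transpose]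

lemma measurePreserving_linear {f : Cols →ₗ[ℝ] Cols} (hf : LinearMap.det f = 1) :
    MeasurePreserving f (volume : Measure Cols) volume := by
  refine ⟨(LinearMap.continuous_of_finiteDimensional f).measurable, ?_⟩
  rw [Measure.map_linearMap_addHaar_eq_smul_addHaar _ (by rw [hf]; simp), hf]
  simp

/-- Normalization of a matrix of positive determinant. -/
noncomputable def slNormalize (c : Cols) (h : 0 < (colMat c).det) : SL3 :=
  ⟨(colMat c).det ^ (-(1 / 3) : ℝ) • colMat c, by
    rw [Matrix.det_smul, Fintype.card_fin, ← Real.rpow_natCast, ← Real.rpow_mul h.le]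
    norm_num
    rw [Real.rpow_neg_one, inv_mul_cancel₀ h.ne']⟩

/-- The radial projection of matrices of positive determinant to `SL(3, ℝ)`. -/
noncomputable def slProj (c : Cols) : SL3 :=
  if h : 0 < (colMat c).det then slNormalize c h else 1

lemma slProj_coe {c : Cols} (h : 0 < (colMat c).det) :
    (slProj c : Matrix (Fin 3) (Fin 3) ℝ) = (colMat c).det ^ (-(1 / 3) : ℝ) • colMat c := by
  rw [slProj, dif_pos h]; rfl

lemma isOpen_det_pos : IsOpen {c : Cols | 0 < (colMat c).det} :=
  isOpen_lt continuous_const continuous_colMat.matrix_det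

lemma continuousOn_slProj : ContinuousOn slProj {c : Cols | 0 < (colMat c).det} := by
  refine (Topology.IsInducing.continuousOn_iff
    (g := fun g : SL3 => (g : Matrix (Fin 3) (Fin 3) ℝ)) ⟨rfl⟩).2 ?_
  have : ContinuousOn (fun c : Cols => (colMat c).det ^ (-(1 / 3) : ℝ) • colMat c)
      {c : Cols | 0 < (colMat c).det} := by
    refine ContinuousOn.smul (f := fun c => (colMat c).det ^ (-(1 / 3) : ℝ)) ?_
      continuous_colMat.continuousOn
    refine ContinuousOn.rpow_const continuous_colMat.matrix_det.continuousOn ?_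
    intro c hc
    exact Or.inl (ne_of_gt hc)
  exact this.congr fun c hc => slProj_coe hc

lemma measurable_slProj : Measurable slProj := by
  classical
  have : slProj = Set.piecewise {c : Cols | 0 < (colMat c).det} slProj fun _ => 1 := by
    ext1 c
    by_cases h : 0 < (colMat c).det
    · simp [Set.piecewise, h]
    · simp only [Set.piecewise, Set.mem_ofPred_eq, h, if_false]
      rw [slProj, dif_neg h]
  rw [this]
  exact continuousOn_slProj.measurable_piecewise continuousOn_const isOpen_det_pos.measurableSet

lemma slProj_lmul (g : SL3) {c : Cols} (h : 0 < (colMat c).det) :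
    slProj (lmul g.1 c) = g * slProj c := by
  have hd : (colMat (lmul g.1 c)).det = (colMat c).det := by rw [colMat_lmul]; simp
  apply Subtype.ext
  rw [slProj_coe (by rwa [hd]), hd, Matrix.SpecialLinearGroup.coe_mul, slProj_coe h, colMat_lmul,
    Matrix.mul_smul]

lemma slProj_rmul (g : SL3) {c : Cols} (h : 0 < (colMat c).det) :
    slProj (rmul g.1 c) = slProj c * g := by
  have hd : (colMat (rmul g.1 c)).det = (colMat c).det := by rw [colMat_rmul]; simp
  apply Subtype.ext
  rw [slProj_coe (by rwa [hd]), hd, Matrix.SpecialLinearGroup.coe_mul, slProj_coe h, colMat_rmul,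
    Matrix.smul_mul]

lemma det_colMat_smul (t : ℝ) (c : Cols) : (colMat (t • c)).det = t ^ 3 * (colMat c).det := by
  have : colMat (t • c) = t • colMat c := rfl
  rw [this, Matrix.det_smul]; simp

lemma slProj_smul {t : ℝ} (ht : 0 < t) {c : Cols} (h : 0 < (colMat c).det) :
    slProj (t • c) = slProj c := by
  have hd := det_colMat_smul t c
  have h3 : (t ^ 3) ^ (-(1 / 3) : ℝ) = t⁻¹ := by
    rw [← Real.rpow_natCast, ← Real.rpow_mul ht.le]
    norm_num
    exact Real.rpow_neg_one t
  apply Subtype.ext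
  rw [slProj_coe (by rw [hd]; positivity), hd, slProj_coe h,
    Real.mul_rpow (by positivity) h.le, h3]
  have : colMat (t • c) = t • colMat c := rfl
  rw [this, smul_smul]
  congr 1
  field_simp

/-- The cone `{0 < det ≤ T}`. -/
def cone (T : ℝ) : Set Cols := {c | 0 < (colMat c).det ∧ (colMat c).det ≤ T}

lemma measurableSet_cone (T : ℝ) : MeasurableSet (cone T) :=
  (isOpen_det_pos.measurableSet).inter
    (isClosed_le continuous_colMat.matrix_det continuous_const).measurableSet

/-- A concrete model of Haar measure on `SL(3, ℝ)`: the cone measure. -/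
noncomputable def haarSL : Measure SL3 := ((volume : Measure Cols).restrict (cone 1)).map slProj

lemma haarSL_apply {A : Set SL3} (hA : MeasurableSet A) :
    haarSL A = volume (slProj ⁻¹' A ∩ cone 1) := by
  rw [haarSL, Measure.map_apply measurable_slProj hA,
    Measure.restrict_apply (measurable_slProj hA)]

instance : haarSL.IsMulLeftInvariant := by
  refine ⟨fun g => ?_⟩
  refine Measure.ext fun A hA => ?_
  have hm : Measurable fun x : SL3 => g * x := (continuous_const_mul g).measurable
  rw [Measure.map_apply hm hA, haarSL_apply (hm hA), haarSL_apply hA,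
    ← (measurePreserving_linear (f := lmul g.1) (by rw [det_lmul]; simp)).measure_preimage
      ((measurable_slProj hA).inter (measurableSet_cone 1)).nullMeasurableSet]
  congr 1
  ext c
  have hd : (colMat (lmul g.1 c)).det = (colMat c).det := by rw [colMat_lmul]; simp
  simp only [Set.mem_inter_iff, Set.mem_preimage, cone, Set.mem_ofPred_eq, hd]
  refine and_congr_left fun h => ?_
  rw [slProj_lmul g h.1]

instance : haarSL.IsMulRightInvariant := by
  refine ⟨fun g => ?_⟩
  refine Measure.ext fun A hA => ?_
  have hm : Measurable fun x : SL3 => x * g := (continuous_mul_const g).measurable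
  rw [Measure.map_apply hm hA, haarSL_apply (hm hA), haarSL_apply hA,
    ← (measurePreserving_linear (f := rmul g.1) (by rw [det_rmul]; simp)).measure_preimage
      ((measurable_slProj hA).inter (measurableSet_cone 1)).nullMeasurableSet]
  congr 1
  ext c
  have hd : (colMat (rmul g.1 c)).det = (colMat c).det := by rw [colMat_rmul]; simp
  simp only [Set.mem_inter_iff, Set.mem_preimage, cone, Set.mem_ofPred_eq, hd]
  refine and_congr_left fun h => ?_
  rw [slProj_rmul g h.1]

/-- The columns of an element of `SL(3, ℝ)`. -/
def colsOf (g : SL3) : Cols := fun j i => g.1 i j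

lemma colMat_colsOf (g : SL3) : colMat (colsOf g) = g.1 := rfl

lemma slProj_colsOf (g : SL3) : slProj (colsOf g) = g := by
  apply Subtype.ext
  rw [slProj_coe (by rw [colMat_colsOf]; simp), colMat_colsOf]; simp

instance : haarSL.IsOpenPosMeasure := by
  refine ⟨fun U hU ⟨u, hu⟩ => ?_⟩
  rw [haarSL_apply hU.measurableSet]
  have ho : IsOpen ({c : Cols | 0 < (colMat c).det} ∩ slProj ⁻¹' U ∩
      {c : Cols | (colMat c).det < 1}) :=
    (continuousOn_slProj.isOpen_inter_preimage isOpen_det_pos hU).inter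
      (isOpen_lt continuous_colMat.matrix_det continuous_const)
  refine ne_of_gt (lt_of_lt_of_le (ho.measure_pos volume ⟨(1 / 2 : ℝ) • colsOf u, ?_⟩)
    (measure_mono ?_))
  · have h1 : 0 < (colMat (colsOf u)).det := by rw [colMat_colsOf]; simp
    refine ⟨⟨?_, ?_⟩, ?_⟩
    · simp only [Set.mem_ofPred_eq]; rw [det_colMat_smul]; positivity
    · simp only [Set.mem_preimage]
      rwa [slProj_smul (by norm_num) h1, slProj_colsOf]
    · simp only [Set.mem_ofPred_eq]; rw [det_colMat_smul, colMat_colsOf]; simp; norm_num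
  · rintro c ⟨⟨h1, h2⟩, h3⟩
    exact ⟨h2, h1, le_of_lt h3⟩

lemma colMat_eq_smul_slProj {c : Cols} (h : 0 < (colMat c).det) :
    colMat c = (colMat c).det ^ (1 / 3 : ℝ) • (slProj c).1 := by
  rw [slProj_coe h, smul_smul, ← Real.rpow_add h]; simp

instance : IsFiniteMeasureOnCompacts haarSL := by
  refine ⟨fun K hK => ?_⟩
  rw [haarSL_apply hK.measurableSet]
  have hc : Continuous colsOf :=
    continuous_pi fun j => continuous_pi fun i => SL3.continuous_val.matrix_elem i j
  obtain ⟨R, hR⟩ := (hK.image hc).isBounded.exists_norm_le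
  refine lt_of_le_of_lt (measure_mono (t := Metric.closedBall 0 R) ?_)
    (isCompact_closedBall _ _).measure_lt_top
  rintro c ⟨h1, h2, h3⟩
  have h4 : c = (colMat c).det ^ (1 / 3 : ℝ) • colsOf (slProj c) := by
    ext j i
    exact congrFun (congrFun (colMat_eq_smul_slProj h2) i) j
  rw [mem_closedBall_zero_iff, h4, norm_smul]
  have h5 := hR _ ⟨_, h1, rfl⟩
  have h6 : ‖(colMat c).det ^ (1 / 3 : ℝ)‖ ≤ 1 := by
    rw [Real.norm_of_nonneg (by positivity)]
    exact Real.rpow_le_one h2.le h3 (by norm_num)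
  nlinarith [norm_nonneg (colsOf (slProj c))]

instance : haarSL.IsHaarMeasure where

lemma volume_preimage_inter_cone {A : Set SL3} (hA : MeasurableSet A) {t : ℝ} (ht : 0 < t) :
    volume (slProj ⁻¹' A ∩ cone (t ^ 3)) = ENNReal.ofReal (t ^ 9) * haarSL A := by
  have h := Measure.addHaar_smul (volume : Measure Cols) t (slProj ⁻¹' A ∩ cone 1)
  rw [haarSL_apply hA]
  have h9 : Module.finrank ℝ Cols = 9 := by
    rw [Module.finrank_pi_fintype]; simp
  rw [h9, abs_of_pos (by positivity)] at h
  rw [← h]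
  congr 1
  ext c
  rw [Set.mem_smul_set_iff_inv_smul_mem₀ ht.ne']
  have hd := det_colMat_smul t⁻¹ c
  simp only [Set.mem_inter_iff, Set.mem_preimage, cone, Set.mem_ofPred_eq, hd]
  have e1 : 0 < t⁻¹ ^ 3 * (colMat c).det ↔ 0 < (colMat c).det := by
    rw [mul_pos_iff_of_pos_left (by positivity)]
  have e2 : t⁻¹ ^ 3 * (colMat c).det ≤ 1 ↔ (colMat c).det ≤ t ^ 3 := by
    rw [inv_pow, inv_mul_le_iff₀ (by positivity), mul_one]
  rw [e1, e2]
  refine and_congr_left fun h => ?_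
  rw [slProj_smul (by positivity) h.1]

end HaarModel

section Lattice

open scoped ENNReal Pointwise

/-- The subgroup `SL(3, ℤ)` of `SL(3, ℝ)`. -/
def Gam : Subgroup SL3 := (Matrix.SpecialLinearGroup.map (n := Fin 3) (Int.castRingHom ℝ)).range

instance : Countable Gam := by
  have : Countable (Matrix.SpecialLinearGroup (Fin 3) ℤ) :=
    inferInstanceAs (Countable {A : Fin 3 → Fin 3 → ℤ // Matrix.det (Matrix.of A) = 1})
  exact (Matrix.SpecialLinearGroup.map (n := Fin 3)
    (Int.castRingHom ℝ)).rangeRestrict_surjective.countable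

instance : Countable Gam.op := Gam.equivOp.symm.injective.countable

lemma exists_int_of_mem_Gam {g : SL3} (hg : g ∈ Gam) (i j : Fin 3) : ∃ n : ℤ, g.1 i j = n := by
  obtain ⟨γ, rfl⟩ := hg
  exact ⟨γ.1 i j, rfl⟩

/-- A neighbourhood of the identity meeting `SL(3, ℤ)` only in the identity. -/
def smallNhd : Set SL3 := {g | ∀ i j, |g.1 i j - (1 : Matrix (Fin 3) (Fin 3) ℝ) i j| < 1}

lemma isOpen_smallNhd : IsOpen smallNhd := by
  have : smallNhd = ⋂ i, ⋂ j, {g : SL3 | |g.1 i j - (1 : Matrix (Fin 3) (Fin 3) ℝ) i j| < 1} := by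
    ext g; simp [smallNhd]
  rw [this]
  refine isOpen_iInter_of_finite fun i => isOpen_iInter_of_finite fun j => ?_
  exact isOpen_lt ((SL3.continuous_val.matrix_elem i j).sub continuous_const).abs continuous_const

lemma one_mem_smallNhd : (1 : SL3) ∈ smallNhd := fun i j => by simp

lemma eq_one_of_mem_Gam_of_mem_smallNhd {g : SL3} (hg : g ∈ Gam) (h : g ∈ smallNhd) : g = 1 := by
  apply Subtype.ext
  ext i j
  obtain ⟨n, hn⟩ := exists_int_of_mem_Gam hg i j
  have h1 := h i j
  obtain ⟨k, hk⟩ := exists_int_of_mem_Gam (one_mem Gam) i j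
  have hk' : (1 : Matrix (Fin 3) (Fin 3) ℝ) i j = k := hk
  change g.1 i j = (1 : Matrix (Fin 3) (Fin 3) ℝ) i j
  rw [hn, hk'] at h1 ⊢
  have : |n - k| < 1 := by exact_mod_cast h1
  rw [Int.abs_lt_one_iff] at this
  have : n = k := by omega
  rw [this]

instance : DiscreteTopology Gam := by
  refine discreteTopology_of_isOpen_singleton_one ?_
  have : ({1} : Set Gam) = Subtype.val ⁻¹' smallNhd := by
    ext g
    simp only [Set.mem_singleton_iff, Set.mem_preimage]
    constructor
    · rintro rfl; exact one_mem_smallNhd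
    · intro h; exact Subtype.ext (eq_one_of_mem_Gam_of_mem_smallNhd g.2 h)
  rw [this]
  exact isOpen_smallNhd.preimage continuous_subtype_val

lemma isClosed_Gam : IsClosed (Gam : Set SL3) := Subgroup.isClosed_of_discrete

instance : T2Space (SL3 ⧸ Gam) :=
  (t2Space_iff_of_isOpenQuotientMap (QuotientGroup.isOpenQuotientMap_mk (N := Gam))).2 <| by
    have hc : Continuous fun p : SL3 × SL3 => p.1⁻¹ * p.2 :=
      continuous_fst.inv.mul continuous_snd
    convert! isClosed_Gam.preimage hc using 1
    ext p
    exact QuotientGroup.eq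

/-- A neighbourhood injecting into the quotient by `SL(3, ℤ)`. -/
lemma exists_injective_nhd (g : SL3) :
    ∃ U : Set SL3, IsOpen U ∧ g ∈ U ∧ ∀ x ∈ U, ∀ y ∈ U, x⁻¹ * y ∈ smallNhd := by
  have hc : Continuous fun p : SL3 × SL3 => p.1⁻¹ * p.2 :=
    continuous_fst.inv.mul continuous_snd
  have : (fun p : SL3 × SL3 => p.1⁻¹ * p.2) ⁻¹' smallNhd ∈ 𝓝 (g, g) := by
    refine (isOpen_smallNhd.preimage hc).mem_nhds ?_
    rw [Set.mem_preimage, inv_mul_cancel]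
    exact one_mem_smallNhd
  rw [nhds_prod_eq, mem_prod_same_iff] at this
  obtain ⟨W, hW, hWs⟩ := this
  obtain ⟨U, hUW, hU, hgU⟩ := mem_nhds_iff.1 hW
  refine ⟨U, hU, hgU, fun x hx y hy => ?_⟩
  have := hWs (Set.mk_mem_prod (hUW hx) (hUW hy))
  rwa [Set.mem_preimage] at this

lemma exists_fundamentalDomain :
    ∃ F : Set SL3, MeasurableSet F ∧ ∀ x : SL3, ∃! γ : Gam.op, γ • x ∈ F := by
  choose W hWo hWm hWs using exists_injective_nhd
  obtain ⟨T, hTc, hT⟩ := TopologicalSpace.countable_cover_nhds fun g => (hWo g).mem_nhds (hWm g)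
  have hne : T.Nonempty := by
    by_contra h
    rw [Set.not_nonempty_iff_eq_empty] at h
    subst h
    simp at hT
    exact (Set.empty_ne_univ hT).elim
  obtain ⟨f, rfl⟩ := hTc.exists_eq_range hne
  set U : ℕ → Set SL3 := fun n => W (f n) with hUdef
  have hU (n) : IsOpen (U n) := hWo _
  have hcov (x : SL3) : ∃ n, x ∈ U n := by
    have : x ∈ ⋃ g ∈ Set.range f, W g := by rw [hT]; trivial
    simpa [hUdef] using this
  refine ⟨⋃ n, U n \ ⋃ j, ⋃ (_ : j < n), ⋃ γ : Gam.op, (fun x : SL3 => γ • x) ⁻¹' U j, ?_, ?_⟩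
  · refine MeasurableSet.iUnion fun n => (hU n).measurableSet.diff ?_
    refine MeasurableSet.iUnion fun j => MeasurableSet.iUnion fun _ => MeasurableSet.iUnion
      fun γ => ((hU j).preimage (continuous_const_smul γ)).measurableSet
  · intro x
    classical
    have hex : ∃ n, ∃ γ : Gam.op, γ • x ∈ U n := by
      obtain ⟨n, hn⟩ := hcov x
      exact ⟨n, 1, by rwa [one_smul]⟩
    obtain ⟨γ, hγ⟩ := Nat.find_spec hex
    have key (δ : Gam.op) (n : ℕ) (h : ∀ j < n, ∀ η : Gam.op, η • δ • x ∉ U j)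
        (h' : δ • x ∈ U n) : n = Nat.find hex := by
      refine le_antisymm ?_ (Nat.find_min' hex ⟨δ, h'⟩)
      by_contra hlt
      push Not at hlt
      refine h _ hlt (γ * δ⁻¹) ?_
      rwa [smul_smul, inv_mul_cancel_right]
    refine ⟨γ, ?_, ?_⟩
    · simp only [Set.mem_iUnion, Set.mem_sdiff, Set.mem_preimage, not_exists]
      refine ⟨_, hγ, fun j hj η hη => ?_⟩
      exact Nat.find_min hex hj ⟨η * γ, by rwa [← smul_smul]⟩
    · intro δ hδ
      simp only [Set.mem_iUnion, Set.mem_sdiff, Set.mem_preimage, not_exists] at hδ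
      obtain ⟨n, h1, h2⟩ := hδ
      have hn := key δ n h2 h1
      rw [hn] at h1
      have h3 := hWs _ _ hγ _ h1
      have h4 : (γ • x)⁻¹ * (δ • x) = (γ.1.unop)⁻¹ * δ.1.unop := by
        change (x * γ.1.unop)⁻¹ * (x * δ.1.unop) = _
        group
      rw [h4] at h3
      have h5 := eq_one_of_mem_Gam_of_mem_smallNhd
        (mul_mem (inv_mem (Subgroup.mem_op.1 γ.2)) (Subgroup.mem_op.1 δ.2)) h3
      rw [inv_mul_eq_one] at h5
      exact Subtype.ext (MulOpposite.unop_injective h5.symm)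

/-- A measurable fundamental domain for `SL(3, ℤ)` acting on `SL(3, ℝ)` from the right. -/
noncomputable def fundDom : Set SL3 := exists_fundamentalDomain.choose

lemma isFundamentalDomain_fundDom : IsFundamentalDomain Gam.op fundDom haarSL :=
  .mk' exists_fundamentalDomain.choose_spec.1.nullMeasurableSet
    exists_fundamentalDomain.choose_spec.2

lemma measure_fundDom_le {S : Set SL3} (hS : ∀ x, ∃ γ ∈ Gam, x * γ ∈ S) :
    haarSL fundDom ≤ haarSL S := by
  rw [isFundamentalDomain_fundDom.measure_eq_tsum S]
  refine le_trans (measure_mono (t := ⋃ γ : Gam.op, γ • S ∩ fundDom) ?_) (measure_iUnion_le _)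
  intro x hx
  obtain ⟨γ, hγ, h⟩ := hS x
  rw [Set.mem_iUnion]
  refine ⟨⟨MulOpposite.op γ⁻¹, Subgroup.mem_op.2 (inv_mem hγ)⟩, ?_, hx⟩
  refine ⟨_, h, ?_⟩
  change x * γ * γ⁻¹ = x
  group

lemma haarSL_le_measure_inter {B : Set SL3} (hB : MeasurableSet B)
    (hinj : ∀ x ∈ B, ∀ y ∈ B, x⁻¹ * y ∈ smallNhd) :
    haarSL B ≤ haarSL ((QuotientGroup.mk : SL3 → SL3 ⧸ Gam) ⁻¹'
      ((QuotientGroup.mk : SL3 → SL3 ⧸ Gam) '' B) ∩ fundDom) := by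
  rw [isFundamentalDomain_fundDom.measure_eq_tsum B, ← measure_iUnion₀]
  · refine measure_mono (Set.iUnion_subset fun γ => ?_)
    rintro x ⟨⟨b, hb, rfl⟩, h2⟩
    refine ⟨⟨b, hb, ?_⟩, h2⟩
    refine QuotientGroup.eq.2 ?_
    change b⁻¹ * (b * γ.1.unop) ∈ Gam
    simpa using Subgroup.mem_op.1 γ.2
  · intro γ δ hne
    refine Disjoint.aedisjoint (Set.disjoint_left.2 ?_)
    rintro x ⟨⟨b, hb, rfl⟩, -⟩ ⟨⟨b', hb', h⟩, -⟩
    apply hne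
    change b' * δ.1.unop = b * γ.1.unop at h
    have h1 : b⁻¹ * b' = γ.1.unop * δ.1.unop⁻¹ := by
      rw [inv_mul_eq_iff_eq_mul, ← mul_assoc, ← h]; group
    have h2 := hinj _ hb _ hb'
    rw [h1] at h2
    have h5 := eq_one_of_mem_Gam_of_mem_smallNhd
        (mul_mem (Subgroup.mem_op.1 γ.2) (inv_mem (Subgroup.mem_op.1 δ.2))) h2
    rw [mul_inv_eq_one] at h5
    exact Subtype.ext (MulOpposite.unop_injective h5)
  · intro γ
    refine NullMeasurableSet.inter ?_ exists_fundamentalDomain.choose_spec.1.nullMeasurableSet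
    exact (hB.const_smul γ).nullMeasurableSet

end Lattice

section Reduction

/-- Reduced triples of columns. -/
def ReducedCols (c : Cols) : Prop :=
  2 * |c 0 ⬝ᵥ c 1| ≤ c 0 ⬝ᵥ c 0 ∧ c 0 ⬝ᵥ c 0 ≤ c 1 ⬝ᵥ c 1 ∧ 2 * |c 0 ⬝ᵥ c 2| ≤ c 0 ⬝ᵥ c 0 ∧
  2 * ((c 0 ⬝ᵥ c 0) * |((c 0 ⬝ᵥ c 0) • c 1 - (c 0 ⬝ᵥ c 1) • c 0) ⬝ᵥ c 2|) ≤
    ((c 0 ⬝ᵥ c 0) • c 1 - (c 0 ⬝ᵥ c 1) • c 0) ⬝ᵥ ((c 0 ⬝ᵥ c 0) • c 1 - (c 0 ⬝ᵥ c 1) • c 0) ∧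
  (c 0 ⬝ᵥ c 0) * (c 1 ⬝ᵥ c 1) ^ 2 ≤ 3

lemma dotProduct_self_nonneg' (x : Fin 3 → ℝ) : 0 ≤ x ⬝ᵥ x := by
  simp only [dotProduct, Fin.sum_univ_three]; nlinarith [mul_self_nonneg (x 0),
    mul_self_nonneg (x 1), mul_self_nonneg (x 2)]

lemma abs_le_of_dotProduct_self_le {x : Fin 3 → ℝ} {R : ℝ} (h : x ⬝ᵥ x ≤ R) (i : Fin 3) :
    |x i| ≤ √R := by
  refine Real.abs_le_sqrt ?_
  simp only [dotProduct, Fin.sum_univ_three] at h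
  fin_cases i <;> simp <;> nlinarith [mul_self_nonneg (x 0),
    mul_self_nonneg (x 1), mul_self_nonneg (x 2)]

/-- A lattice has finitely many vectors of bounded length. -/
lemma finite_setOf_short (g : SL3) (R : ℝ) :
    {v : Fin 3 → ℤ | (g.1 *ᵥ fun i => (v i : ℝ)) ⬝ᵥ (g.1 *ᵥ fun i => (v i : ℝ)) ≤ R}.Finite := by
  set C : ℝ := (∑ i, ∑ j, |(g⁻¹).1 i j|) * √R with hC
  refine (Set.finite_Icc (fun _ : Fin 3 => -⌈C⌉) (fun _ => ⌈C⌉)).subset ?_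
  intro v hv
  have hb (i : Fin 3) : |(v i : ℝ)| ≤ C := by
    have h1 : (fun i => (v i : ℝ)) = (g⁻¹).1 *ᵥ (g.1 *ᵥ fun i => (v i : ℝ)) := by
      rw [Matrix.mulVec_mulVec, ← Matrix.SpecialLinearGroup.coe_mul, inv_mul_cancel]
      simp
    have h2 := congrFun h1 i
    rw [h2, Matrix.mulVec, dotProduct]
    refine (Finset.abs_sum_le_sum_abs _ _).trans ?_
    calc ∑ j, |(g⁻¹).1 i j * (g.1 *ᵥ fun i => (v i : ℝ)) j|
        ≤ ∑ j, |(g⁻¹).1 i j| * √R := by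
          refine Finset.sum_le_sum fun j _ => ?_
          rw [abs_mul]
          gcongr
          exact abs_le_of_dotProduct_self_le hv j
      _ = (∑ j, |(g⁻¹).1 i j|) * √R := by rw [Finset.sum_mul]
      _ ≤ C := by
          rw [hC]
          refine mul_le_mul_of_nonneg_right ?_ (Real.sqrt_nonneg R)
          exact Finset.single_le_sum (f := fun i => ∑ j, |(g⁻¹).1 i j|)
            (fun i _ => Finset.sum_nonneg fun j _ => abs_nonneg _) (Finset.mem_univ i)
  rw [Set.mem_Icc]
  constructor <;> intro i
  · have := (abs_le.1 (hb i)).1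
    have h3 := Int.le_ceil C
    have : (-⌈C⌉ : ℝ) ≤ v i := by linarith
    exact_mod_cast this
  · have := (abs_le.1 (hb i)).2
    have h3 := Int.le_ceil C
    have : (v i : ℝ) ≤ ⌈C⌉ := by linarith
    exact_mod_cast this

lemma exists_min_col (g : SL3) (k : Fin 3) (P : SL3 → Prop) (hP : ∃ γ ∈ Gam, P γ) :
    ∃ γ ∈ Gam, P γ ∧ ∀ δ ∈ Gam, P δ →
      colsOf (g * γ) k ⬝ᵥ colsOf (g * γ) k ≤ colsOf (g * δ) k ⬝ᵥ colsOf (g * δ) k := by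
  obtain ⟨γ₀, hγ₀, hPγ₀⟩ := hP
  set φ : SL3 → ℝ := fun γ => colsOf (g * γ) k ⬝ᵥ colsOf (g * γ) k with hφ
  set A : Set ℝ := φ '' {γ | γ ∈ Gam ∧ P γ ∧ φ γ ≤ φ γ₀} with hA
  have hfin : A.Finite := by
    refine ((finite_setOf_short g (φ γ₀)).image fun v =>
      (g.1 *ᵥ fun i => (v i : ℝ)) ⬝ᵥ (g.1 *ᵥ fun i => (v i : ℝ))).subset ?_
    rintro _ ⟨γ, ⟨hγ, -, hle⟩, rfl⟩
    obtain ⟨η, rfl⟩ := hγ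
    have : colsOf (g * Matrix.SpecialLinearGroup.map (Int.castRingHom ℝ) η) k
        = g.1 *ᵥ fun i => ((η.1 i k : ℤ) : ℝ) := by
      ext i
      simp [colsOf, Matrix.mul_apply, Matrix.mulVec, dotProduct]
    refine ⟨fun i => η.1 i k, ?_, ?_⟩
    · simp only [hφ, this] at hle
      exact hle
    · simp only [hφ, this]
  obtain ⟨a, ⟨γ, ⟨hγ, hPγ, hle⟩, rfl⟩, hmin⟩ := Set.exists_min_image A id hfin
    ⟨_, γ₀, ⟨hγ₀, hPγ₀, le_rfl⟩, rfl⟩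
  refine ⟨γ, hγ, hPγ, fun δ hδ hPδ => ?_⟩
  rcases le_total (φ δ) (φ γ₀) with h | h
  · exact hmin _ ⟨δ, ⟨hδ, hPδ, h⟩, rfl⟩
  · exact hle.trans h

/-- An element of `SL(3, ℤ)` given by its entries. -/
lemma exists_mem_Gam (A : Matrix (Fin 3) (Fin 3) ℤ) (hA : A.det = 1) :
    ∃ γ ∈ Gam, γ.1 = A.map (fun n : ℤ => (n : ℝ)) :=
  ⟨_, ⟨⟨A, hA⟩, rfl⟩, rfl⟩

lemma colsOf_mul (g γ : SL3) (j : Fin 3) :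
    colsOf (g * γ) j = γ.1 0 j • colsOf g 0 + γ.1 1 j • colsOf g 1 + γ.1 2 j • colsOf g 2 := by
  ext i
  simp [colsOf, Matrix.mul_apply, Fin.sum_univ_three, mul_comm]

lemma two_mul_abs_dotProduct_le {x y : Fin 3 → ℝ} (h1 : y ⬝ᵥ y ≤ (y + x) ⬝ᵥ (y + x))
    (h2 : y ⬝ᵥ y ≤ (y - x) ⬝ᵥ (y - x)) : 2 * |x ⬝ᵥ y| ≤ x ⬝ᵥ x := by
  have : |x ⬝ᵥ y| ≤ (x ⬝ᵥ x) / 2 := by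
    rw [abs_le]
    simp only [dotProduct, Fin.sum_univ_three, Pi.add_apply, Pi.sub_apply] at *
    constructor <;> linarith
  linarith

lemma two_mul_abs_sub_round_le {a q : ℝ} (hq : 0 < q) :
    2 * |a + ((-round (a / q) : ℤ) : ℝ) * q| ≤ q := by
  have h := abs_sub_round (a / q)
  have : a + ((-round (a / q) : ℤ) : ℝ) * q = (a / q - round (a / q)) * q := by
    push_cast; field_simp; ring
  rw [this, abs_mul, abs_of_pos hq]
  nlinarith

lemma gram_le {q0 q1 q2 s t r : ℝ} (h0 : 0 < q0) (h1 : 2 * |s| ≤ q0) (h2 : q0 ≤ q1)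
    (h3 : 2 * |t| ≤ q0) (h4 : 2 * (q0 * |q0 * r - s * t|) ≤ q0 * (q0 * q1 - s ^ 2)) (h5 : q1 ≤ q2)
    (hdet : q0 * q1 * q2 + 2 * s * t * r - q0 * r ^ 2 - q1 * t ^ 2 - q2 * s ^ 2 = 1) :
    q0 * q1 ^ 2 ≤ 3 := by
  have hs2 : 4 * s ^ 2 ≤ q0 ^ 2 := by
    have := abs_nonneg s
    rw [← sq_abs s]; nlinarith
  have ht2 : 4 * t ^ 2 ≤ q0 ^ 2 := by
    have := abs_nonneg t
    rw [← sq_abs t]; nlinarith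
  have hqq : q0 ^ 2 ≤ q0 * q1 := by nlinarith
  have hq01 : 0 < q0 * q1 := mul_pos h0 (h0.trans_le h2)
  obtain ⟨Δ, hΔ⟩ : ∃ Δ, Δ = q0 * q1 - s ^ 2 := ⟨_, rfl⟩
  obtain ⟨u, hu⟩ : ∃ u, u = q0 * r - s * t := ⟨_, rfl⟩
  rw [← hΔ, ← hu] at h4
  have hΔ1 : 3 * (q0 * q1) ≤ 4 * Δ := by linarith
  have hΔ0 : 0 < Δ := by linarith
  have hu2 : 4 * u ^ 2 ≤ Δ ^ 2 := by
    have h4' : 2 * |u| ≤ Δ := by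
      have h4'' : q0 * (2 * |u|) ≤ q0 * Δ := by linarith
      exact le_of_mul_le_mul_left h4'' h0
    have := abs_nonneg u
    rw [← sq_abs u]; nlinarith
  have hdet' : Δ * (q0 * q2 - t ^ 2) - u ^ 2 = q0 := by
    rw [hΔ, hu]; linear_combination q0 * hdet
  have hΔq : Δ ≤ q0 * q1 := by rw [hΔ]; linarith [sq_nonneg s]
  have h6 : Δ * (q0 * q1) ≤ 2 * q0 := by
    have a1 : q0 * q1 ≤ q0 * q2 := mul_le_mul_of_nonneg_left h5 h0.le
    have a2 : 3 / 4 * (q0 * q1) ≤ q0 * q2 - t ^ 2 := by linarith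
    have a3 := mul_le_mul_of_nonneg_left a2 hΔ0.le
    have a4 := mul_le_mul_of_nonneg_left hΔq hΔ0.le
    have a5 : Δ ^ 2 = Δ * Δ := sq Δ
    linarith
  have h7 : 3 * (q0 * q1) * (q0 * q1) ≤ 8 * q0 := by
    have := mul_le_mul_of_nonneg_right hΔ1 hq01.le
    linarith
  have h8 : q0 * (3 * (q0 * q1 ^ 2)) ≤ q0 * 8 := by
    have : q0 * (3 * (q0 * q1 ^ 2)) = 3 * (q0 * q1) * (q0 * q1) := by ring
    linarith
  have := le_of_mul_le_mul_left h8 h0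
  linarith

/-- The Gram determinant, by orthogonalization. -/
lemma det_sq_le {c : Cols} (h : (colMat c).det = 1) (h0 : 0 < c 0 ⬝ᵥ c 0)
    (h1 : 2 * |c 0 ⬝ᵥ c 1| ≤ c 0 ⬝ᵥ c 0) (h2 : c 0 ⬝ᵥ c 0 ≤ c 1 ⬝ᵥ c 1)
    (h3 : 2 * |c 0 ⬝ᵥ c 2| ≤ c 0 ⬝ᵥ c 0)
    (h4 : 2 * ((c 0 ⬝ᵥ c 0) * |((c 0 ⬝ᵥ c 0) • c 1 - (c 0 ⬝ᵥ c 1) • c 0) ⬝ᵥ c 2|) ≤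
      ((c 0 ⬝ᵥ c 0) • c 1 - (c 0 ⬝ᵥ c 1) • c 0) ⬝ᵥ ((c 0 ⬝ᵥ c 0) • c 1 - (c 0 ⬝ᵥ c 1) • c 0))
    (h5 : c 1 ⬝ᵥ c 1 ≤ c 2 ⬝ᵥ c 2) :
    (c 0 ⬝ᵥ c 0) * (c 1 ⬝ᵥ c 1) ^ 2 ≤ 3 := by
  set q0 := c 0 ⬝ᵥ c 0 with hq0
  set q1 := c 1 ⬝ᵥ c 1 with hq1
  set q2 := c 2 ⬝ᵥ c 2 with hq2
  set s := c 0 ⬝ᵥ c 1 with hs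
  set t := c 0 ⬝ᵥ c 2 with ht
  set r := c 1 ⬝ᵥ c 2 with hr
  have e1 : (q0 • c 1 - s • c 0) ⬝ᵥ c 2 = q0 * r - s * t := by
    simp [sub_dotProduct, smul_dotProduct, ← hr, ← ht]
  have e2 : (q0 • c 1 - s • c 0) ⬝ᵥ (q0 • c 1 - s • c 0) = q0 * (q0 * q1 - s ^ 2) := by
    have : c 1 ⬝ᵥ c 0 = s := dotProduct_comm _ _
    simp [sub_dotProduct, dotProduct_sub, smul_dotProduct, dotProduct_smul, this, ← hq0, ← hq1,
      ← hs]
    ring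
  rw [e1, e2] at h4
  have hdet : q0 * q1 * q2 + 2 * s * t * r - q0 * r ^ 2 - q1 * t ^ 2 - q2 * s ^ 2 = 1 := by
    have h' : (colMat c).det ^ 2 = 1 := by rw [h]; norm_num
    rw [← h', Matrix.det_fin_three]
    simp only [colMat_apply, hq0, hq1, hq2, hs, ht, hr, dotProduct, Fin.sum_univ_three]
    ring
  exact gram_le h0 h1 h2 h3 h4 h5 hdet

lemma dotProduct_self_pos' {x : Fin 3 → ℝ} (h : x ≠ 0) : 0 < x ⬝ᵥ x :=
  lt_of_le_of_ne (dotProduct_self_nonneg' x) fun h' => h (dotProduct_self_eq_zero.1 h'.symm)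

lemma colsOf_ne_zero (g : SL3) (j : Fin 3) : colsOf g j ≠ 0 := by
  intro h
  have := g.2
  rw [Matrix.det_eq_zero_of_column_eq_zero j fun i => congrFun h i] at this
  exact zero_ne_one this

theorem exists_reducedCols (g : SL3) : ∃ γ ∈ Gam, ReducedCols (colsOf (g * γ)) := by
  obtain ⟨γ₁, hγ₁, -, hmin₁⟩ := exists_min_col g 0 (fun _ => True) ⟨1, one_mem _, trivial⟩
  obtain ⟨γ₂, hγ₂, hP, hmin₂⟩ := exists_min_col g 1
    (fun γ => ∀ δ ∈ Gam, colsOf (g * γ) 0 ⬝ᵥ colsOf (g * γ) 0 ≤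
      colsOf (g * δ) 0 ⬝ᵥ colsOf (g * δ) 0) ⟨γ₁, hγ₁, fun δ hδ => hmin₁ δ hδ trivial⟩
  set c := colsOf (g * γ₂) with hc
  have hmin1 (η : SL3) (hη : η ∈ Gam) (h0 : colsOf (g * (γ₂ * η)) 0 = c 0) :
      c 1 ⬝ᵥ c 1 ≤ colsOf (g * (γ₂ * η)) 1 ⬝ᵥ colsOf (g * (γ₂ * η)) 1 :=
    hmin₂ _ (mul_mem hγ₂ hη) fun δ hδ => by rw [h0]; exact hP δ hδ
  have hcol (η : SL3) (j : Fin 3) : colsOf (g * (γ₂ * η)) j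
      = η.1 0 j • c 0 + η.1 1 j • c 1 + η.1 2 j • c 2 := by
    rw [← mul_assoc, colsOf_mul]
  have q0 : 0 < c 0 ⬝ᵥ c 0 := dotProduct_self_pos' (colsOf_ne_zero _ _)
  have hshear (k : ℤ) : c 1 ⬝ᵥ c 1 ≤ (c 1 + (k : ℝ) • c 0) ⬝ᵥ (c 1 + (k : ℝ) • c 0) := by
    obtain ⟨η, hη, hη'⟩ := exists_mem_Gam !![1, k, 0; 0, 1, 0; 0, 0, 1] (by
      simp [Matrix.det_fin_three])
    have := hmin1 η hη (by rw [hcol, hη']; simp)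
    rw [hcol, hη'] at this
    simpa [add_comm] using this
  have h1 : 2 * |c 0 ⬝ᵥ c 1| ≤ c 0 ⬝ᵥ c 0 := by
    apply two_mul_abs_dotProduct_le
    · simpa using hshear 1
    · simpa [sub_eq_add_neg] using hshear (-1)
  have h2 : c 0 ⬝ᵥ c 0 ≤ c 1 ⬝ᵥ c 1 := by
    obtain ⟨η, hη, hη'⟩ := exists_mem_Gam !![0, -1, 0; 1, 0, 0; 0, 0, 1] (by
      simp [Matrix.det_fin_three])
    have := hP _ (mul_mem hγ₂ hη)
    rw [hcol, hη'] at this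
    simpa using this
  set Δ := (c 0 ⬝ᵥ c 0) * (c 1 ⬝ᵥ c 1) - (c 0 ⬝ᵥ c 1) ^ 2 with hΔ
  have hΔ0 : 0 < Δ := by
    have := abs_nonneg (c 0 ⬝ᵥ c 1)
    rw [hΔ, ← sq_abs (c 0 ⬝ᵥ c 1)]; nlinarith
  set w := (c 0 ⬝ᵥ c 0) • c 1 - (c 0 ⬝ᵥ c 1) • c 0 with hw
  have e0 : w ⬝ᵥ c 0 = 0 := by
    simp [hw, sub_dotProduct, smul_dotProduct, dotProduct_comm (c 1) (c 0)]; ring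
  have e1 : w ⬝ᵥ c 1 = Δ := by
    simp [hw, hΔ, sub_dotProduct, smul_dotProduct]; ring
  have e2 : w ⬝ᵥ w = (c 0 ⬝ᵥ c 0) * Δ := by
    conv_lhs => rw [hw]
    rw [sub_dotProduct, smul_dotProduct, smul_dotProduct, dotProduct_comm _ w,
      dotProduct_comm _ w, e0, e1]
    simp
  set j : ℤ := -round (w ⬝ᵥ c 2 / Δ) with hj
  set k : ℤ := -round (c 0 ⬝ᵥ (c 2 + (j : ℝ) • c 1) / (c 0 ⬝ᵥ c 0)) with hk
  obtain ⟨η, hη, hη'⟩ := exists_mem_Gam !![1, 0, k; 0, 1, j; 0, 0, 1] (by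
      simp [Matrix.det_fin_three])
  refine ⟨γ₂ * η, mul_mem hγ₂ hη, ?_⟩
  have f0 : colsOf (g * (γ₂ * η)) 0 = c 0 := by rw [hcol, hη']; simp
  have f1 : colsOf (g * (γ₂ * η)) 1 = c 1 := by rw [hcol, hη']; simp
  have f2 : colsOf (g * (γ₂ * η)) 2 = c 2 + (j : ℝ) • c 1 + (k : ℝ) • c 0 := by
    rw [hcol, hη']; simp; abel
  have h3 : 2 * |c 0 ⬝ᵥ colsOf (g * (γ₂ * η)) 2| ≤ c 0 ⬝ᵥ c 0 := by
    rw [f2, dotProduct_add, dotProduct_smul, smul_eq_mul]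
    exact two_mul_abs_sub_round_le q0
  have h4 : 2 * ((c 0 ⬝ᵥ c 0) * |w ⬝ᵥ colsOf (g * (γ₂ * η)) 2|) ≤ w ⬝ᵥ w := by
    rw [f2, dotProduct_add, dotProduct_add, dotProduct_smul, dotProduct_smul, e0, e1, e2]
    have := two_mul_abs_sub_round_le (a := w ⬝ᵥ c 2) hΔ0
    simp only [smul_eq_mul, mul_zero, add_zero]
    nlinarith
  have h5 : c 1 ⬝ᵥ c 1 ≤ colsOf (g * (γ₂ * η)) 2 ⬝ᵥ colsOf (g * (γ₂ * η)) 2 := by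
    obtain ⟨θ, hθ, hθ'⟩ := exists_mem_Gam !![1, k, 0; 0, j, -1; 0, 1, 0] (by
      simp [Matrix.det_fin_three])
    have := hmin1 θ hθ (by rw [hcol, hθ']; simp)
    have e : colsOf (g * (γ₂ * θ)) 1 = colsOf (g * (γ₂ * η)) 2 := by
      rw [hcol, hcol, hθ', hη']; simp
    rwa [e] at this
  have key := det_sq_le (c := colsOf (g * (γ₂ * η))) (by rw [colMat_colsOf]; exact (g * (γ₂ * η)).2)
  unfold ReducedCols
  simp only [f0, f1] at key ⊢
  exact ⟨h1, h2, h3, h4, key q0 h1 h2 h3 h4 h5⟩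

end Reduction

section FiniteVolume

open scoped ENNReal

lemma reducedCols_smul {c : Cols} (h : ReducedCols c) {τ : ℝ} (h0 : 0 < τ) (h1 : τ ≤ 1) :
    ReducedCols (τ • c) := by
  obtain ⟨a1, a2, a3, a4, a5⟩ := h
  have hsm (i j : Fin 3) : (τ • c) i ⬝ᵥ (τ • c) j = τ ^ 2 * (c i ⬝ᵥ c j) := by
    simp [smul_dotProduct, dotProduct_smul]; ring
  have hτ : 0 < τ ^ 2 := by positivity
  unfold ReducedCols
  simp only [hsm]
  have hw : (τ ^ 2 * (c 0 ⬝ᵥ c 0)) • (τ • c) 1 - (τ ^ 2 * (c 0 ⬝ᵥ c 1)) • (τ • c) 0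
      = τ ^ 3 • ((c 0 ⬝ᵥ c 0) • c 1 - (c 0 ⬝ᵥ c 1) • c 0) := by
    ext i; simp; ring
  rw [hw]
  set w := (c 0 ⬝ᵥ c 0) • c 1 - (c 0 ⬝ᵥ c 1) • c 0
  have e2 : (τ • c) 2 = τ • c 2 := rfl
  simp only [smul_dotProduct, e2, dotProduct_smul, smul_eq_mul, abs_mul, abs_of_pos hτ,
    abs_of_pos h0,
    abs_of_pos (pow_pos h0 3)]
  refine ⟨?_, ?_, ?_, ?_, ?_⟩
  · nlinarith
  · nlinarith
  · nlinarith
  · have : 0 < τ ^ 6 := by positivity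
    have := mul_le_mul_of_nonneg_left a4 this.le
    linarith
  · have h6 : τ ^ 6 ≤ 1 := pow_le_one₀ h0.le h1
    have hn : 0 ≤ (c 0 ⬝ᵥ c 0) * (c 1 ⬝ᵥ c 1) ^ 2 :=
      mul_nonneg (dotProduct_self_nonneg' _) (sq_nonneg _)
    calc τ ^ 2 * (c 0 ⬝ᵥ c 0) * (τ ^ 2 * (c 1 ⬝ᵥ c 1)) ^ 2
        = τ ^ 6 * ((c 0 ⬝ᵥ c 0) * (c 1 ⬝ᵥ c 1) ^ 2) := by ring
      _ ≤ 1 * ((c 0 ⬝ᵥ c 0) * (c 1 ⬝ᵥ c 1) ^ 2) := by gcongr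
      _ ≤ 3 := by linarith

lemma isClosed_reducedCols : IsClosed {c : Cols | ReducedCols c} := by
  have hd (i j : Fin 3) : Continuous fun c : Cols => c i ⬝ᵥ c j :=
    (continuous_apply i).dotProduct (continuous_apply j)
  have hw : Continuous fun c : Cols => (c 0 ⬝ᵥ c 0) • c 1 - (c 0 ⬝ᵥ c 1) • c 0 :=
    ((hd 0 0).smul (continuous_apply 1)).sub ((hd 0 1).smul (continuous_apply 0))
  have h1 : IsClosed {c : Cols | 2 * |c 0 ⬝ᵥ c 1| ≤ c 0 ⬝ᵥ c 0} :=
    isClosed_le (continuous_const.mul (hd 0 1).abs) (hd 0 0)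
  have h2 : IsClosed {c : Cols | c 0 ⬝ᵥ c 0 ≤ c 1 ⬝ᵥ c 1} := isClosed_le (hd 0 0) (hd 1 1)
  have h3 : IsClosed {c : Cols | 2 * |c 0 ⬝ᵥ c 2| ≤ c 0 ⬝ᵥ c 0} :=
    isClosed_le (continuous_const.mul (hd 0 2).abs) (hd 0 0)
  have h4 := isClosed_le
    (continuous_const.mul ((hd 0 0).mul (hw.dotProduct (continuous_apply 2)).abs) :
      Continuous fun c : Cols => 2 * ((c 0 ⬝ᵥ c 0) *
        |((c 0 ⬝ᵥ c 0) • c 1 - (c 0 ⬝ᵥ c 1) • c 0) ⬝ᵥ c 2|))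
    (hw.dotProduct hw)
  have h5 : IsClosed {c : Cols | (c 0 ⬝ᵥ c 0) * (c 1 ⬝ᵥ c 1) ^ 2 ≤ 3} :=
    isClosed_le ((hd 0 0).mul ((hd 1 1).pow 2)) continuous_const
  exact h1.inter (h2.inter (h3.inter (h4.inter h5)))

/-- Volume of a parallelepiped given by linear inequalities. -/
lemma volume_slab {U : Matrix (Fin 3) (Fin 3) ℝ} (hU : U.det ≠ 0) (r : Fin 3 → ℝ) :
    volume {x : Fin 3 → ℝ | ∀ i, |(U *ᵥ x) i| ≤ r i}
      = ENNReal.ofReal |U.det|⁻¹ * ∏ i, ENNReal.ofReal (2 * r i) := by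
  have hset : {x : Fin 3 → ℝ | ∀ i, |(U *ᵥ x) i| ≤ r i} = Matrix.toLin' U ⁻¹' Set.Icc (-r) r := by
    ext x
    simp only [Set.mem_ofPred_eq, Set.mem_preimage, Matrix.toLin'_apply, Set.mem_Icc, Pi.le_def,
      Pi.neg_apply, abs_le, forall_and]
  rw [hset, Measure.addHaar_preimage_linearMap _ (by rwa [LinearMap.det_toLin']),
    LinearMap.det_toLin', Real.volume_Icc_pi, abs_inv]
  congr 2
  ext i
  congr 1
  simp; ring

lemma volume_third_le {x y : Fin 3 → ℝ} {w : Fin 3 → ℝ}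
    (hw : w = (x ⬝ᵥ x) • y - (x ⬝ᵥ y) • x) :
    volume {z : Fin 3 → ℝ | 0 < (colMat ![x, y, z]).det ∧ (colMat ![x, y, z]).det ≤ 1 ∧
      2 * |x ⬝ᵥ z| ≤ x ⬝ᵥ x ∧ 2 * ((x ⬝ᵥ x) * |w ⬝ᵥ z|) ≤ w ⬝ᵥ w} ≤ 2 := by
  set q := x ⬝ᵥ x with hq
  set Δ := q * (y ⬝ᵥ y) - (x ⬝ᵥ y) ^ 2 with hΔ
  set n : Fin 3 → ℝ := ![x 1 * y 2 - x 2 * y 1, x 2 * y 0 - x 0 * y 2, x 0 * y 1 - x 1 * y 0]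
    with hn
  have hdet (z : Fin 3 → ℝ) : (colMat ![x, y, z]).det = n ⬝ᵥ z := by
    rw [Matrix.det_fin_three]
    simp [colMat_apply, hn, dotProduct, Fin.sum_univ_three]
    ring
  have hqn : n ⬝ᵥ n = Δ := by
    simp [hn, hΔ, hq, dotProduct, Fin.sum_univ_three]; ring
  have hww : w ⬝ᵥ w = q * Δ := by
    simp [hw, hΔ, hq, dotProduct, Fin.sum_univ_three]; ring
  have hdU : (Matrix.of ![x, w, n]).det = q * Δ := by
    rw [Matrix.det_fin_three]
    simp [hn, hw, hΔ, hq, dotProduct, Fin.sum_univ_three]; ring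
  have hq0 : 0 ≤ q := dotProduct_self_nonneg' x
  have hΔ0 : 0 ≤ Δ := hqn ▸ dotProduct_self_nonneg' n
  by_cases hz : q * Δ = 0
  · refine le_trans (le_of_eq ?_) zero_le
    refine measure_mono_null (t := ∅) ?_ measure_empty
    rintro z ⟨h1, -⟩
    rw [hdet] at h1
    rcases mul_eq_zero.1 hz with h | h
    · have : x = 0 := dotProduct_self_eq_zero.1 h
      simp [hn, this] at h1
    · have : n = 0 := dotProduct_self_eq_zero.1 (hqn.trans h)
      rw [this] at h1
      simp at h1
  · have hpos : 0 < q * Δ := lt_of_le_of_ne (mul_nonneg hq0 hΔ0) (Ne.symm hz)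
    have hqpos : 0 < q := lt_of_le_of_ne hq0 fun h => hz (by rw [← h, zero_mul])
    have hΔpos : 0 < Δ := lt_of_le_of_ne hΔ0 fun h => hz (by rw [← h, mul_zero])
    refine le_trans (measure_mono (t := {z | ∀ i, |(Matrix.of ![x, w, n] *ᵥ z) i|
      ≤ ![q / 2, Δ / 2, 1] i}) ?_) ?_
    · rintro z ⟨h1, h2, h3, h4⟩ i
      rw [hdet] at h1 h2
      rw [hww] at h4
      fin_cases i
      · change |x ⬝ᵥ z| ≤ q / 2
        linarith
      · change |w ⬝ᵥ z| ≤ Δ / 2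
        have h4' : q * (2 * |w ⬝ᵥ z|) ≤ q * Δ := by linarith
        linarith [le_of_mul_le_mul_left h4' hqpos]
      · change |n ⬝ᵥ z| ≤ 1
        rw [abs_of_pos h1]; exact h2
    · rw [volume_slab (by rw [hdU]; exact hz), hdU, abs_of_pos hpos, Fin.prod_univ_three]
      change ENNReal.ofReal (q * Δ)⁻¹ * (ENNReal.ofReal (2 * (q / 2)) *
        ENNReal.ofReal (2 * (Δ / 2)) * ENNReal.ofReal (2 * 1)) ≤ 2
      rw [← ENNReal.ofReal_mul (by positivity), ← ENNReal.ofReal_mul (by positivity),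
        ← ENNReal.ofReal_mul (by positivity)]
      have : (q * Δ)⁻¹ * (2 * (q / 2) * (2 * (Δ / 2)) * (2 * 1)) = 2 := by field_simp
      rw [this]; simp

lemma le_of_sq_le_of_nonneg {a b : ℝ} (h : a ^ 2 ≤ b ^ 2) (hb : 0 ≤ b) : a ≤ b :=
  (abs_le_of_sq_le_sq' h hb).2

lemma volume_second_le {x : Fin 3 → ℝ} (hx : x ≠ 0) :
    volume {y : Fin 3 → ℝ | 2 * |x ⬝ᵥ y| ≤ x ⬝ᵥ x ∧ (x ⬝ᵥ x) * (y ⬝ᵥ y) ^ 2 ≤ 3} ≤ 12 := by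
  set q := x ⬝ᵥ x with hq
  have hqpos : 0 < q := dotProduct_self_pos' hx
  obtain ⟨k, hk⟩ : ∃ k, q ≤ 3 * x k ^ 2 := by
    by_contra! h
    have h0 := h 0
    have h1 := h 1
    have h2 := h 2
    simp only [hq, dotProduct, Fin.sum_univ_three] at h0 h1 h2
    linarith
  have hk0 : x k ≠ 0 := by
    intro h
    rw [h] at hk
    norm_num at hk
    linarith
  obtain ⟨ρ, hρ0, hρ⟩ : ∃ ρ : ℝ, 0 ≤ ρ ∧ q * ρ ^ 4 = 3 := by
    refine ⟨√(√(3 / q)), Real.sqrt_nonneg _, ?_⟩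
    have : √(√(3 / q)) ^ 4 = (√(√(3 / q)) ^ 2) ^ 2 := by ring
    rw [this, Real.sq_sqrt (Real.sqrt_nonneg _), Real.sq_sqrt (by positivity)]
    field_simp
  have hU : ((1 : Matrix (Fin 3) (Fin 3) ℝ).updateRow k x).det = x k := by
    fin_cases k <;> simp [Matrix.det_fin_three, Matrix.updateRow_apply]
  refine le_trans (measure_mono (t := {y | ∀ i, |((1 : Matrix (Fin 3) (Fin 3) ℝ).updateRow k x
    *ᵥ y) i| ≤ Function.update (fun _ => ρ) k (q / 2) i}) ?_) ?_
  · rintro y ⟨h1, h2⟩ i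
    by_cases hik : i = k
    · subst hik
      have : ((1 : Matrix (Fin 3) (Fin 3) ℝ).updateRow i x *ᵥ y) i = x ⬝ᵥ y := by
        simp [Matrix.mulVec]
      rw [this]; simp; linarith
    · have : ((1 : Matrix (Fin 3) (Fin 3) ℝ).updateRow k x *ᵥ y) i = y i := by
        have e : ((1 : Matrix (Fin 3) (Fin 3) ℝ).updateRow k x *ᵥ y) i
            = ((1 : Matrix (Fin 3) (Fin 3) ℝ) *ᵥ y) i := by
          simp only [Matrix.mulVec, Matrix.updateRow_ne hik]
        rw [e, Matrix.one_mulVec]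
      rw [this, Function.update_of_ne hik]
      have h3 : y ⬝ᵥ y ≤ ρ ^ 2 := by
        rw [← hρ] at h2
        have := le_of_mul_le_mul_left h2 hqpos
        refine le_of_sq_le_of_nonneg ?_ (by positivity)
        linarith [show (ρ ^ 2) ^ 2 = ρ ^ 4 by ring]
      have := abs_le_of_dotProduct_self_le h3 i
      rwa [Real.sqrt_sq hρ0] at this
  · rw [volume_slab (by rwa [hU]), hU]
    have : ∏ i, ENNReal.ofReal (2 * Function.update (fun _ => ρ) k (q / 2) i)
        = ENNReal.ofReal (q * (4 * ρ ^ 2)) := by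
      rw [← ENNReal.ofReal_prod_of_nonneg]
      · congr 1
        rw [Fin.prod_univ_three]
        fin_cases k <;> simp [Function.update] <;> ring
      · intro i _
        by_cases hik : i = k
        · subst hik; simp; positivity
        · rw [Function.update_of_ne hik]; positivity
    rw [this, ← ENNReal.ofReal_mul (by positivity)]
    refine (ENNReal.ofReal_le_ofReal ?_).trans_eq (by norm_num : ENNReal.ofReal 12 = 12)
    rw [inv_mul_le_iff₀ (by positivity)]
    refine le_of_sq_le_of_nonneg ?_ (by positivity)
    calc (q * (4 * ρ ^ 2)) ^ 2 = 16 * q * (q * ρ ^ 4) := by ring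
      _ = 48 * q := by rw [hρ]; ring
      _ ≤ 48 * (3 * x k ^ 2) := by gcongr
      _ = (|x k| * 12) ^ 2 := by rw [mul_pow, sq_abs]; ring

/-- Splitting off the columns. -/
noncomputable def colsEquiv : Cols ≃ᵐ (Fin 3 → ℝ) × ((Fin 3 → ℝ) × (Fin 3 → ℝ)) :=
  (MeasurableEquiv.piFinSuccAbove (fun _ : Fin 3 => Fin 3 → ℝ) 0).trans
    (MeasurableEquiv.prodCongr (MeasurableEquiv.refl _) MeasurableEquiv.finTwoArrow)

lemma colsEquiv_symm_apply (x y z : Fin 3 → ℝ) : colsEquiv.symm (x, (y, z)) = ![x, y, z] := by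
  rw [MeasurableEquiv.symm_apply_eq]
  rfl

lemma measurePreserving_colsEquiv : MeasurePreserving colsEquiv volume volume := by
  have h1 := volume_preserving_piFinSuccAbove (fun _ : Fin 3 => Fin 3 → ℝ) 0
  have h2 := (MeasurePreserving.id (volume : Measure (Fin 3 → ℝ))).prod
    (volume_preserving_finTwoArrow (Fin 3 → ℝ))
  exact h2.comp h1

lemma volume_reduced_lt_top : volume ({c : Cols | ReducedCols c} ∩ cone 1) < ∞ := by
  set D := {c : Cols | ReducedCols c} ∩ cone 1 with hD
  have hDm : MeasurableSet D := isClosed_reducedCols.measurableSet.inter (measurableSet_cone 1)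
  rw [← measurePreserving_colsEquiv.symm.measure_preimage_equiv D]
  have hm : MeasurableSet (colsEquiv.symm ⁻¹' D) := colsEquiv.symm.measurable hDm
  change (volume.prod volume : Measure _) (colsEquiv.symm ⁻¹' D) < ∞
  rw [Measure.prod_apply hm]
  have hsec (x : Fin 3 → ℝ) : (volume : Measure ((Fin 3 → ℝ) × (Fin 3 → ℝ)))
      (Prod.mk x ⁻¹' (colsEquiv.symm ⁻¹' D)) ≤
      Set.indicator (Set.Icc (fun _ => (-2 : ℝ)) fun _ => 2) (fun _ => 24) x := by
    by_cases hx : x ∈ Set.Icc (fun _ => (-2 : ℝ)) fun _ => 2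
    · rw [Set.indicator_of_mem hx]
      by_cases hx0 : x = 0
      · refine le_trans (le_of_eq ?_) zero_le
        refine measure_mono_null (t := ∅) ?_ measure_empty
        rintro ⟨y, z⟩ h
        rw [Set.mem_preimage, Set.mem_preimage, colsEquiv_symm_apply] at h
        have := h.2.1
        rw [Matrix.det_fin_three] at this
        simp [colMat_apply, hx0] at this
      have hm' := measurable_prodMk_left (x := x) hm
      change (volume.prod volume : Measure _) _ ≤ _
      rw [Measure.prod_apply hm']
      calc ∫⁻ y, volume (Prod.mk y ⁻¹' (Prod.mk x ⁻¹' (colsEquiv.symm ⁻¹' D)))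
          ≤ ∫⁻ y, Set.indicator {y : Fin 3 → ℝ | 2 * |x ⬝ᵥ y| ≤ x ⬝ᵥ x ∧
            (x ⬝ᵥ x) * (y ⬝ᵥ y) ^ 2 ≤ 3} (fun _ => 2) y := by
            refine lintegral_mono fun y => ?_
            by_cases hy : y ∈ {y : Fin 3 → ℝ | 2 * |x ⬝ᵥ y| ≤ x ⬝ᵥ x ∧
                (x ⬝ᵥ x) * (y ⬝ᵥ y) ^ 2 ≤ 3}
            · rw [Set.indicator_of_mem hy]
              refine le_trans (measure_mono ?_) (volume_third_le (x := x) (y := y) rfl)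
              intro z h
              rw [Set.mem_preimage, Set.mem_preimage, Set.mem_preimage, colsEquiv_symm_apply] at h
              obtain ⟨⟨-, -, h3, h4, -⟩, h6, h7⟩ := h
              exact ⟨h6, h7, h3, h4⟩
            · rw [Set.indicator_of_notMem hy]
              refine le_of_eq (measure_mono_null (t := ∅) ?_ measure_empty)
              intro z h
              rw [Set.mem_preimage, Set.mem_preimage, Set.mem_preimage, colsEquiv_symm_apply] at h
              obtain ⟨⟨h1, -, -, -, h5⟩, -⟩ := h
              exact hy ⟨h1, h5⟩
        _ = 2 * volume {y : Fin 3 → ℝ | 2 * |x ⬝ᵥ y| ≤ x ⬝ᵥ x ∧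
            (x ⬝ᵥ x) * (y ⬝ᵥ y) ^ 2 ≤ 3} := by
            rw [lintegral_indicator, lintegral_const, Measure.restrict_apply_univ]
            have hd : Continuous fun y : Fin 3 → ℝ => x ⬝ᵥ y :=
              continuous_const.dotProduct continuous_id
            have hd' : Continuous fun y : Fin 3 → ℝ => y ⬝ᵥ y :=
              continuous_id.dotProduct continuous_id
            exact ((isClosed_le (continuous_const.mul hd.abs) continuous_const).inter
              (isClosed_le (continuous_const.mul (hd'.pow 2)) continuous_const)).measurableSet
        _ ≤ 2 * 12 := by gcongr; exact volume_second_le hx0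
        _ = 24 := by norm_num
    · rw [Set.indicator_of_notMem hx]
      refine le_of_eq (measure_mono_null (t := ∅) ?_ measure_empty)
      rintro ⟨y, z⟩ h
      rw [Set.mem_preimage, Set.mem_preimage, colsEquiv_symm_apply] at h
      obtain ⟨⟨-, h2, -, -, h5⟩, -⟩ := h
      change x ⬝ᵥ x ≤ y ⬝ᵥ y at h2
      change (x ⬝ᵥ x) * (y ⬝ᵥ y) ^ 2 ≤ 3 at h5
      apply hx
      have hq : x ⬝ᵥ x ≤ 4 := by
        by_contra! h
        have : 4 * 4 ^ 2 < (x ⬝ᵥ x) * (y ⬝ᵥ y) ^ 2 := by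
          have : (4 : ℝ) < y ⬝ᵥ y := by linarith
          gcongr
        linarith
      have hb (i) := abs_le.1 (abs_le_of_dotProduct_self_le hq i)
      have h4 : √(4 : ℝ) = 2 := by
        rw [show (4 : ℝ) = 2 ^ 2 by norm_num, Real.sqrt_sq (by norm_num)]
      rw [h4] at hb
      exact ⟨fun i => (hb i).1, fun i => (hb i).2⟩
  refine lt_of_le_of_lt (lintegral_mono hsec) ?_
  rw [lintegral_indicator measurableSet_Icc, lintegral_const, Measure.restrict_apply_univ]
  exact ENNReal.mul_lt_top (by simp) (isCompact_Icc.measure_lt_top)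

theorem haarSL_fundDom_lt_top : haarSL fundDom < ∞ := by
  have hc : Continuous colsOf :=
    continuous_pi fun j => continuous_pi fun i => SL3.continuous_val.matrix_elem i j
  refine lt_of_le_of_lt (measure_fundDom_le (S := {g | ReducedCols (colsOf g)})
    exists_reducedCols) ?_
  have happ := haarSL_apply (A := {g | ReducedCols (colsOf g)})
    (isClosed_reducedCols.preimage hc).measurableSet
  rw [happ]
  refine lt_of_le_of_lt (measure_mono ?_) volume_reduced_lt_top
  rintro c ⟨h1, h2⟩
  refine ⟨?_, h2⟩
  have h4 : c = (colMat c).det ^ (1 / 3 : ℝ) • colsOf (slProj c) := by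
    ext j i
    exact congrFun (congrFun (colMat_eq_smul_slProj h2.1) i) j
  change ReducedCols c
  rw [h4]
  exact reducedCols_smul h1 (Real.rpow_pos_of_pos h2.1 _)
    (Real.rpow_le_one h2.1.le h2.2 (by norm_num))

end FiniteVolume

section QuotientMeasure

open scoped ENNReal

instance : PolishSpace SL3 :=
  have : PolishSpace (Matrix (Fin 3) (Fin 3) ℝ) :=
    inferInstanceAs (PolishSpace (Fin 3 → Fin 3 → ℝ))
  (Matrix.SpecialLinearGroup.isClosedEmbedding_val (n := Fin 3) (R := ℝ)).polishSpace

instance : SecondCountableTopology (SL3 ⧸ Gam) :=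
  (QuotientGroup.isOpenQuotientMap_mk (N := Gam)).isQuotientMap.secondCountableTopology
    (QuotientGroup.isOpenMap_coe)

instance : BorelSpace (SL3 ⧸ Gam) := CosetSpace.borelSpace

instance : TopologicalSpace.MetrizableSpace (SL3 ⧸ Gam) := by
  have : LocallyCompactSpace (SL3 ⧸ Gam) := inferInstance
  exact TopologicalSpace.metrizableSpace_of_t3_secondCountable _

lemma haarSL_fundDom_ne_zero : haarSL fundDom ≠ 0 := by
  exact isFundamentalDomain_fundDom.measure_ne_zero (NeZero.ne haarSL)

/-- The invariant probability measure on `SL(3, ℝ) / SL(3, ℤ)`. -/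
noncomputable def quotMeas : Measure (SL3 ⧸ Gam) :=
  (haarSL fundDom)⁻¹ • (haarSL.restrict fundDom).map (QuotientGroup.mk : SL3 → SL3 ⧸ Gam)

lemma measurable_quotient_mk : Measurable (QuotientGroup.mk : SL3 → SL3 ⧸ Gam) :=
  QuotientGroup.continuous_mk.measurable

lemma quotMeas_apply {A : Set (SL3 ⧸ Gam)} (hA : MeasurableSet A) :
    quotMeas A = (haarSL fundDom)⁻¹ * haarSL (QuotientGroup.mk ⁻¹' A ∩ fundDom) := by
  rw [quotMeas, Measure.smul_apply, smul_eq_mul, Measure.map_apply measurable_quotient_mk hA,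
    Measure.restrict_apply (measurable_quotient_mk hA)]

instance : IsProbabilityMeasure quotMeas := ⟨by
  rw [quotMeas_apply MeasurableSet.univ, Set.preimage_univ, Set.univ_inter]
  exact ENNReal.inv_mul_cancel haarSL_fundDom_ne_zero haarSL_fundDom_lt_top.ne⟩

instance : SMulInvariantMeasure SL3 (SL3 ⧸ Gam) quotMeas := by
  have : HasFundamentalDomain Gam.op SL3 haarSL := ⟨⟨fundDom, isFundamentalDomain_fundDom⟩⟩
  have : QuotientMeasureEqMeasurePreimage haarSL
      ((haarSL.restrict fundDom).map (QuotientGroup.mk : SL3 → SL3 ⧸ Gam)) :=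
    isFundamentalDomain_fundDom.quotientMeasureEqMeasurePreimage_quotientMeasure
  have := QuotientMeasureEqMeasurePreimage.smulInvariantMeasure_quotient (Γ := Gam) (ν := haarSL)
    (μ := (haarSL.restrict fundDom).map (QuotientGroup.mk : SL3 → SL3 ⧸ Gam))
  unfold quotMeas
  infer_instance

lemma ae_quotMeas_iff {P : SL3 ⧸ Gam → Prop} (hP : MeasurableSet {x | P x}) :
    (∀ᵐ x ∂quotMeas, P x) ↔ ∀ᵐ g ∂haarSL, P (QuotientGroup.mk g) := by
  have hac := isFundamentalDomain_fundDom.absolutelyContinuous_map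
  have h0 : (haarSL fundDom)⁻¹ ≠ 0 := ENNReal.inv_ne_zero.2 haarSL_fundDom_lt_top.ne
  rw [quotMeas, Measure.ae_ennreal_smul_measure_iff h0]
  constructor
  · intro h
    exact (ae_map_iff measurable_quotient_mk.aemeasurable hP).1 (hac.ae_le h)
  · intro h
    rw [ae_map_iff measurable_quotient_mk.aemeasurable hP]
    exact ae_restrict_of_ae h

instance : ErgodicSMul SL3 (SL3 ⧸ Gam) quotMeas where
  aeconst_of_forall_preimage_smul_ae_eq {s} hs h := by
    have hs' : MeasurableSet ((QuotientGroup.mk : SL3 → SL3 ⧸ Gam) ⁻¹' s) :=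
      measurable_quotient_mk hs
    have key : EventuallyConst ((QuotientGroup.mk : SL3 → SL3 ⧸ Gam) ⁻¹' s) (ae haarSL) := by
      refine aeconst_of_forall_preimage_smul_ae_eq SL3 hs'.nullMeasurableSet fun g => ?_
      have h1 := h g
      rw [eventuallyEq_set] at h1 ⊢
      exact (ae_quotMeas_iff ((((measurable_const_smul g) hs).mem.iff hs.mem).setOf)).1 h1
    rw [eventuallyConst_set] at key ⊢
    refine key.imp (fun h => ?_) fun h => ?_
    · exact (ae_quotMeas_iff hs).2 h
    · exact (ae_quotMeas_iff hs.compl).2 h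

/-- Effective mixing for orbits on `SL(3, ℝ) / SL(3, ℤ)` in terms of Haar measure upstairs. -/
theorem haarSL_mul_measure_le {σ : ℝ} (h0 : 0 < σ) (h1 : σ < 1 / 2) (s : ℝ) {A : Set SL3}
    (hA : IsOpen A) (hinj : ∀ x ∈ A, ∀ y ∈ A, x⁻¹ * y ∈ smallNhd) {E : Set (SL3 ⧸ Gam)}
    (hE : MeasurableSet E)
    (hdisj : ∀ p, ∀ r ∈ A, theta s p • (QuotientGroup.mk r : SL3 ⧸ Gam) ∉ E) :
    haarSL.real A * quotMeas.real E ≤ haarSL.real fundDom * lam σ s ^ 2 := by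
  have hB : MeasurableSet ((QuotientGroup.mk : SL3 → SL3 ⧸ Gam) '' A) :=
    (QuotientGroup.isOpenMap_coe A hA).measurableSet
  have key := measure_mul_measure_le (m := quotMeas) h0 h1 s hB hE (by
    rintro p _ ⟨r, hr, rfl⟩
    exact hdisj p r hr)
  have hV : 0 < haarSL.real fundDom :=
    ENNReal.toReal_pos haarSL_fundDom_ne_zero haarSL_fundDom_lt_top.ne
  have hle : haarSL.real A ≤ haarSL.real fundDom *
      quotMeas.real ((QuotientGroup.mk : SL3 → SL3 ⧸ Gam) '' A) := by
    rw [Measure.real, Measure.real, Measure.real, quotMeas_apply hB, ← ENNReal.toReal_mul,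
      ← mul_assoc, ENNReal.mul_inv_cancel haarSL_fundDom_ne_zero haarSL_fundDom_lt_top.ne, one_mul]
    refine ENNReal.toReal_mono ?_ (haarSL_le_measure_inter hA.measurableSet hinj)
    exact (lt_of_le_of_lt (measure_mono Set.inter_subset_right) haarSL_fundDom_lt_top).ne
  calc haarSL.real A * quotMeas.real E
      ≤ haarSL.real fundDom * quotMeas.real ((QuotientGroup.mk : SL3 → SL3 ⧸ Gam) '' A) *
        quotMeas.real E := by gcongr
    _ ≤ _ := by rw [mul_assoc]; gcongr

end QuotientMeasure

section LocalVolume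

open scoped ENNReal

lemma abs_mul_apply_le {A B : Matrix (Fin 3) (Fin 3) ℝ} {a b : ℝ} (hA : ∀ i j, |A i j| ≤ a)
    (hB : ∀ i j, |B i j| ≤ b) (i j : Fin 3) : |(A * B) i j| ≤ 3 * a * b := by
  have ha : 0 ≤ a := (abs_nonneg _).trans (hA 0 0)
  rw [Matrix.mul_apply]
  refine (Finset.abs_sum_le_sum_abs _ _).trans ?_
  refine (Finset.sum_le_card_nsmul _ _ (a * b) fun k _ => ?_).trans_eq ?_
  · rw [abs_mul]
    exact mul_le_mul (hA i k) (hB k j) (abs_nonneg _) ha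
  · simp; ring

lemma abs_transpose_mul_mul_apply_le {D k : Matrix (Fin 3) (Fin 3) ℝ} {a d : ℝ}
    (hk : ∀ i j, |k i j| ≤ a) (hD : ∀ i j, |D i j| ≤ d) (i j : Fin 3) :
    |(kᵀ * D * k) i j| ≤ 9 * a ^ 2 * d := by
  refine (abs_mul_apply_le (abs_mul_apply_le (A := kᵀ) (fun i j => hk j i) hD) hk i j).trans_eq ?_
  ring

lemma abs_Jmat_apply_le (i j : Fin 3) : |Jmat i j| ≤ 1 := by
  fin_cases i <;> fin_cases j <;> simp [Jmat, Matrix.diagonal]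

lemma abs_mul_three_sub_le {a b c a' b' c' R η : ℝ} (ha' : |a'| ≤ R) (hb : |b| ≤ R)
    (hb' : |b'| ≤ R) (hc : |c| ≤ R) (h1 : |a - a'| ≤ η) (h2 : |b - b'| ≤ η) (h3 : |c - c'| ≤ η) :
    |a * b * c - a' * b' * c'| ≤ 3 * R ^ 2 * η := by
  have hR : 0 ≤ R := (abs_nonneg _).trans hb
  have hη : 0 ≤ η := (abs_nonneg _).trans h1
  have e : a * b * c - a' * b' * c'
      = (a - a') * (b * c) + (b - b') * (a' * c) + (c - c') * (a' * b') := by ring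
  rw [e]
  refine (abs_add_three _ _ _).trans ?_
  simp only [abs_mul]
  have i1 : |a - a'| * (|b| * |c|) ≤ η * (R * R) := by gcongr
  have i2 : |b - b'| * (|a'| * |c|) ≤ η * (R * R) := by gcongr
  have i3 : |c - c'| * (|a'| * |b'|) ≤ η * (R * R) := by gcongr
  linarith

lemma abs_det_sub_det_le {A B : Matrix (Fin 3) (Fin 3) ℝ} {R η : ℝ} (hA : ∀ i j, |A i j| ≤ R)
    (hB : ∀ i j, |B i j| ≤ R) (hAB : ∀ i j, |A i j - B i j| ≤ η) :
    |A.det - B.det| ≤ 18 * R ^ 2 * η := by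
  have key (i j k l m n : Fin 3) := abs_le.1 (abs_mul_three_sub_le (hB i j) (hA k l) (hB k l)
    (hA m n) (hAB i j) (hAB k l) (hAB m n))
  rw [Matrix.det_fin_three, Matrix.det_fin_three, abs_le]
  have k1 := key 0 0 1 1 2 2
  have k2 := key 0 0 1 2 2 1
  have k3 := key 0 1 1 0 2 2
  have k4 := key 0 1 1 2 2 0
  have k5 := key 0 2 1 0 2 1
  have k6 := key 0 2 1 1 2 0
  constructor <;> linarith [k1.1, k1.2, k2.1, k2.2, k3.1, k3.2, k4.1, k4.2, k5.1, k5.2, k6.1, k6.2]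

/-- A pigeonhole principle: some cell of side `η` carries its share of the measure. -/
lemma exists_large_cell {α : Type*} [MeasurableSpace α] (μ : Measure α) {W : Set α}
    (hW : MeasurableSet W) (hWfin : μ W ≠ ∞) {n : ℕ} {T : α → Fin n → ℝ} (hT : Measurable T)
    {R η : ℝ} (hR : 1 ≤ R) (hη : 0 < η) (hη1 : η ≤ 1) (hb : ∀ x ∈ W, ∀ k, |T x k| ≤ R) :
    ∃ S ⊆ W, MeasurableSet S ∧ (∀ x ∈ S, ∀ y ∈ S, ∀ k, |T x k - T y k| ≤ η) ∧
      μ.real W ≤ (4 * R / η) ^ n * μ.real S := by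
  classical
  set I : Finset (Fin n → ℤ) := Fintype.piFinset fun _ => Finset.Icc ⌊-R / η⌋ ⌊R / η⌋ with hI
  set cell : (Fin n → ℤ) → Set α := fun v => W ∩ {x | ∀ k, ⌊T x k / η⌋ = v k} with hcell
  have hcm (v) : MeasurableSet (cell v) := by
    refine hW.inter ?_
    have : {x | ∀ k, ⌊T x k / η⌋ = v k} = ⋂ k, (fun x => ⌊T x k / η⌋) ⁻¹' {v k} := by
      ext x; simp
    rw [this]
    refine MeasurableSet.iInter fun k => ?_
    exact (Int.measurable_floor.comp (((measurable_pi_apply k).comp hT).div_const η))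
      (measurableSet_singleton _)
  have hcov : W ⊆ ⋃ v ∈ I, cell v := by
    intro x hx
    simp only [Set.mem_iUnion]
    refine ⟨fun k => ⌊T x k / η⌋, ?_, hx, fun k => rfl⟩
    rw [hI, Fintype.mem_piFinset]
    intro k
    have := abs_le.1 (hb x hx k)
    rw [Finset.mem_Icc]
    constructor
    · exact Int.floor_le_floor (by gcongr; exact this.1)
    · exact Int.floor_le_floor (by gcongr; exact this.2)
  have hRη : 1 ≤ R / η := by rw [le_div_iff₀ hη]; linarith
  have hcard1 : ((Finset.Icc ⌊-R / η⌋ ⌊R / η⌋).card : ℝ) ≤ 4 * R / η := by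
    rw [Int.card_Icc]
    have h1 := Int.floor_le (R / η)
    have h2 := Int.lt_floor_add_one (-R / η)
    have h3 : (⌊-R / η⌋ : ℤ) ≤ ⌊R / η⌋ := Int.floor_le_floor (by gcongr; linarith)
    have h4 : (((⌊R / η⌋ + 1 - ⌊-R / η⌋).toNat : ℤ) : ℝ) = ((⌊R / η⌋ + 1 - ⌊-R / η⌋ : ℤ) : ℝ) := by
      rw [Int.toNat_of_nonneg (by omega)]
    rw [Int.cast_natCast] at h4
    rw [h4]
    push_cast
    have e1 : -R / η = -(R / η) := by ring
    have e2 : 4 * R / η = 4 * (R / η) := by ring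
    rw [e1] at h2 ⊢
    rw [e2]
    linarith
  have hcard : (I.card : ℝ) ≤ (4 * R / η) ^ n := by
    rw [hI, Fintype.card_piFinset]
    simp only [Finset.prod_const, Finset.card_univ, Fintype.card_fin]
    push_cast
    gcongr
  have hfin (v) : μ (cell v) ≠ ∞ := ((measure_mono Set.inter_subset_left).trans_lt
    (lt_top_iff_ne_top.2 hWfin)).ne
  have hIne : I.Nonempty := by
    rw [hI, Fintype.piFinset_nonempty]
    intro k
    rw [Finset.nonempty_Icc]
    exact Int.floor_le_floor (by gcongr; linarith)
  obtain ⟨v, hv, hle⟩ : ∃ v ∈ I, μ.real W ≤ I.card * μ.real (cell v) := by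
    by_contra! h
    have hsum : μ.real W ≤ ∑ v ∈ I, μ.real (cell v) := by
      refine (measureReal_mono hcov ?_).trans (measureReal_biUnion_finset_le _ _)
      refine ((measure_biUnion_finset_le _ _).trans_lt ?_).ne
      exact ENNReal.sum_lt_top.2 fun v _ => lt_top_iff_ne_top.2 (hfin v)
    have h2 := Finset.sum_lt_sum_of_nonempty hIne h
    rw [← Finset.mul_sum, Finset.sum_const, nsmul_eq_mul] at h2
    have hc : (0 : ℝ) < I.card := by exact_mod_cast hIne.card_pos
    exact absurd (lt_of_mul_lt_mul_left h2 hc.le) (not_lt.2 hsum)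
  refine ⟨cell v, Set.inter_subset_left, hcm v, ?_, hle.trans ?_⟩
  · rintro x ⟨-, hx⟩ y ⟨-, hy⟩ k
    have h1 := Int.abs_sub_lt_one_of_floor_eq_floor ((hx k).trans (hy k).symm)
    rw [← sub_div, abs_div, abs_of_pos hη, div_lt_one hη] at h1
    exact h1.le
  · gcongr

/-- Volume of a piece of the cone near determinant one, compared with Haar measure. -/
lemma volume_shell_le {B : Set SL3} (hB : MeasurableSet B) {S : Set Cols} {x : ℝ} (hx : 0 < x)
    (hx1 : x ≤ 1 / 4) (hS : S ⊆ slProj ⁻¹' B) (hdet : ∀ c ∈ S, |(colMat c).det - 1| ≤ x) :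
    volume S ≤ ENNReal.ofReal (16 * x) * haarSL B := by
  by_cases hH : haarSL B = ∞
  · rw [hH, ENNReal.mul_top (by simpa using hx)]; exact le_top
  have root (y : ℝ) (hy : 0 < y) : ∃ t : ℝ, 0 < t ∧ t ^ 3 = y := by
    refine ⟨y ^ (1 / 3 : ℝ), Real.rpow_pos_of_pos hy _, ?_⟩
    rw [← Real.rpow_natCast, ← Real.rpow_mul hy.le]; norm_num
  obtain ⟨t, ht, ht3⟩ := root (1 + x) (by linarith)
  obtain ⟨u, hu, hu3⟩ := root (1 - 2 * x) (by linarith)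
  have h1 := volume_preimage_inter_cone hB ht
  have h2 := volume_preimage_inter_cone hB hu
  rw [ht3, show t ^ 9 = (t ^ 3) ^ 3 by ring, ht3] at h1
  rw [hu3, show u ^ 9 = (u ^ 3) ^ 3 by ring, hu3] at h2
  have hsub : S ⊆ (slProj ⁻¹' B ∩ cone (1 + x)) \ (slProj ⁻¹' B ∩ cone (1 - 2 * x)) := by
    intro c hc
    have := abs_le.1 (hdet c hc)
    refine ⟨⟨hS hc, ?_, ?_⟩, ?_⟩
    · linarith
    · linarith
    · rintro ⟨-, -, h⟩
      linarith
  refine (measure_mono hsub).trans ?_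
  rw [measure_sdiff, h1, h2]
  · rw [← ENNReal.sub_mul (fun _ _ => hH), ← ENNReal.ofReal_sub _ (by
      have : 0 ≤ 1 - 2 * x := by linarith
      positivity)]
    gcongr
    have h3 : x ^ 3 ≤ x ^ 2 := pow_le_pow_of_le_one hx.le (by linarith) (by norm_num)
    nlinarith [sq_nonneg x]
  · rintro c ⟨h1, h2, h3⟩
    exact ⟨h1, h2, by linarith⟩
  · exact ((measurable_slProj hB).inter (measurableSet_cone _)).nullMeasurableSet
  · rw [h2]
    exact ENNReal.mul_ne_top ENNReal.ofReal_ne_top hH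

lemma abs_sq_sub_one_le {t d x : ℝ} (ht : 0 < t) (htd : t ^ 3 * d = 1) (hx : x ≤ 1 / 4)
    (hd : |d - 1| ≤ x) : |t ^ 2 - 1| ≤ 2 * x := by
  have h1 : |t ^ 2 - 1| ≤ |t ^ 3 - 1| := by
    rcases le_total 1 t with h | h
    · rw [abs_of_nonneg (by nlinarith), abs_of_nonneg (by nlinarith [sq_nonneg t])]
      nlinarith [sq_nonneg t]
    · have h2 : t ^ 2 ≤ 1 := pow_le_one₀ ht.le h
      have h3 : t ^ 3 ≤ 1 := pow_le_one₀ ht.le h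
      rw [abs_of_nonpos (by linarith), abs_of_nonpos (by linarith)]
      nlinarith [sq_nonneg t]
  have hd' := abs_le.1 hd
  have hdpos : 3 / 4 ≤ d := by linarith
  have h2 : |t ^ 3 - 1| * d = |d - 1| := by
    rw [← abs_of_pos (show 0 < d by linarith), ← abs_mul, abs_of_pos (show 0 < d by linarith),
      sub_mul, htd, one_mul, abs_sub_comm]
  refine h1.trans ?_
  have h0 := abs_nonneg (t ^ 3 - 1)
  nlinarith

/-- Near the identity, quotients are controlled. -/
lemma exists_radius (r0 : SL3) {U : Set SL3} (hU : IsOpen U) (hr0 : r0 ∈ U) :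
    ∃ δ > 0, ∀ c ∈ Metric.closedBall (colsOf 1) δ, ∀ c0 ∈ Metric.closedBall (colsOf 1) δ,
      (∀ i j, |colMat c i j| ≤ 2) ∧ 1 / 2 < (colMat c0).det ∧ (colMat c0).det < 2 ∧
      ∃ K : Matrix (Fin 3) (Fin 3) ℝ, colMat c0 * K = 1 ∧ (∀ i j, |K i j| ≤ 2) ∧
        ∀ c', colMat c' = colMat c * K * r0.1 → slProj c' ∈ U := by
  set K : Cols → Matrix (Fin 3) (Fin 3) ℝ := fun c => (colMat c).det⁻¹ • (colMat c).adjugate with hK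
  have h1 : colMat (colsOf 1) = 1 := rfl
  have hd1 : (colMat (colsOf 1)).det = 1 := by rw [h1, Matrix.det_one]
  have hK1 : K (colsOf 1) = 1 := by simp [hK, h1]
  have hKc : ContinuousAt K (colsOf 1) := by
    refine ContinuousAt.smul (f := fun c : Cols => (colMat c).det⁻¹)
      (g := fun c : Cols => (colMat c).adjugate) ?_ ?_
    · exact (continuous_colMat.matrix_det.continuousAt).inv₀ (by rw [hd1]; norm_num)
    · exact continuous_colMat.matrix_adjugate.continuousAt
  have hKe (i j : Fin 3) : ContinuousAt (fun c => K c i j) (colsOf 1) := by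
    have : Continuous fun M : Matrix (Fin 3) (Fin 3) ℝ => M i j :=
      (continuous_apply j).comp (continuous_apply i)
    exact this.continuousAt.comp hKc
  set Φ : Cols × Cols → Cols := fun p j i => (colMat p.1 * K p.2 * r0.1) i j with hΦ
  have hΦc : ContinuousAt Φ (colsOf 1, colsOf 1) := by
    have hm : ContinuousAt (fun p : Cols × Cols => colMat p.1 * K p.2 * r0.1)
        (colsOf 1, colsOf 1) := by
      have a1 : ContinuousAt (fun p : Cols × Cols => colMat p.1) (colsOf 1, colsOf 1) :=
        (continuous_colMat.comp continuous_fst).continuousAt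
      have a2 : ContinuousAt (fun p : Cols × Cols => K p.2) (colsOf 1, colsOf 1) :=
        ContinuousAt.comp (f := Prod.snd) (g := K) hKc continuousAt_snd
      exact (a1.mul a2).mul continuousAt_const
    refine continuousAt_pi.2 fun j => continuousAt_pi.2 fun i => ?_
    have : Continuous fun M : Matrix (Fin 3) (Fin 3) ℝ => M i j :=
      (continuous_apply j).comp (continuous_apply i)
    exact this.continuousAt.comp hm
  have hΦ1 : Φ (colsOf 1, colsOf 1) = colsOf r0 := by
    ext j i
    simp [hΦ, hK1, h1, colsOf]
  have hP : ContinuousAt slProj (Φ (colsOf 1, colsOf 1)) := by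
    rw [hΦ1]
    refine continuousOn_slProj.continuousAt (isOpen_det_pos.mem_nhds ?_)
    change 0 < (colMat (colsOf r0)).det
    rw [colMat_colsOf, r0.2]; norm_num
  have e1 : ∀ᶠ p in 𝓝 (colsOf 1, colsOf 1), slProj (Φ p) ∈ U := by
    refine (ContinuousAt.comp (f := Φ) hP hΦc).eventually_mem (hU.mem_nhds ?_)
    change slProj (Φ (colsOf 1, colsOf 1)) ∈ U
    rwa [hΦ1, slProj_colsOf]
  have hone (i j : Fin 3) : |(1 : Matrix (Fin 3) (Fin 3) ℝ) i j| < 2 := by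
    by_cases h : i = j
    · subst h; simp
    · simp [h]
  have e2 : ∀ᶠ c in 𝓝 (colsOf 1), ∀ i j, |colMat c i j| < 2 := by
    refine eventually_all.2 fun i => eventually_all.2 fun j => ?_
    refine ((continuous_colMat.matrix_elem i j).abs.continuousAt).eventually_lt_const ?_
    exact hone i j
  have e3 : ∀ᶠ c in 𝓝 (colsOf 1), ∀ i j, |K c i j| < 2 := by
    refine eventually_all.2 fun i => eventually_all.2 fun j => ?_
    refine (hKe i j).abs.eventually_lt_const ?_
    change |K (colsOf 1) i j| < 2
    rw [hK1]
    exact hone i j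
  have e4 : ∀ᶠ c in 𝓝 (colsOf 1), (colMat c).det < 2 :=
    continuous_colMat.matrix_det.continuousAt.eventually_lt_const
      (by change (colMat (colsOf 1)).det < 2; rw [hd1]; norm_num)
  have e5 : ∀ᶠ c in 𝓝 (colsOf 1), 1 / 2 < (colMat c).det :=
    continuous_colMat.matrix_det.continuousAt.eventually_const_lt
      (by change 1 / 2 < (colMat (colsOf 1)).det; rw [hd1]; norm_num)
  have e6 := e1.and ((e2.prod_inl_nhds (colsOf 1)).and
    ((e3.and (e4.and e5)).prod_inr_nhds (colsOf 1)))
  obtain ⟨δ, hδ, hball⟩ := Metric.nhds_basis_closedBall.eventually_iff.1 e6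
  refine ⟨δ, hδ, fun c hc c0 hc0 => ?_⟩
  obtain ⟨g1, g2, g3, g4, g5⟩ := hball (show (c, c0) ∈ Metric.closedBall (colsOf 1, colsOf 1) δ by
    rw [← closedBall_prod_same]; exact ⟨hc, hc0⟩)
  refine ⟨fun i j => (g2 i j).le, g5, g4, K c0, ?_, fun i j => (g3 i j).le, fun c' hc' => ?_⟩
  · change colMat c0 * ((colMat c0).det⁻¹ • (colMat c0).adjugate) = 1
    have hne : (colMat c0).det ≠ 0 := by
      intro h
      change 1 / 2 < (colMat c0).det at g5
      rw [h] at g5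
      norm_num at g5
    rw [Matrix.mul_smul, Matrix.mul_adjugate, smul_smul, inv_mul_cancel₀ hne, one_smul]
  · have : c' = Φ (c, c0) := by
      ext j i
      exact congrFun (congrFun hc' i) j
    rw [this]
    exact g1

/-- The six positions on or above the diagonal. -/
def upperIdx : Fin 6 → Fin 3 × Fin 3 := ![(0, 0), (0, 1), (0, 2), (1, 1), (1, 2), (2, 2)]

lemma exists_upperIdx : ∀ i j : Fin 3, ∃ k, upperIdx k = (i, j) ∨ upperIdx k = (j, i) := by
  decide

lemma gram_symm (M : Matrix (Fin 3) (Fin 3) ℝ) (i j : Fin 3) :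
    (Mᵀ * Jmat * M) i j = (Mᵀ * Jmat * M) j i := by
  have : (Mᵀ * Jmat * M)ᵀ = Mᵀ * Jmat * M := by
    rw [Matrix.transpose_mul, Matrix.transpose_mul, Matrix.transpose_transpose, Jmat,
      Matrix.diagonal_transpose, Matrix.mul_assoc]
  exact congrFun (congrFun this j) i

lemma det_gram (M : Matrix (Fin 3) (Fin 3) ℝ) : (Mᵀ * Jmat * M).det = M.det ^ 2 := by
  rw [Matrix.det_mul, Matrix.det_mul, Matrix.det_transpose, Jmat, Matrix.det_diagonal,
    Fin.prod_univ_three]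
  simp
  ring

/-- Geometric part of the local volume estimate. -/
lemma gram_slProj_sub_le {N N0 K : Matrix (Fin 3) (Fin 3) ℝ} {r0 : SL3} {a η : ℝ} {c : Cols}
    (ha : ∀ i j, |r0.1 i j| ≤ a) (ha1 : 1 ≤ a) (hη : 0 < η) (hη1 : 93312 * η ≤ 1 / 4)
    (hN : ∀ i j, |N i j| ≤ 2) (hN0 : ∀ i j, |N0 i j| ≤ 2) (hdN : 1 / 2 < N.det)
    (hd0 : 1 / 2 < N0.det) (hK : N0 * K = 1) (hKb : ∀ i j, |K i j| ≤ 2)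
    (hc : colMat c = N * K * r0.1)
    (hG : ∀ i j, |(Nᵀ * Jmat * N) i j - (N0ᵀ * Jmat * N0) i j| ≤ η) :
    |(colMat c).det - 1| ≤ 93312 * η ∧ ∀ i j,
      |((slProj c).1ᵀ * Jmat * (slProj c).1 - r0.1ᵀ * Jmat * r0.1) i j| ≤ 1700000 * a ^ 2 * η := by
  have hdK : N0.det * K.det = 1 := by rw [← Matrix.det_mul, hK, Matrix.det_one]
  have hd : (colMat c).det = N.det * K.det := by
    rw [hc, Matrix.det_mul, Matrix.det_mul, r0.2, mul_one]
  have hKpos : 0 < K.det := by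
    by_contra! h
    nlinarith
  have hK2 : K.det ≤ 2 := by nlinarith
  have hdpos : 0 < (colMat c).det := by rw [hd]; positivity
  have hgb {M : Matrix (Fin 3) (Fin 3) ℝ} (hM : ∀ i j, |M i j| ≤ 2) (i j : Fin 3) :
      |(Mᵀ * Jmat * M) i j| ≤ 36 :=
    (abs_transpose_mul_mul_apply_le hM abs_Jmat_apply_le i j).trans_eq (by norm_num)
  have hdet := abs_det_sub_det_le (hgb hN) (hgb hN0) hG
  rw [det_gram, det_gram] at hdet
  have hd1 : |(colMat c).det - 1| ≤ 93312 * η := by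
    have e : (colMat c).det ^ 2 - 1 = (N.det ^ 2 - N0.det ^ 2) * K.det ^ 2 := by
      rw [hd]
      have : N0.det ^ 2 * K.det ^ 2 = 1 := by rw [← mul_pow, hdK, one_pow]
      linear_combination this
    have h1 : |(colMat c).det ^ 2 - 1| ≤ 23328 * η * 4 := by
      rw [e, abs_mul, abs_of_pos (show 0 < K.det ^ 2 by positivity)]
      have : K.det ^ 2 ≤ 4 := by nlinarith
      have h0 := abs_nonneg (N.det ^ 2 - N0.det ^ 2)
      exact mul_le_mul (by linarith) this (by positivity) (by positivity)
    have h2 : (colMat c).det ^ 2 - 1 = ((colMat c).det - 1) * ((colMat c).det + 1) := by ring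
    rw [h2, abs_mul, abs_of_pos (show 0 < (colMat c).det + 1 by linarith)] at h1
    have := abs_nonneg ((colMat c).det - 1)
    nlinarith
  refine ⟨hd1, fun i j => ?_⟩
  set t := (colMat c).det ^ (-(1 / 3) : ℝ) with ht
  have htpos : 0 < t := Real.rpow_pos_of_pos hdpos _
  have ht3 : t ^ 3 * (colMat c).det = 1 := by
    rw [ht, ← Real.rpow_natCast, ← Real.rpow_mul hdpos.le]
    norm_num
    rw [Real.rpow_neg_one, inv_mul_cancel₀ hdpos.ne']
  have ht2 := abs_sq_sub_one_le htpos ht3 hη1 hd1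
  have hkb (i j : Fin 3) : |(K * r0.1) i j| ≤ 6 * a :=
    (abs_mul_apply_le hKb ha i j).trans_eq (by ring)
  have hcc : colMat c = N * (K * r0.1) := by rw [hc, Matrix.mul_assoc]
  have hξ : r0.1ᵀ * Jmat * r0.1 = (K * r0.1)ᵀ * (N0ᵀ * Jmat * N0) * (K * r0.1) := by
    have : N0 * (K * r0.1) = r0.1 := by rw [← Matrix.mul_assoc, hK, Matrix.one_mul]
    have h2 : (K * r0.1)ᵀ * N0ᵀ = r0.1ᵀ := by rw [← Matrix.transpose_mul, this]
    calc r0.1ᵀ * Jmat * r0.1 = ((K * r0.1)ᵀ * N0ᵀ) * Jmat * (N0 * (K * r0.1)) := by rw [this, h2]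
      _ = _ := by simp only [Matrix.mul_assoc]
  have hMG : (colMat c)ᵀ * Jmat * colMat c - r0.1ᵀ * Jmat * r0.1
      = (K * r0.1)ᵀ * (Nᵀ * Jmat * N - N0ᵀ * Jmat * N0) * (K * r0.1) := by
    rw [hξ, hcc, Matrix.transpose_mul, Matrix.mul_sub, Matrix.sub_mul]
    simp only [Matrix.mul_assoc]
  have hM (i j) : |((colMat c)ᵀ * Jmat * colMat c - r0.1ᵀ * Jmat * r0.1) i j|
      ≤ 324 * a ^ 2 * η := by
    rw [hMG]
    exact (abs_transpose_mul_mul_apply_le hkb hG i j).trans_eq (by ring)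
  have hξb : |(r0.1ᵀ * Jmat * r0.1) i j| ≤ 9 * a ^ 2 :=
    (abs_transpose_mul_mul_apply_le ha abs_Jmat_apply_le i j).trans_eq (by ring)
  have hfin : (slProj c).1ᵀ * Jmat * (slProj c).1 - r0.1ᵀ * Jmat * r0.1
      = t ^ 2 • ((colMat c)ᵀ * Jmat * colMat c - r0.1ᵀ * Jmat * r0.1)
        + (t ^ 2 - 1) • (r0.1ᵀ * Jmat * r0.1) := by
    rw [slProj_coe hdpos, ← ht, Matrix.transpose_smul, Matrix.smul_mul, Matrix.smul_mul,
      Matrix.mul_smul, smul_smul, smul_sub, sub_smul, one_smul, sq]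
    abel
  rw [hfin, Matrix.add_apply, Matrix.smul_apply, Matrix.smul_apply, smul_eq_mul, smul_eq_mul]
  have ht2' : t ^ 2 ≤ 2 := by
    have := (abs_le.1 ht2).2
    linarith
  calc _ ≤ |t ^ 2 * ((colMat c)ᵀ * Jmat * colMat c - r0.1ᵀ * Jmat * r0.1) i j|
        + |(t ^ 2 - 1) * (r0.1ᵀ * Jmat * r0.1) i j| := abs_add_le _ _
    _ ≤ 2 * (324 * a ^ 2 * η) + 2 * (93312 * η) * (9 * a ^ 2) := by
        rw [abs_mul, abs_mul, abs_of_pos (show 0 < t ^ 2 by positivity)]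
        gcongr
        exact hM i j
    _ ≤ _ := by nlinarith [mul_pos (show 0 < a ^ 2 by positivity) hη]

/-- The Haar measure of the set of frames near `r0` whose Gram matrix is `ε`-close to that of `r0`
is at least of order `ε ^ 5`. -/
theorem exists_haarSL_gram_ge (r0 : SL3) {U : Set SL3} (hU : IsOpen U) (hr0 : r0 ∈ U) :
    ∃ C > 0, ∃ ε₁ > 0, ∀ ε : ℝ, 0 < ε → ε < ε₁ → ENNReal.ofReal (C * ε ^ 5) ≤
      haarSL {r | r ∈ U ∧ ∀ i j, |(r.1ᵀ * Jmat * r.1 - r0.1ᵀ * Jmat * r0.1) i j| < ε} := by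
  obtain ⟨δ, hδ, hrad⟩ := exists_radius r0 hU hr0
  set W := Metric.closedBall (colsOf 1) δ with hW
  have hWm : MeasurableSet W := Metric.isClosed_closedBall.measurableSet
  have hWfin : volume W ≠ ∞ := (isCompact_closedBall _ _).measure_lt_top.ne
  have hWpos : 0 < volume.real W :=
    ENNReal.toReal_pos (Metric.measure_closedBall_pos _ _ hδ).ne' hWfin
  obtain ⟨a, ha1, ha⟩ : ∃ a : ℝ, 1 ≤ a ∧ ∀ i j, |r0.1 i j| ≤ a := by
    refine ⟨1 + ∑ i, ∑ j, |r0.1 i j|, ?_, fun i j => ?_⟩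
    · have : 0 ≤ ∑ i, ∑ j, |r0.1 i j| :=
        Finset.sum_nonneg fun i _ => Finset.sum_nonneg fun j _ => abs_nonneg _
      linarith
    · have h1 := Finset.single_le_sum (f := fun j => |r0.1 i j|) (fun j _ => abs_nonneg _)
        (Finset.mem_univ j)
      have h2 := Finset.single_le_sum (f := fun i => ∑ j, |r0.1 i j|)
        (fun i _ => Finset.sum_nonneg fun j _ => abs_nonneg _) (Finset.mem_univ i)
      linarith
  set w := volume.real W with hw
  set T : Cols → Fin 6 → ℝ := fun c k =>
    ((colMat c)ᵀ * Jmat * colMat c) (upperIdx k).1 (upperIdx k).2 with hT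
  have hTm : Measurable T := by
    refine measurable_pi_lambda _ fun k => Continuous.measurable ?_
    exact (((continuous_colMat.matrix_transpose).mul continuous_const).mul
      continuous_colMat).matrix_elem _ _
  have hTb : ∀ c ∈ W, ∀ k, |T c k| ≤ 36 := fun c hc k =>
    (abs_transpose_mul_mul_apply_le (hrad c hc c hc).1 abs_Jmat_apply_le _ _).trans_eq
      (by norm_num)
  set b : ℝ := 2000000 * a ^ 2 with hb
  have hbpos : 2000000 ≤ b := by nlinarith
  refine ⟨w / ((4 * 36) ^ 6 * 8 * 16 * 93312 * b ^ 5), by positivity, 1, one_pos,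
    fun ε hε hε1 => ?_⟩
  set η := ε / b with hη
  have hηpos : 0 < η := by positivity
  have hηb : η * b = ε := by rw [hη]; field_simp
  have hη1 : 93312 * η ≤ 1 / 4 := by nlinarith
  obtain ⟨S, hSW, hSm, hSG, hSvol⟩ := exists_large_cell volume hWm hWfin hTm (R := 36)
    (by norm_num) hηpos (by linarith) hTb
  obtain ⟨c0, hc0⟩ : S.Nonempty := by
    by_contra h
    rw [Set.not_nonempty_iff_eq_empty] at h
    rw [h] at hSvol
    simp at hSvol
    linarith
  set B : Set SL3 := {r | r ∈ U ∧ ∀ i j, |(r.1ᵀ * Jmat * r.1 - r0.1ᵀ * Jmat * r0.1) i j| < ε}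
    with hB
  have hBm : MeasurableSet B := by
    have : B = U ∩ ⋂ i, ⋂ j,
        {r | |(r.1ᵀ * Jmat * r.1 - r0.1ᵀ * Jmat * r0.1) i j| < ε} := by
      ext r; simp [hB]
    rw [this]
    refine (hU.inter (isOpen_iInter_of_finite fun i => isOpen_iInter_of_finite fun j =>
      ?_)).measurableSet
    exact isOpen_lt (((((SL3.continuous_val.matrix_transpose).mul continuous_const).mul
      SL3.continuous_val).sub continuous_const).matrix_elem i j).abs continuous_const
  set h : Matrix (Fin 3) (Fin 3) ℝ := (r0⁻¹).1 * colMat c0 with hh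
  have hdh : h.det = (colMat c0).det := by rw [hh, Matrix.det_mul, (r0⁻¹).2, one_mul]
  obtain ⟨-, hd01, hd02, -⟩ := hrad c0 (hSW hc0) c0 (hSW hc0)
  have hdet : LinearMap.det (rmul h) ≠ 0 := by
    rw [det_rmul, hdh]; positivity
  set S' := rmul h ⁻¹' S with hS'
  have hvol : volume S' = ENNReal.ofReal |((colMat c0).det ^ 3)⁻¹| * volume S := by
    rw [hS', Measure.addHaar_preimage_linearMap _ hdet, det_rmul, hdh]
  have hgood : ∀ c ∈ S', slProj c ∈ B ∧ |(colMat c).det - 1| ≤ 93312 * η := by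
    intro c hc
    obtain ⟨hNb, -, -, K, hK, hKb, hKU⟩ := hrad _ (hSW hc) c0 (hSW hc0)
    have hcN : colMat (rmul h c) = colMat c * h := colMat_rmul h c
    have hceq : colMat c = colMat (rmul h c) * K * r0.1 := by
      have e : (r0⁻¹).1 * r0.1 = 1 := by
        rw [← Matrix.SpecialLinearGroup.coe_mul, inv_mul_cancel, Matrix.SpecialLinearGroup.coe_one]
      have : colMat (rmul h c) * K * r0.1
          = colMat c * ((r0⁻¹).1 * ((colMat c0 * K) * r0.1)) := by
        rw [hcN, hh]; simp only [Matrix.mul_assoc]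
      rw [this, hK, Matrix.one_mul, e, Matrix.mul_one]
    have hG (i j : Fin 3) : |((colMat (rmul h c))ᵀ * Jmat * colMat (rmul h c)) i j
        - ((colMat c0)ᵀ * Jmat * colMat c0) i j| ≤ η := by
      obtain ⟨k, hk | hk⟩ := exists_upperIdx i j
      · have := hSG _ hc c0 hc0 k
        simpa only [hT, hk] using this
      · have := hSG _ hc c0 hc0 k
        rw [gram_symm _ i j, gram_symm (colMat c0) i j]
        simpa only [hT, hk] using this
    obtain ⟨k1, k2⟩ := gram_slProj_sub_le ha ha1 hηpos hη1 hNb (hrad c0 (hSW hc0) c0 (hSW hc0)).1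
      (hrad c0 (hSW hc0) _ (hSW hc)).2.1 hd01 hK hKb hceq hG
    refine ⟨⟨hKU c hceq, fun i j => (k2 i j).trans_lt ?_⟩, k1⟩
    rw [← hηb, hb]
    nlinarith [mul_pos (show 0 < a ^ 2 by positivity) hηpos]
  have hshell := volume_shell_le hBm (S := S') (x := 93312 * η) (by positivity) hη1
    (fun c hc => (hgood c hc).1) (fun c hc => (hgood c hc).2)
  have hSfin : volume S ≠ ∞ := ((measure_mono hSW).trans_lt (lt_top_iff_ne_top.2 hWfin)).ne
  have hlow : ENNReal.ofReal (w / ((4 * 36 / η) ^ 6 * 8)) ≤ volume S' := by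
    rw [hvol, ← ENNReal.ofReal_toReal hSfin, ← ENNReal.ofReal_mul (abs_nonneg _)]
    refine ENNReal.ofReal_le_ofReal ?_
    change w / _ ≤ _ * volume.real S
    have h3 : (colMat c0).det ^ 3 ≤ 2 ^ 3 := by gcongr
    have h4 : (8 : ℝ)⁻¹ ≤ ((colMat c0).det ^ 3)⁻¹ := by
      rw [inv_le_inv₀ (by norm_num) (by positivity)]
      linarith
    rw [abs_of_pos (by positivity), div_le_iff₀ (by positivity)]
    calc w ≤ (4 * 36 / η) ^ 6 * volume.real S := hSvol
      _ = 8⁻¹ * volume.real S * ((4 * 36 / η) ^ 6 * 8) := by ring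
      _ ≤ _ := by gcongr
  have hcomb := hlow.trans hshell
  have hx : 0 < 16 * (93312 * η) := by positivity
  have hid : w / ((4 * 36 / η) ^ 6 * 8) = 16 * (93312 * η) *
      (w / ((4 * 36) ^ 6 * 8 * 16 * 93312 * b ^ 5) * ε ^ 5) := by
    rw [← hηb]
    field_simp
  rw [hid, ENNReal.ofReal_mul hx.le] at hcomb
  exact (ENNReal.mul_le_mul_iff_right (by simpa using hηpos) ENNReal.ofReal_ne_top).1 hcomb

end LocalVolume

section Density

open scoped ENNReal

lemma abs_rot_apply_le (x : ℝ) (i j : Fin 3) : |(rot x).1 i j| ≤ 1 := by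
  have h1 := Real.abs_cos_le_one x
  have h2 := Real.abs_sin_le_one x
  rw [rot_coe]
  fin_cases i <;> fin_cases j <;> simp [h1, h2]

lemma abs_boost_apply_le {s : ℝ} (hs : 0 ≤ s) (i j : Fin 3) : |(boost s).1 i j| ≤ Real.exp s := by
  have h0 : 1 ≤ Real.exp s := Real.one_le_exp hs
  have h1 : |Real.cosh s| ≤ Real.exp s := by
    rw [abs_of_pos (Real.cosh_pos s), Real.cosh_eq]
    have : Real.exp (-s) ≤ Real.exp s := Real.exp_le_exp.2 (by linarith)
    linarith
  have h2 : |Real.sinh s| ≤ Real.exp s := by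
    rw [abs_of_nonneg (Real.sinh_nonneg_iff.2 hs), Real.sinh_eq]
    have := Real.exp_pos (-s)
    linarith
  rw [boost_coe]
  fin_cases i <;> fin_cases j <;> simp [h0, h1, h2, Real.exp_nonneg]

lemma abs_theta_apply_le {s : ℝ} (hs : 0 ≤ s) (p : ℝ × ℝ) (i j : Fin 3) :
    |(theta s p).1 i j| ≤ 9 * Real.exp s := by
  have := abs_mul_apply_le (abs_mul_apply_le (abs_rot_apply_le p.1) (abs_boost_apply_le hs))
    (abs_rot_apply_le p.2) i j
  refine le_trans this (le_of_eq ?_)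
  ring

/-- The frames in `U` whose Gram matrix is `ε`-close to that of `r0`. -/
def nearGram (r0 : SL3) (U : Set SL3) (ε : ℝ) : Set SL3 :=
  {r | r ∈ U ∧ ∀ i j, |(r.1ᵀ * Jmat * r.1 - r0.1ᵀ * Jmat * r0.1) i j| < ε}

lemma isOpen_nearGram (r0 : SL3) {U : Set SL3} (hU : IsOpen U) (ε : ℝ) :
    IsOpen (nearGram r0 U ε) := by
  have : nearGram r0 U ε = U ∩ ⋂ i, ⋂ j,
      {r | |(r.1ᵀ * Jmat * r.1 - r0.1ᵀ * Jmat * r0.1) i j| < ε} := by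
    ext r; simp [nearGram]
  rw [this]
  refine hU.inter (isOpen_iInter_of_finite fun i => isOpen_iInter_of_finite fun j => ?_)
  exact isOpen_lt (((((SL3.continuous_val.matrix_transpose).mul continuous_const).mul
    SL3.continuous_val).sub continuous_const).matrix_elem i j).abs continuous_const

/-- The points not reached from `A` by elements `theta s p`. -/
def missed (s : ℝ) (A : Set SL3) : Set (SL3 ⧸ Gam) :=
  {x | ∀ p, ∀ r ∈ A, theta s p • (QuotientGroup.mk r : SL3 ⧸ Gam) ≠ x}

lemma isClosed_missed (s : ℝ) {A : Set SL3} (hA : IsOpen A) : IsClosed (missed s A) := by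
  have : missed s A = (⋃ p, (fun x : SL3 ⧸ Gam => theta s p • x) ''
      ((QuotientGroup.mk : SL3 → SL3 ⧸ Gam) '' A))ᶜ := by
    ext x
    simp [missed]
  rw [this, isClosed_compl_iff]
  exact isOpen_iUnion fun p => isOpenMap_smul _ _ (QuotientGroup.isOpenMap_coe A hA)

lemma ae_eventually_notMem_missed {κ : ℝ} (hκ : 5 < κ) (r0 : SL3) {U : Set SL3} (hU : IsOpen U)
    (hr0 : r0 ∈ U) (hinj : ∀ x ∈ U, ∀ y ∈ U, x⁻¹ * y ∈ smallNhd) :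
    ∀ᵐ x ∂quotMeas, ∀ᶠ k : ℕ in atTop,
      x ∉ missed (κ * (k * Real.log 2)) (nearGram r0 U ((1 / 2) ^ k)) := by
  obtain ⟨σ, hσ1, hσ2⟩ : ∃ σ, 5 / (2 * κ) < σ ∧ σ < 1 / 2 := by
    refine exists_between ?_
    rw [div_lt_div_iff₀ (by linarith) (by norm_num)]
    linarith
  have hσ0 : 0 < σ := lt_trans (by positivity) hσ1
  rw [div_lt_iff₀ (by linarith)] at hσ1
  obtain ⟨C, hC, ε₁, hε₁, hvol⟩ := exists_haarSL_gram_ge r0 hU hr0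
  obtain ⟨D, hD, hlam⟩ := exists_lam_le hσ0 hσ2
  set V := haarSL.real fundDom with hV
  have hV0 : 0 ≤ V := measureReal_nonneg
  set q : ℝ := (1 / 2) ^ (2 * σ * κ - 5) with hq
  have hq0 : 0 < q := by positivity
  have hq1 : q < 1 := Real.rpow_lt_one (by norm_num) (by norm_num) (by linarith)
  have hlim : ∀ᶠ k : ℕ in atTop, ((1 : ℝ) / 2) ^ k < ε₁ :=
    (tendsto_pow_atTop_nhds_zero_of_lt_one (by norm_num) (by norm_num)).eventually_lt_const hε₁
  obtain ⟨n, hn⟩ := eventually_atTop.1 hlim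
  set E : ℕ → Set (SL3 ⧸ Gam) := fun k =>
    missed (κ * (k * Real.log 2)) (nearGram r0 U ((1 / 2) ^ k)) with hE
  have hbound (k : ℕ) (hk : n ≤ k) : quotMeas.real (E k) ≤ V * D ^ 2 / C * q ^ k := by
    set ε : ℝ := (1 / 2) ^ k with hε
    have hεpos : 0 < ε := by positivity
    set s := κ * (k * Real.log 2) with hs
    have hs0 : 0 ≤ s := by
      have := Real.log_pos (show (1 : ℝ) < 2 by norm_num)
      positivity
    have hA := isOpen_nearGram r0 hU ε
    have hAinj : ∀ x ∈ nearGram r0 U ε, ∀ y ∈ nearGram r0 U ε, x⁻¹ * y ∈ smallNhd :=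
      fun x hx y hy => hinj x hx.1 y hy.1
    have key := haarSL_mul_measure_le hσ0 hσ2 s hA hAinj (isClosed_missed s hA).measurableSet
      (fun p r hr h => h p r hr rfl)
    have hfin : haarSL (nearGram r0 U ε) ≠ ∞ :=
      ((haarSL_le_measure_inter hA.measurableSet hAinj).trans_lt
        ((measure_mono Set.inter_subset_right).trans_lt haarSL_fundDom_lt_top)).ne
    have hlow : C * ε ^ 5 ≤ haarSL.real (nearGram r0 U ε) :=
      (ENNReal.ofReal_le_iff_le_toReal hfin).1 (hvol ε hεpos (hn k hk))
    have hl : lam σ s ^ 2 ≤ D ^ 2 * (ε ^ 5 * q ^ k) := by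
      have h1 := hlam s hs0
      have h2 : lam σ s ^ 2 ≤ (D * Real.exp (-(σ * s))) ^ 2 := by
        have := (lam_pos σ s).le
        gcongr
      refine h2.trans (le_of_eq ?_)
      rw [mul_pow]
      congr 1
      rw [hq, hε, ← Real.rpow_natCast, ← Real.rpow_natCast, ← Real.rpow_natCast,
        ← Real.rpow_natCast, ← Real.exp_mul, ← Real.rpow_mul (by norm_num),
        ← Real.rpow_mul (by norm_num), ← Real.rpow_add (by norm_num),
        Real.rpow_def_of_pos (by norm_num), hs,
        show (1 : ℝ) / 2 = 2⁻¹ by norm_num, Real.log_inv]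
      congr 1
      push_cast
      ring
    have hm0 : 0 ≤ quotMeas.real (E k) := measureReal_nonneg
    have hCε : 0 < C * ε ^ 5 := by positivity
    have h3 : C * ε ^ 5 * quotMeas.real (E k) ≤ C * ε ^ 5 * (V * D ^ 2 / C * q ^ k) := by
      calc C * ε ^ 5 * quotMeas.real (E k)
          ≤ haarSL.real (nearGram r0 U ε) * quotMeas.real (E k) := by gcongr
        _ ≤ V * lam σ s ^ 2 := key
        _ ≤ V * (D ^ 2 * (ε ^ 5 * q ^ k)) := by gcongr
        _ = _ := by field_simp
    exact le_of_mul_le_mul_left h3 hCε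
  have hsum : ∑' k, quotMeas (E (k + n)) ≠ ∞ := by
    have hg : Summable fun k : ℕ => V * D ^ 2 / C * q ^ (k + n) := by
      refine Summable.mul_left _ ?_
      exact (summable_nat_add_iff n).2 (summable_geometric_of_lt_one hq0.le hq1)
    refine ne_top_of_le_ne_top hg.tsum_ofReal_ne_top (ENNReal.tsum_le_tsum fun k => ?_)
    rw [← ofReal_measureReal]
    exact ENNReal.ofReal_le_ofReal (hbound (k + n) (by omega))
  filter_upwards [ae_eventually_notMem hsum] with x hx
  obtain ⟨N, hN⟩ := eventually_atTop.1 hx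
  refine eventually_atTop.2 ⟨N + n, fun k hk => ?_⟩
  have := hN (k - n) (by omega)
  rwa [Nat.sub_add_cancel (by omega)] at this

lemma exists_gram_eq {ξ : Matrix (Fin 3) (Fin 3) ℝ} (hdet : ξ.det = 1)
    (hsig : ∃ P : Matrix (Fin 3) (Fin 3) ℝ, IsUnit P.det ∧ Pᵀ * ξ * P = Jmat) :
    ∃ r0 : SL3, r0.1ᵀ * Jmat * r0.1 = ξ := by
  obtain ⟨P, hP, hPξ⟩ := hsig
  have hJ : Jmat.det = 1 := by
    have := det_gram 1
    simpa using this
  have hP2 : P.det ^ 2 = 1 := by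
    have := congrArg Matrix.det hPξ
    rw [Matrix.det_mul, Matrix.det_mul, Matrix.det_transpose, hdet, hJ] at this
    linarith
  have hinv : P * P⁻¹ = 1 := Matrix.mul_nonsing_inv P hP
  have hgram : (P⁻¹)ᵀ * Jmat * P⁻¹ = ξ := by
    have h2 : (P⁻¹)ᵀ * Pᵀ = 1 := by rw [← Matrix.transpose_mul, hinv, Matrix.transpose_one]
    calc (P⁻¹)ᵀ * Jmat * P⁻¹ = ((P⁻¹)ᵀ * Pᵀ) * ξ * (P * P⁻¹) := by
          rw [← hPξ]; simp only [Matrix.mul_assoc]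
      _ = ξ := by rw [h2, hinv, Matrix.one_mul, Matrix.mul_one]
  have hd : P⁻¹.det * P.det = 1 := by
    rw [← Matrix.det_mul, Matrix.nonsing_inv_mul P hP, Matrix.det_one]
  rcases eq_or_eq_neg_of_sq_eq_sq P.det 1 (by rw [hP2, one_pow]) with h | h
  · exact ⟨⟨P⁻¹, by rw [h] at hd; linarith⟩, hgram⟩
  · refine ⟨⟨-P⁻¹, by rw [Matrix.det_neg, Fintype.card_fin]; rw [h] at hd; linarith⟩, ?_⟩
    change (-P⁻¹)ᵀ * Jmat * (-P⁻¹) = ξ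
    rw [Matrix.transpose_neg, Matrix.neg_mul, Matrix.neg_mul, Matrix.mul_neg, neg_neg, hgram]

/-- A bounded injectivity neighbourhood. -/
lemma exists_bounded_injective_nhd (r0 : SL3) : ∃ U : Set SL3, IsOpen U ∧ r0 ∈ U ∧
    (∀ x ∈ U, ∀ y ∈ U, x⁻¹ * y ∈ smallNhd) ∧ ∃ a : ℝ, ∀ r ∈ U, ∀ i j, |r.1 i j| ≤ a := by
  obtain ⟨U, hU, hr0, hinj⟩ := exists_injective_nhd r0
  obtain ⟨K, hK, hrK, hKU⟩ := exists_compact_subset hU hr0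
  refine ⟨interior K, isOpen_interior, hrK,
    fun x hx y hy => hinj x (hKU (interior_subset hx)) y (hKU (interior_subset hy)), ?_⟩
  have hc : Continuous fun r : SL3 => ∑ i, ∑ j, |r.1 i j| :=
    continuous_finsetSum _ fun i _ => continuous_finsetSum _ fun j _ =>
      (SL3.continuous_val.matrix_elem i j).abs
  obtain ⟨a, ha⟩ := hK.bddAbove_image hc.continuousOn
  refine ⟨a, fun r hr i j => le_trans ?_ (ha (Set.mem_image_of_mem _ (interior_subset hr)))⟩
  have h1 := Finset.single_le_sum (f := fun j => |r.1 i j|) (fun j _ => abs_nonneg _)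
    (Finset.mem_univ j)
  have h2 := Finset.single_le_sum (f := fun i => ∑ j, |r.1 i j|)
    (fun i _ => Finset.sum_nonneg fun j _ => abs_nonneg _) (Finset.mem_univ i)
  exact h1.trans h2

/-- A point of the quotient that is hit yields an integral unimodular frame. -/
lemma exists_integral_frame {g : SL3} {r0 : SL3} {U : Set SL3} {s ε : ℝ}
    (hg : (QuotientGroup.mk g⁻¹ : SL3 ⧸ Gam) ∉ missed s (nearGram r0 U ε)) :
    ∃ γ : Matrix.SpecialLinearGroup (Fin 3) ℤ, ∃ p, ∃ r ∈ nearGram r0 U ε,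
      (γ : Matrix (Fin 3) (Fin 3) ℤ).map (fun a => (a : ℝ)) = g.1 * ((theta s p).1 * r.1) ∧
      (g.1 * ((theta s p).1 * r.1))ᵀ * ((g⁻¹).1ᵀ * Jmat * (g⁻¹).1) * (g.1 * ((theta s p).1 * r.1))
        = r.1ᵀ * Jmat * r.1 := by
  simp only [missed, Set.mem_ofPred_eq, not_forall, not_not] at hg
  obtain ⟨p, r, hr, h⟩ := hg
  have hmem : (theta s p * r)⁻¹ * g⁻¹ ∈ Gam := QuotientGroup.eq.1 h
  rw [← _root_.mul_inv_rev] at hmem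
  obtain ⟨γ, hγ⟩ := inv_mem_iff.1 hmem
  have hγ' : (γ : Matrix (Fin 3) (Fin 3) ℤ).map (fun a => (a : ℝ)) = g.1 * ((theta s p).1 * r.1) :=
    congrArg Subtype.val hγ
  refine ⟨γ, p, r, hr, hγ', ?_⟩
  have hinv : (g⁻¹).1 * g.1 = 1 := by
    rw [← Matrix.SpecialLinearGroup.coe_mul, inv_mul_cancel, Matrix.SpecialLinearGroup.coe_one]
  have hinv' : g.1ᵀ * (g⁻¹).1ᵀ = 1 := by
    rw [← Matrix.transpose_mul, hinv, Matrix.transpose_one]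
  have hJ := (mem_SO21.1 (theta_mem s p)).1
  calc _ = r.1ᵀ * (((theta s p).1)ᵀ * (g.1ᵀ * (g⁻¹).1ᵀ) * Jmat * ((g⁻¹).1 * g.1) *
        (theta s p).1) * r.1 := by
        rw [Matrix.transpose_mul, Matrix.transpose_mul]
        simp only [Matrix.mul_assoc]
    _ = r.1ᵀ * Jmat * r.1 := by rw [hinv, hinv', Matrix.mul_one, Matrix.mul_one, hJ]

end Density

lemma half_pow_rpow_eq_exp (κ : ℝ) (k : ℕ) :
    Real.exp (κ * (k * Real.log 2)) = (((1 : ℝ) / 2) ^ k) ^ (-κ) := by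
  rw [Real.rpow_def_of_pos (by positivity), Real.log_pow, one_div, Real.log_inv]
  congr 1
  ring

/-- Passing from the dyadic scales to all small scales costs only a constant factor, which is
absorbed by enlarging the exponent. -/
lemma exists_dyadic_scale {κ κ' : ℝ} (h0 : 0 < κ') (h : κ' < κ) (C : ℝ) (n₀ : ℕ) :
    ∃ ε₀ > 0, ∀ ε : ℝ, 0 < ε → ε < ε₀ → ∃ k ≥ n₀, ((1 : ℝ) / 2) ^ k < ε ∧
      C * Real.exp (κ' * (k * Real.log 2)) < ε ^ (-κ) := by
  have ht := (tendsto_rpow_neg_nhdsGT_zero (y := κ' - κ) (by linarith)).eventually_gt_atTop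
    (|C| * 2 ^ κ')
  obtain ⟨δ, hδ, hlt⟩ := mem_nhdsGT_iff_exists_Ioo_subset.1 ht
  have hδ' : (0 : ℝ) < δ := hδ
  refine ⟨min δ (min 1 ((1 / 2) ^ n₀)), by positivity, fun ε hε hε₀ => ?_⟩
  obtain ⟨hεδ, hε1, hεn⟩ : ε < δ ∧ ε < 1 ∧ ε < (1 / 2) ^ n₀ := by
    simpa only [lt_min_iff] using hε₀
  obtain ⟨n, hn1, hn2⟩ := exists_nat_pow_near_of_lt_one hε hε1.le (y := (1 / 2 : ℝ))
    (by norm_num) (by norm_num)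
  have hk : n₀ < n + 1 :=
    (pow_lt_pow_iff_right_of_lt_one₀ (by norm_num) (by norm_num)).1 (hn1.trans hεn)
  refine ⟨n + 1, hk.le, hn1, ?_⟩
  have hgt : |C| * 2 ^ κ' < ε ^ (κ' - κ) := hlt ⟨hε, hεδ⟩
  rw [half_pow_rpow_eq_exp]
  have h1 : (((1 : ℝ) / 2) ^ (n + 1)) ^ (-κ') ≤ (ε / 2) ^ (-κ') := by
    refine Real.rpow_le_rpow_of_nonpos (by positivity) ?_ (by linarith)
    rw [pow_succ]
    linarith
  have h2 : (ε / 2) ^ (-κ') = 2 ^ κ' * ε ^ (-κ') := by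
    rw [Real.div_rpow hε.le (by norm_num), Real.rpow_neg (by norm_num : (0 : ℝ) ≤ 2)]
    field_simp
  calc C * (((1 : ℝ) / 2) ^ (n + 1)) ^ (-κ') ≤ |C| * (2 ^ κ' * ε ^ (-κ')) := by
        rw [← h2]
        gcongr
        exact le_abs_self C
    _ = |C| * 2 ^ κ' * ε ^ (-κ') := by ring
    _ < ε ^ (κ' - κ) * ε ^ (-κ') := by
        have := Real.rpow_pos_of_pos hε (-κ')
        gcongr
    _ = ε ^ (-κ) := by
        rw [← Real.rpow_add hε]
        congr 1
        ring

lemma measurableSet_eventually_notMem {α : Type*} [MeasurableSpace α] {E : ℕ → Set α}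
    (hE : ∀ k, MeasurableSet (E k)) : MeasurableSet {x | ∀ᶠ k in atTop, x ∉ E k} := by
  have : {x | ∀ᶠ k in atTop, x ∉ E k} = ⋃ n, ⋂ k ≥ n, (E k)ᶜ := by
    ext x
    simp [eventually_atTop]
  rw [this]
  exact MeasurableSet.iUnion fun n => MeasurableSet.iInter fun k =>
    MeasurableSet.iInter fun _ => (hE k).compl

lemma ae_haarSL_eventually_notMem_missed {κ : ℝ} (hκ : 5 < κ) (r0 : SL3) {U : Set SL3}
    (hU : IsOpen U) (hr0 : r0 ∈ U) (hinj : ∀ x ∈ U, ∀ y ∈ U, x⁻¹ * y ∈ smallNhd) :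
    ∀ᵐ g ∂haarSL, ∀ᶠ k : ℕ in atTop, (QuotientGroup.mk g⁻¹ : SL3 ⧸ Gam) ∉
      missed (κ * (k * Real.log 2)) (nearGram r0 U ((1 / 2) ^ k)) := by
  have h := (ae_quotMeas_iff (measurableSet_eventually_notMem fun k : ℕ =>
    (isClosed_missed (κ * (k * Real.log 2))
      (isOpen_nearGram r0 hU ((1 / 2) ^ k))).measurableSet)).1
    (ae_eventually_notMem_missed hκ r0 hU hr0 hinj)
  exact (quasiMeasurePreserving_inv haarSL).ae h

/-- **Theorem 4 (Gram-matrix map, optimal density).**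
Let `κ > 5`, `J = diag(−1,−1,1)`, and let `ξ` be a real symmetric `3×3` matrix of determinant
one and signature `(2,1)` (i.e. congruent to `J`).  Then for Haar-almost every `g ∈ SL(3,ℝ)`,
with `J_Q = (g⁻¹)ᵀ J g⁻¹`, there is `ε₀ > 0` such that for every `ε ∈ (0,ε₀)` there is
`γ ∈ SL(3,ℤ)` with `‖γᵀ J_Q γ − ξ‖ < ε` and `‖γ‖ < ε^(−κ)`. -/
theorem gram_matrix_map_optimal_density
    (κ : ℝ) (hκ : 5 < κ)
    (ξ : Matrix (Fin 3) (Fin 3) ℝ) (hξsymm : ξ.IsSymm) (hξdet : ξ.det = 1)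
    (hξsig : ∃ P : Matrix (Fin 3) (Fin 3) ℝ, IsUnit P.det ∧ Pᵀ * ξ * P = Jmat)
    (μ : Measure (Matrix.SpecialLinearGroup (Fin 3) ℝ)) [μ.IsHaarMeasure] :
    ∀ᵐ g ∂μ,
      (let JQ : Matrix (Fin 3) (Fin 3) ℝ :=
        ((g⁻¹ : Matrix.SpecialLinearGroup (Fin 3) ℝ) : Matrix (Fin 3) (Fin 3) ℝ)ᵀ * Jmat *
          ((g⁻¹ : Matrix.SpecialLinearGroup (Fin 3) ℝ) : Matrix (Fin 3) (Fin 3) ℝ)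
      ∃ ε₀ > 0, ∀ ε : ℝ, 0 < ε → ε < ε₀ →
        ∃ γ : Matrix.SpecialLinearGroup (Fin 3) ℤ,
          (let c : Matrix (Fin 3) (Fin 3) ℝ :=
            ((γ : Matrix (Fin 3) (Fin 3) ℤ)).map fun a => (a : ℝ)
          ‖fun i j => (cᵀ * JQ * c - ξ) i j‖ < ε ∧
          ‖fun i j => c i j‖ < ε ^ (-κ))) := by
  obtain ⟨r0, rfl⟩ := exists_gram_eq hξdet hξsig
  obtain ⟨U, hU, hr0, hinj, a, ha⟩ := exists_bounded_injective_nhd r0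
  have hκ' : 5 < (5 + κ) / 2 := by linarith
  have hae := (Measure.absolutelyContinuous_isHaarMeasure μ haarSL).ae_le
    (ae_haarSL_eventually_notMem_missed hκ' r0 hU hr0 hinj)
  filter_upwards [hae] with g hg
  obtain ⟨n₀, hn₀⟩ := eventually_atTop.1 hg
  set b : ℝ := ∑ i, ∑ j, |g.1 i j|
  have hb : ∀ i j, |g.1 i j| ≤ b := fun i j =>
    (Finset.single_le_sum (f := fun j => |g.1 i j|) (fun _ _ => abs_nonneg _)
      (Finset.mem_univ j)).trans
    (Finset.single_le_sum (f := fun i => ∑ j, |g.1 i j|)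
      (fun _ _ => Finset.sum_nonneg fun _ _ => abs_nonneg _) (Finset.mem_univ i))
  obtain ⟨ε₀, hε₀, H⟩ := exists_dyadic_scale (κ := κ) (κ' := (5 + κ) / 2) (by linarith)
    (by linarith) (81 * a * b) n₀
  refine ⟨ε₀, hε₀, fun ε hε hlt => ?_⟩
  obtain ⟨k, hk, hkε, hkC⟩ := H ε hε hlt
  have hs : 0 ≤ (5 + κ) / 2 * (k * Real.log 2) := by
    have := Real.log_nonneg one_le_two
    have : 0 ≤ (5 + κ) / 2 := by linarith
    positivity
  obtain ⟨γ, p, r, hr, hγ, hgram⟩ := exists_integral_frame (hn₀ k hk)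
  refine ⟨γ, ?_, ?_⟩
  · refine (pi_norm_lt_iff hε).2 fun i => (pi_norm_lt_iff hε).2 fun j => ?_
    rw [hγ]
    change ‖((g.1 * ((theta _ p).1 * r.1))ᵀ * ((g⁻¹).1ᵀ * Jmat * (g⁻¹).1) *
      (g.1 * ((theta _ p).1 * r.1)) - r0.1ᵀ * Jmat * r0.1) i j‖ < ε
    rw [hgram, Real.norm_eq_abs]
    exact (hr.2 i j).trans hkε
  · have hpos : 0 < ε ^ (-κ) := Real.rpow_pos_of_pos hε _
    refine (pi_norm_lt_iff hpos).2 fun i => (pi_norm_lt_iff hpos).2 fun j => ?_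
    rw [hγ, Real.norm_eq_abs]
    refine (abs_mul_apply_le hb
      (abs_mul_apply_le (abs_theta_apply_le hs p) (ha r hr.1)) i j).trans_lt
      (lt_of_eq_of_lt ?_ hkC)
    ring
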